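/- Let s ≥ 2 be a natural number, let m be a natural number, and let A be a finite non-empty subset of S_{4,m}. For every ε > 0 there is a constant C(s, ε) > 0, independent of m and A, such that E_{s,2}(A) ≤ C(s, ε) · m^ε · ( |A|^{(12s−7)/8} · E_{s−1,2}(A)^{1/4} + |A|^{2s−2} ). -/

import Mathlib

open Finset

noncomputable section

/-- The set of lattice points on the sphere of radius `√m` in `ℤ^d`. -/
def latSphere (d m : ℕ) : Set (Fin d → ℤ) := {x | ∑ i, x i ^ 2 = (m : ℤ)}

/-- The additive energy `E_{s,2}(A)`: the number of `2s`-tuples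
`(x₁, …, x_{2s}) ∈ A^{2s}` with `x₁ + ⋯ + x_s = x_{s+1} + ⋯ + x_{2s}`. -/
def addEnergy {V : Type*} [AddCommMonoid V] (s : ℕ) (A : Set V) : ℕ :=
  Nat.card {p : (Fin s → V) × (Fin s → V) //
    (∀ i, p.1 i ∈ A) ∧ (∀ i, p.2 i ∈ A) ∧ ∑ i, p.1 i = ∑ i, p.2 i}

/-- The representation function `r_s(A, n)`: the number of `s`-tuples
`(x₁, …, x_s) ∈ A^s` with `x₁ + ⋯ + x_s = n`. -/
def repCount {V : Type*} [AddCommMonoid V] (s : ℕ) (A : Set V) (n : V) : ℕ :=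
  Nat.card {x : Fin s → V // (∀ i, x i ∈ A) ∧ ∑ i, x i = n}


/-- Subcubes of dimension `k` contained in a set family, given by bottom and top. -/
def cub {ι : Type*} [DecidableEq ι] (k : ℕ) (P : Finset (Finset ι)) :
    Finset (Finset ι × Finset ι) := by
  classical
  exact (P ×ˢ P).filter fun q => q.1 ⊆ q.2 ∧ #(q.2 \ q.1) = k ∧
    ∀ T, q.1 ⊆ T → T ⊆ q.2 → T ∈ P

theorem mem_cub {ι : Type*} [DecidableEq ι] {k : ℕ} {P : Finset (Finset ι)}
    {q : Finset ι × Finset ι} : q ∈ cub k P ↔ q.1 ⊆ q.2 ∧ #(q.2 \ q.1) = k ∧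
    ∀ T, q.1 ⊆ T → T ⊆ q.2 → T ∈ P := by
  classical
  unfold cub
  simp only [mem_filter, mem_product]
  constructor
  · rintro ⟨_, h⟩; exact h
  · rintro ⟨h1, h2, h3⟩
    exact ⟨⟨h3 _ (Subset.refl _) h1, h3 _ h1 (Subset.refl _)⟩, h1, h2, h3⟩

theorem cub_split {ι : Type*} [DecidableEq ι] (k : ℕ) (P : Finset (Finset ι)) (h : ι) :
    #(cub (k+1) P) ≤ #(cub (k+1) (P.nonMemberSubfamily h)) + #(cub (k+1) (P.memberSubfamily h))
      + #(cub k (P.nonMemberSubfamily h ∩ P.memberSubfamily h)) := by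
  classical
  have hsub : cub (k+1) P ⊆ (cub (k+1) (P.nonMemberSubfamily h) ∪
      (cub (k+1) (P.memberSubfamily h)).image (fun q => (insert h q.1, insert h q.2))) ∪
      (cub k (P.nonMemberSubfamily h ∩ P.memberSubfamily h)).image
        (fun q => (q.1, insert h q.2)) := by
    rintro ⟨B, B'⟩ hq
    rw [mem_cub] at hq
    obtain ⟨h1, h2, h3⟩ := hq
    simp only [] at h1 h2 h3
    simp only [mem_union, mem_image]
    by_cases hB' : h ∈ B'
    · by_cases hB : h ∈ B
      · left; right
        refine ⟨(B.erase h, B'.erase h), ?_, by simp [insert_erase hB, insert_erase hB']⟩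
        rw [mem_cub]
        refine ⟨erase_subset_erase _ h1, ?_, ?_⟩
        · rw [← h2]; congr 1; ext x; simp only [mem_sdiff, mem_erase]
          constructor
          · rintro ⟨⟨a, b⟩, c⟩; exact ⟨b, fun d => c ⟨a, d⟩⟩
          · rintro ⟨a, b⟩
            refine ⟨⟨?_, a⟩, fun d => b d.2⟩
            rintro rfl; exact b hB
        · intro T hT1 hT2
          simp only [] at hT1 hT2
          rw [mem_memberSubfamily]
          have hT : h ∉ T := fun hh => by simpa using hT2 hh
          refine ⟨h3 _ ?_ ?_, hT⟩
          · rw [← insert_erase hB]; exact insert_subset_insert _ hT1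
          · rw [← insert_erase hB']; exact insert_subset_insert _ hT2
      · right
        refine ⟨(B, B'.erase h), ?_, by simp [insert_erase hB']⟩
        rw [mem_cub]
        refine ⟨?_, ?_, ?_⟩
        · exact subset_erase.2 ⟨h1, hB⟩
        · have : B' \ B = insert h (B'.erase h \ B) := by
            ext x; simp only [mem_sdiff, mem_erase, mem_insert]
            by_cases hx : x = h
            · subst hx; simp [hB, hB']
            · simp [hx]
          rw [this, card_insert_of_notMem (by simp)] at h2
          simpa using h2
        · intro T hT1 hT2
          simp only [] at hT1 hT2
          have hT : h ∉ T := fun hh => by simpa using hT2 hh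
          rw [mem_inter, mem_memberSubfamily, mem_nonMemberSubfamily]
          refine ⟨⟨h3 _ hT1 (hT2.trans (erase_subset _ _)), hT⟩, h3 _ ?_ ?_, hT⟩
          · exact hT1.trans (subset_insert _ _)
          · rw [← insert_erase hB']; exact insert_subset_insert _ hT2
    · left; left
      rw [mem_cub]
      refine ⟨h1, h2, ?_⟩
      intro T hT1 hT2
      rw [mem_nonMemberSubfamily]
      exact ⟨h3 T hT1 hT2, fun hh => hB' (hT2 hh)⟩
  calc _ ≤ _ := card_le_card hsub
    _ ≤ _ := card_union_le _ _
    _ ≤ _ := Nat.add_le_add ((card_union_le _ _).trans (Nat.add_le_add_left card_image_le _))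
        card_image_le

theorem cub_add_le {ι : Type*} [DecidableEq ι] (k : ℕ) (P Q : Finset (Finset ι)) :
    #(cub k P) + #(cub k Q) ≤ #(cub k (P ∪ Q)) + #(cub k (P ∩ Q)) := by
  classical
  rw [← card_union_add_card_inter]
  apply Nat.add_le_add
  · apply card_le_card
    intro q hq
    rw [mem_union, mem_cub, mem_cub] at hq
    rw [mem_cub]
    rcases hq with hq | hq
    · exact ⟨hq.1, hq.2.1, fun T a b => mem_union_left _ (hq.2.2 T a b)⟩
    · exact ⟨hq.1, hq.2.1, fun T a b => mem_union_right _ (hq.2.2 T a b)⟩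
  · apply card_le_card
    intro q hq
    rw [mem_inter, mem_cub, mem_cub] at hq
    rw [mem_cub]
    exact ⟨hq.1.1, hq.1.2.1, fun T a b => mem_inter.2 ⟨hq.1.2.2 T a b, hq.2.2.2 T a b⟩⟩

theorem cub_zero {ι : Type*} [DecidableEq ι] (P : Finset (Finset ι)) : #(cub 0 P) ≤ #P := by
  classical
  apply card_le_card_of_injOn (fun q => q.1)
  · intro q hq
    have hq := mem_cub.1 hq
    exact hq.2.2 _ (Subset.refl _) hq.1
  · intro q hq q' hq' heq
    have hq := mem_cub.1 hq
    have hq' := mem_cub.1 hq'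
    have e1 := Subset.antisymm hq.1 (sdiff_eq_empty_iff_subset.1 (card_eq_zero.1 hq.2.1))
    have e2 := Subset.antisymm hq'.1 (sdiff_eq_empty_iff_subset.1 (card_eq_zero.1 hq'.2.1))
    simp only [] at heq
    exact Prod.ext heq (by rw [← e1, ← e2, heq])

/-- The number of `k`-cubes in a family of VC-dimension at most `D`. -/
theorem cub_bound {ι : Type*} [DecidableEq ι] (S : Finset ι) : ∀ (k D : ℕ) (P : Finset (Finset ι)),
    (∀ p ∈ P, p ⊆ S) → (∀ X, P.Shatters X → #X ≤ D) → #(cub k P) ≤ D.choose k * #P := by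
  classical
  induction S using Finset.induction_on with
  | empty =>
    intro k D P hP hD
    rcases k with _ | k
    · simpa using cub_zero P
    · have : cub (k+1) P = ∅ := by
        rw [eq_empty_iff_forall_notMem]
        intro q hq
        obtain ⟨h1, h2, h3⟩ := mem_cub.1 hq
        have := hP _ (h3 _ h1 (Subset.refl _))
        rw [subset_empty.1 this] at h2
        simp at h2
      simp [this]
  | insert h S hh ih =>
    intro k D P hP hD
    rcases k with _ | k
    · simpa using cub_zero P
    set P0 := P.nonMemberSubfamily h with hP0
    set P1 := P.memberSubfamily h with hP1
    have hs0 : ∀ p ∈ P0, p ⊆ S := by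
      intro p hp
      rw [hP0, mem_nonMemberSubfamily] at hp
      exact (subset_insert_iff_of_notMem hp.2).1 (hP p hp.1)
    have hs1 : ∀ p ∈ P1, p ⊆ S := by
      intro p hp
      rw [hP1, mem_memberSubfamily] at hp
      have := hP _ hp.1
      intro x hx
      have h2 := this (mem_insert_of_mem hx)
      rcases mem_insert.1 h2 with rfl | h2
      · exact absurd hx hp.2
      · exact h2
    have hsu : ∀ p ∈ P0 ∪ P1, p ⊆ S := by
      intro p hp; rcases mem_union.1 hp with hp | hp
      · exact hs0 p hp
      · exact hs1 p hp
    have hsi : ∀ p ∈ P0 ∩ P1, p ⊆ S := fun p hp => hs0 p (mem_inter.1 hp).1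
    have hcard : #(P0 ∪ P1) + #(P0 ∩ P1) = #P := by
      rw [card_union_add_card_inter, add_comm, hP0, hP1, card_memberSubfamily_add_card_nonMemberSubfamily]
    have hvu : ∀ X, (P0 ∪ P1).Shatters X → #X ≤ D := by
      intro X hX
      apply hD
      have hXS : h ∉ X := by
        intro hx
        obtain ⟨u, hu, hu2⟩ := hX (Subset.refl X)
        have : h ∈ u := by
          have : h ∈ X ∩ u := by rw [hu2]; exact hx
          exact (mem_inter.1 this).2
        exact hh (hsu u hu this)
      intro t ht
      obtain ⟨u, hu, hu2⟩ := hX ht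
      rcases mem_union.1 hu with hu | hu
      · exact ⟨u, (mem_nonMemberSubfamily.1 hu).1, hu2⟩
      · exact ⟨insert h u, (mem_memberSubfamily.1 hu).1, by rw [inter_insert_of_notMem hXS, hu2]⟩
    have h1 := cub_split k P h
    have h2 := cub_add_le (k+1) P0 P1
    have h3 := ih (k+1) D _ hsu hvu
    by_cases hne : (P0 ∩ P1) = ∅
    · have e : ∀ j, cub j (P0 ∩ P1) = ∅ := by
        intro j
        rw [eq_empty_iff_forall_notMem]
        intro q hq
        obtain ⟨h1, h2, h3⟩ := mem_cub.1 hq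
        have := (h3 _ h1 (Subset.refl _))
        simp [hne] at this
      have e2 : #(P0 ∪ P1) = #P := by rw [hne] at hcard; simpa using hcard
      rw [e] at h2
      rw [← hP0, ← hP1, e] at h1
      simp only [card_empty] at h1 h2
      rw [e2] at h3
      omega
    · have hvi : ∀ X, (P0 ∩ P1).Shatters X → #X + 1 ≤ D := by
        intro X hX
        have hXS : h ∉ X := by
          intro hx
          obtain ⟨u, hu, hu2⟩ := hX (Subset.refl X)
          have : h ∈ u := by
            have : h ∈ X ∩ u := by rw [hu2]; exact hx
            exact (mem_inter.1 this).2
          exact hh (hsi u hu this)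
        rw [← card_insert_of_notMem hXS]
        apply hD
        intro t ht
        obtain ⟨u, hu, hu2⟩ := hX (t := t.erase h) (by
          intro x hx
          have := ht (mem_of_mem_erase hx)
          rcases mem_insert.1 this with rfl | h'
          · simp at hx
          · exact h')
        have hu' := mem_inter.1 hu
        have hu0 := mem_nonMemberSubfamily.1 hu'.1
        by_cases hht : h ∈ t
        · refine ⟨insert h u, (mem_memberSubfamily.1 hu'.2).1, ?_⟩
          rw [← insert_inter_distrib, hu2, insert_erase hht]
        · refine ⟨u, hu0.1, ?_⟩
          rw [insert_inter_of_notMem hu0.2, hu2, erase_eq_of_notMem hht]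
      have hD1 : 1 ≤ D := by
        obtain ⟨p, hp⟩ := nonempty_iff_ne_empty.2 hne
        have := hvi ∅ (by
          intro t ht
          exact ⟨p, hp, by rw [subset_empty.1 ht]; simp⟩)
        simpa using this
      obtain ⟨D', rfl⟩ : ∃ D', D = D' + 1 := ⟨D - 1, by omega⟩
      have h4 := ih (k+1) D' _ hsi (fun X hX => by have := hvi X hX; omega)
      have h5 := ih k D' _ hsi (fun X hX => by have := hvi X hX; omega)
      rw [← hP0, ← hP1] at h1
      have : (D'+1).choose (k+1) * #P = (D'+1).choose (k+1) * #(P0 ∪ P1) +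
          (D'.choose (k+1) * #(P0 ∩ P1) + D'.choose k * #(P0 ∩ P1)) := by
        rw [← hcard, mul_add, Nat.choose_succ_succ]; ring
      omega


/-- Sign patterns on `S` realised by the points of `U`. -/
def pat {ι Y : Type*} [DecidableEq ι] (f : ι → Y → ℝ) (U : Finset Y) (S : Finset ι) :
    Finset (Finset ι) := by
  classical
  exact U.image (fun u => S.filter (fun i => 0 < f i u))

theorem mem_pat {ι Y : Type*} [DecidableEq ι] {f : ι → Y → ℝ} {U : Finset Y} {S : Finset ι}
    {B : Finset ι} : B ∈ pat f U S ↔ ∃ u ∈ U, ∀ i, i ∈ B ↔ i ∈ S ∧ 0 < f i u := by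
  classical
  unfold pat
  simp only [mem_image]
  constructor
  · rintro ⟨u, hu, rfl⟩
    exact ⟨u, hu, fun i => by simp⟩
  · rintro ⟨u, hu, h⟩
    exact ⟨u, hu, by ext i; simp [h]⟩

theorem pat_erase {ι Y : Type*} [DecidableEq ι] {f : ι → Y → ℝ} {U : Finset Y} {S : Finset ι}
    {B : Finset ι} (h : ι) (hB : B ∈ pat f U S) : B.erase h ∈ pat f U (S.erase h) := by
  rw [mem_pat] at *
  obtain ⟨u, hu, hb⟩ := hB
  refine ⟨u, hu, fun i => ?_⟩
  simp only [mem_erase, hb]; tauto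

/-- Pseudo-faces of an arrangement, decorated by cubes of sign patterns. -/
def Obj {ι Y : Type*} [DecidableEq ι] [Fintype ι] (f : ι → Y → ℝ) (U : Finset Y)
    (k j : ℕ) (S : Finset ι) : Finset (Finset ι × Finset ι × Finset ι) := by
  classical
  exact univ.filter fun o => o.1 ⊆ S ∧ #o.1 = k ∧ o.2.1 ⊆ o.1 ∧ #o.2.1 = j ∧ o.2.2 ⊆ S ∧
    Disjoint o.2.1 o.2.2 ∧ (∀ T, T ⊆ o.2.1 → o.2.2 ∪ T ∈ pat f U S) ∧
    ∃ y, (∀ i ∈ o.1, f i y = 0) ∧ ∀ i ∈ S, i ∉ o.1 →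
      ((i ∈ o.2.2 → 0 < f i y) ∧ (i ∉ o.2.2 → f i y < 0))

theorem mem_Obj {ι Y : Type*} [DecidableEq ι] [Fintype ι] {f : ι → Y → ℝ} {U : Finset Y}
    {k j : ℕ} {S Z J B : Finset ι} : (Z, J, B) ∈ Obj f U k j S ↔
    Z ⊆ S ∧ #Z = k ∧ J ⊆ Z ∧ #J = j ∧ B ⊆ S ∧
    Disjoint J B ∧ (∀ T, T ⊆ J → B ∪ T ∈ pat f U S) ∧
    ∃ y, (∀ i ∈ Z, f i y = 0) ∧ ∀ i ∈ S, i ∉ Z →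
      ((i ∈ B → 0 < f i y) ∧ (i ∉ B → f i y < 0)) := by
  classical
  unfold Obj
  simp

/-- affine function -/
def af {ι Y : Type*} [AddCommGroup Y] [Module ℝ Y] (L : ι → Y →ₗ[ℝ] ℝ) (c : ι → ℝ) (i : ι)
    (y : Y) : ℝ := L i y + c i

theorem af_add {ι Y : Type*} [AddCommGroup Y] [Module ℝ Y] (L : ι → Y →ₗ[ℝ] ℝ) (c : ι → ℝ) (i : ι)
    (y d : Y) (t : ℝ) : af L c i (y + t • d) = af L c i y + t * L i d := by
  simp [af]; ring

/-- generic arrangement in dimension five -/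
structure Gn {ι Y : Type*} [AddCommGroup Y] [Module ℝ Y] (L : ι → Y →ₗ[ℝ] ℝ) (c : ι → ℝ) : Prop where
  g0 : ∀ Z : Finset ι, #Z ≤ 4 → ∃ d : Y, d ≠ 0 ∧ ∀ i ∈ Z, L i d = 0
  g1 : ∀ Z : Finset ι, #Z = 5 → ∀ d : Y, (∀ i ∈ Z, L i d = 0) → d = 0
  g2 : ∀ Z : Finset ι, ∀ y : Y, (∀ i ∈ Z, af L c i y = 0) → #Z ≤ 5

theorem small_move {ι Y : Type*} [AddCommGroup Y] [Module ℝ Y]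
    (L : ι → Y →ₗ[ℝ] ℝ) (c : ι → ℝ) (S : Finset ι) (y d : Y) :
    ∃ t : ℝ, 0 < t ∧ ∀ i ∈ S, (0 < af L c i y → 0 < af L c i (y + t • d)) ∧
      (af L c i y < 0 → af L c i (y + t • d) < 0) := by
  have : ∀ᶠ t in nhdsWithin (0:ℝ) (Set.Ioi 0), ∀ i ∈ S, (0 < af L c i y → 0 < af L c i (y + t • d)) ∧
      (af L c i y < 0 → af L c i (y + t • d) < 0) := by
    rw [Filter.eventually_all_finset]
    intro i _
    have hc : Filter.Tendsto (fun t : ℝ => af L c i (y + t • d)) (nhdsWithin (0:ℝ) (Set.Ioi 0))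
        (nhds (af L c i y)) := by
      have : Continuous (fun t : ℝ => af L c i y + t * L i d) := by fun_prop
      have h := this.tendsto 0
      simp only [zero_mul, add_zero] at h
      simp only [af_add]
      exact h.mono_left nhdsWithin_le_nhds
    rcases lt_trichotomy (af L c i y) 0 with h | h | h
    · filter_upwards [hc.eventually (gt_mem_nhds h)] with t ht
      exact ⟨fun h' => absurd h' (by linarith), fun _ => ht⟩
    · filter_upwards with t
      exact ⟨fun h' => absurd h' (by linarith), fun h' => absurd h' (by linarith)⟩
    · filter_upwards [hc.eventually (lt_mem_nhds h)] with t ht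
      exact ⟨fun _ => ht, fun h' => absurd h' (by linarith)⟩
  obtain ⟨t, h1, h2⟩ := (this.and self_mem_nhdsWithin).exists
  exact ⟨t, h2, h1⟩

theorem ker_line {ι Y : Type*} [DecidableEq ι] [AddCommGroup Y] [Module ℝ Y]
    {L : ι → Y →ₗ[ℝ] ℝ} {c : ι → ℝ} (G : Gn L c) (Z : Finset ι) (hZ : #Z = 4) (h : ι) (hh : h ∉ Z)
    (d e : Y) (hd : d ≠ 0) (hd0 : ∀ i ∈ Z, L i d = 0) (he0 : ∀ i ∈ Z, L i e = 0) :
    L h d ≠ 0 ∧ ∃ t : ℝ, e = t • d := by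
  have hc : #(insert h Z) = 5 := by rw [card_insert_of_notMem hh, hZ]
  have h1 : L h d ≠ 0 := by
    intro h0
    apply hd
    apply G.g1 (insert h Z) hc
    intro i hi
    rcases mem_insert.1 hi with rfl | hi
    · exact h0
    · exact hd0 i hi
  refine ⟨h1, L h e / L h d, ?_⟩
  rw [← sub_eq_zero]
  apply G.g1 (insert h Z) hc
  intro i hi
  rcases mem_insert.1 hi with rfl | hi
  · simp; field_simp; ring
  · simp [hd0 i hi, he0 i hi]

theorem P0_le {ι Y : Type*} [DecidableEq ι] [Fintype ι] [AddCommGroup Y] [Module ℝ Y]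
    {L : ι → Y →ₗ[ℝ] ℝ} {c : ι → ℝ} (G : Gn L c) (U : Finset Y) (j : ℕ) (hj : j ≤ 4)
    (S : Finset ι) : #(Obj (af L c) U 5 j S) ≤ 2 * #(Obj (af L c) U 4 j S) := by
  classical
  have key : ∀ o ∈ Obj (af L c) U 5 j S, ∃ h ∈ o.1, (o.1.erase h, o.2) ∈ Obj (af L c) U 4 j S := by
    rintro ⟨Z, J, B⟩ ho
    rw [mem_Obj] at ho
    obtain ⟨hZS, hZ, hJ, hJj, hBS, hd, hp, y, hy0, hy1⟩ := ho
    obtain ⟨h, hhZ, hhJ⟩ : ∃ h ∈ Z, h ∉ J := by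
      by_contra hcon
      push Not at hcon
      have := card_le_card (show Z ⊆ J from hcon)
      omega
    refine ⟨h, hhZ, ?_⟩
    have hc4 : #(Z.erase h) = 4 := by rw [card_erase_of_mem hhZ, hZ]
    obtain ⟨d0, hd0, hdk⟩ := G.g0 (Z.erase h) hc4.le
    have hne := (ker_line G (Z.erase h) hc4 h (by simp) d0 d0 hd0 hdk hdk).1
    obtain ⟨d, hdZ, hdB⟩ : ∃ d : Y, (∀ i ∈ Z.erase h, L i d = 0) ∧
        ((h ∈ B → 0 < L h d) ∧ (h ∉ B → L h d < 0)) := by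
      by_cases hb : h ∈ B
      · refine ⟨(L h d0) • d0, fun i hi => by simp [hdk i hi], fun _ => ?_, fun h' => absurd hb h'⟩
        simp; exact hne
      · refine ⟨(-L h d0) • d0, fun i hi => by simp [hdk i hi], fun h' => absurd h' hb, fun _ => ?_⟩
        simp; exact hne
    obtain ⟨t, ht, hts⟩ := small_move L c S y d
    rw [mem_Obj]
    refine ⟨(erase_subset _ _).trans hZS, hc4, fun i hi => mem_erase.2 ⟨fun e => hhJ (e ▸ hi), hJ hi⟩,
      hJj, hBS, hd, hp, y + t • d, ?_, ?_⟩
    · intro i hi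
      rw [af_add, hy0 i (mem_of_mem_erase hi), hdZ i hi]; simp
    · intro i hi hiZ
      by_cases hih : i = h
      · subst hih
        rw [af_add, hy0 i hhZ]
        constructor
        · intro hb; have := hdB.1 hb; positivity
        · intro hb; have := hdB.2 hb; nlinarith
      · have hiZ' : i ∉ Z := fun h' => hiZ (mem_erase.2 ⟨hih, h'⟩)
        exact ⟨fun hb => (hts i hi).1 ((hy1 i hi hiZ').1 hb), fun hb => (hts i hi).2 ((hy1 i hi hiZ').2 hb)⟩
  rcases isEmpty_or_nonempty ι with hemp | hne
  · have : Obj (af L c) U 5 j S = ∅ := by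
      rw [eq_empty_iff_forall_notMem]
      rintro ⟨Z, J, B⟩ ho
      have := (mem_Obj.1 ho).2.1
      rw [eq_empty_of_isEmpty Z] at this
      simp at this
    rw [this]; simp
  choose! g hg1 hg2 using key
  have hle := Finset.card_le_mul_card_image (f := fun o => ((o.1.erase (g o), o.2) : Finset ι × Finset ι × Finset ι))
    (Obj (af L c) U 5 j S) 2 ?_
  · refine hle.trans (Nat.mul_le_mul_left _ (card_le_card ?_))
    intro q hq
    obtain ⟨o, ho, rfl⟩ := mem_image.1 hq
    exact hg2 o ho
  rintro ⟨Z', J, B⟩ hq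
  have hq4 : (Z', J, B) ∈ Obj (af L c) U 4 j S := by
    obtain ⟨o, ho, h⟩ := mem_image.1 hq
    rw [← h]; exact hg2 o ho
  have hZ4 := (mem_Obj.1 hq4).2.1
  have hst : ∀ o ∈ Obj (af L c) U 5 j S, (o.1.erase (g o), o.2) = (Z', J, B) →
      ∃ h y, h ∈ S ∧ h ∉ Z' ∧ o = (insert h Z', J, B) ∧ (∀ i ∈ Z', af L c i y = 0) ∧ af L c h y = 0 ∧
        ∀ i ∈ S, i ∉ Z' → i ≠ h → ((i ∈ B → 0 < af L c i y) ∧ (i ∉ B → af L c i y < 0)) := by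
    rintro ⟨Z, J1, B1⟩ ho he
    simp only [Prod.mk.injEq] at he
    obtain ⟨h1, rfl, rfl⟩ := he
    have hgm := hg1 _ ho
    have ho' := mem_Obj.1 ho
    obtain ⟨hZS, hZ, hJ, hJj, hBS, hd, hp, y, hy0, hy1⟩ := ho'
    refine ⟨g (Z, J1, B1), y, hZS hgm, ?_, ?_, ?_, ?_, ?_⟩
    · rw [← h1]; simp
    · rw [← h1, insert_erase hgm]
    · intro i hi; rw [← h1] at hi; exact hy0 i (mem_of_mem_erase hi)
    · exact hy0 _ hgm
    · intro i hi hi' hne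
      exact hy1 i hi (fun h => hi' (by rw [← h1]; exact mem_erase.2 ⟨hne, h⟩))
  by_contra hcon
  push Not at hcon
  rw [two_lt_card] at hcon
  obtain ⟨o1, m1, o2, m2, o3, m3, n12, n13, n23⟩ := hcon
  rw [mem_filter] at m1 m2 m3
  obtain ⟨h1, y1, s1, z1, e1, a1, b1, c1⟩ := hst o1 m1.1 m1.2
  obtain ⟨h2, y2, s2, z2, e2, a2, b2, c2⟩ := hst o2 m2.1 m2.2
  obtain ⟨h3, y3, s3, z3, e3, a3, b3, c3⟩ := hst o3 m3.1 m3.2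
  have d12 : h1 ≠ h2 := by rintro rfl; exact n12 (by rw [e1, e2])
  have d13 : h1 ≠ h3 := by rintro rfl; exact n13 (by rw [e1, e3])
  have d23 : h2 ≠ h3 := by rintro rfl; exact n23 (by rw [e2, e3])
  have sg : ∀ i ∈ S, i ∉ Z' → ∀ x y : Y, ((i ∈ B → 0 < af L c i x) ∧ (i ∉ B → af L c i x < 0)) →
      ((i ∈ B → 0 < af L c i y) ∧ (i ∉ B → af L c i y < 0)) → 0 < af L c i x * af L c i y := by
    intro i _ _ x y hx hy
    by_cases hb : i ∈ B
    · exact mul_pos (hx.1 hb) (hy.1 hb)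
    · exact mul_pos_of_neg_of_neg (hx.2 hb) (hy.2 hb)
  have k1 := sg h1 s1 z1 y2 y3 (c2 h1 s1 z1 d12) (c3 h1 s1 z1 d13)
  have k2 := sg h2 s2 z2 y1 y3 (c1 h2 s2 z2 d12.symm) (c3 h2 s2 z2 d23)
  have k3 := sg h3 s3 z3 y1 y2 (c1 h3 s3 z3 d13.symm) (c2 h3 s3 z3 d23.symm)
  have hdne : y2 - y1 ≠ 0 := by
    intro h0
    have : y2 = y1 := sub_eq_zero.1 h0
    rw [this, b1] at k1
    simp at k1
  obtain ⟨-, t, ht⟩ := ker_line G Z' hZ4 h1 z1 (y2 - y1) (y3 - y1) hdne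
    (fun i hi => by have := a1 i hi; have := a2 i hi; simp only [af, map_sub] at *; linarith)
    (fun i hi => by have := a1 i hi; have := a3 i hi; simp only [af, map_sub] at *; linarith)
  have hy2 : y2 = y1 + (1:ℝ) • (y2 - y1) := by simp
  have hy3 : y3 = y1 + t • (y2 - y1) := by rw [← ht]; simp
  have r2 : ∀ i, af L c i y2 = af L c i y1 + L i (y2 - y1) := by
    intro i; conv_lhs => rw [hy2]
    rw [af_add]; ring
  have r3 : ∀ i, af L c i y3 = af L c i y1 + t * L i (y2 - y1) := by
    intro i; conv_lhs => rw [hy3]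
    rw [af_add]
  have q2 := r2 h2
  have q3 := r3 h3
  rw [r2, r3, b1] at k1
  rw [r3] at k2
  rw [r2] at k3
  rw [b2] at q2
  rw [b3] at q3
  set A1 := L h1 (y2 - y1)
  set A2 := L h2 (y2 - y1)
  set A3 := L h3 (y2 - y1)
  have w2 : af L c h2 y1 = -A2 := by linarith
  have w3 : af L c h3 y1 = -(t*A3) := by linarith
  rw [w2] at k2
  rw [w3] at k3
  have t0 : 0 < t := by
    by_contra h
    nlinarith [sq_nonneg A1]
  have t1 : t < 1 := by
    by_contra h
    nlinarith [sq_nonneg A2]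
  nlinarith [mul_nonneg (mul_nonneg t0.le (sub_nonneg.2 t1.le)) (sq_nonneg A3)]

theorem P1_rec {ι Y : Type*} [DecidableEq ι] [Fintype ι] [AddCommGroup Y] [Module ℝ Y]
    (L : ι → Y →ₗ[ℝ] ℝ) (c : ι → ℝ) (U : Finset Y) (j : ℕ)
    (S : Finset ι) : (#S - 4) * #(Obj (af L c) U 4 j S) ≤
      ∑ h ∈ S, #(Obj (af L c) U 4 j (S.erase h)) + (j+1) * #(Obj (af L c) U 5 (j+1) S) := by
  classical
  set F := Obj (af L c) U 4 j S with hF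
  set F' := Obj (af L c) U 5 (j+1) S with hF'
  have e1 : (#S - 4) * #F = ∑ h ∈ S, #(F.filter (fun o => h ∉ o.1)) := by
    have hdc := sum_card_bipartiteAbove_eq_sum_card_bipartiteBelow (s := F) (t := S) (fun o h => h ∉ o.1)
    simp only [bipartiteBelow] at hdc
    rw [← hdc]
    rw [Finset.sum_congr rfl (g := fun _ => #S - 4), sum_const, smul_eq_mul, mul_comm]
    rintro ⟨Z, J, B⟩ ho
    have := mem_Obj.1 ho
    rw [← this.2.1, ← card_sdiff_of_subset this.1]
    congr 1; ext i; simp [bipartiteAbove]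
  have e2 : ∑ h ∈ S, #(F'.filter (fun o => h ∈ o.2.1)) = (j+1) * #F' := by
    have hdc := sum_card_bipartiteAbove_eq_sum_card_bipartiteBelow (s := F') (t := S) (fun o h => h ∈ o.2.1)
    simp only [bipartiteBelow] at hdc
    rw [← hdc]
    rw [Finset.sum_congr rfl (g := fun _ => j+1), sum_const, smul_eq_mul, mul_comm]
    rintro ⟨Z, J, B⟩ ho
    have := mem_Obj.1 ho
    rw [← this.2.2.2.1]
    congr 1; ext i
    simp only [bipartiteAbove, mem_filter]
    exact ⟨fun h => h.2, fun h => ⟨this.1 (this.2.2.1 h), h⟩⟩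
  rw [e1, ← e2, ← sum_add_distrib]
  apply sum_le_sum
  intro h hS
  set er : Finset ι × Finset ι × Finset ι → Finset ι × Finset ι × Finset ι :=
    fun o => (o.1, o.2.1, o.2.2.erase h) with her
  set X := (F.filter (fun o => h ∉ o.1)).filter (fun o => h ∈ o.2.2)
  set X' := (F.filter (fun o => h ∉ o.1)).filter (fun o => ¬ h ∈ o.2.2)
  rw [← card_filter_add_card_filter_not (s := F.filter (fun o => h ∉ o.1)) (fun o => h ∈ o.2.2)]
  change #X + #X' ≤ _
  have iX : #(X.image er) = #X := by
    apply card_image_of_injOn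
    rintro ⟨Z, J, B⟩ hx ⟨Z1, J1, B1⟩ hx1 he
    simp only [X, mem_coe, mem_filter] at hx hx1
    simp only [her, Prod.mk.injEq] at he
    obtain ⟨rfl, rfl, he⟩ := he
    rw [← insert_erase hx.2, ← insert_erase hx1.2, he]
  have iX' : #(X'.image er) = #X' := by
    apply card_image_of_injOn
    rintro ⟨Z, J, B⟩ hx ⟨Z1, J1, B1⟩ hx1 he
    simp only [X', mem_coe, mem_filter] at hx hx1
    simp only [her, Prod.mk.injEq] at he
    obtain ⟨rfl, rfl, he⟩ := he
    rw [← erase_eq_of_notMem hx.2, ← erase_eq_of_notMem hx1.2, he]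
  rw [← iX, ← iX', ← card_union_add_card_inter]
  apply Nat.add_le_add
  · apply card_le_card
    have : ∀ o ∈ F.filter (fun o => h ∉ o.1), er o ∈ Obj (af L c) U 4 j (S.erase h) := by
      rintro ⟨Z, J, B⟩ ho
      rw [mem_filter] at ho
      obtain ⟨⟨hZS, hZ, hJ, hJj, hBS, hd, hp, y, hy0, hy1⟩, hhZ⟩ := And.imp_left mem_Obj.1 ho
      simp only at hhZ
      simp only [her]
      rw [mem_Obj]
      refine ⟨fun i hi => mem_erase.2 ⟨fun e => hhZ (e ▸ hi), hZS hi⟩, hZ, hJ, hJj,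
        erase_subset_erase _ hBS, hd.mono_right (erase_subset _ _), ?_, y, hy0, ?_⟩
      · intro T hT
        have := pat_erase h (hp T hT)
        rwa [erase_union_distrib, erase_eq_of_notMem (s := T) (fun h' => hhZ (hJ (hT h')))] at this
      · intro i hi hiZ
        have := hy1 i (mem_of_mem_erase hi) hiZ
        rw [mem_erase] at hi ⊢
        tauto
    apply union_subset
    · intro q hq
      obtain ⟨o, ho, rfl⟩ := mem_image.1 hq
      exact this o (mem_filter.1 ho).1
    · intro q hq
      obtain ⟨o, ho, rfl⟩ := mem_image.1 hq
      exact this o (mem_filter.1 ho).1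
  · apply card_le_card_of_injOn (fun o => (insert h o.1, insert h o.2.1, o.2.2))
    · rintro ⟨Z, J, B⟩ ho
      simp only [coe_inter, Set.mem_inter_iff, mem_coe, mem_image] at ho
      obtain ⟨⟨⟨Z1, J1, B1⟩, h1, h1e⟩, ⟨⟨Z2, J2, B2⟩, h2, h2e⟩⟩ := ho
      simp only [her, Prod.mk.injEq] at h1e h2e
      obtain ⟨rfl, rfl, h1e⟩ := h1e
      obtain ⟨rfl, rfl, h2e⟩ := h2e
      simp only [X, X', mem_filter] at h1 h2
      rw [erase_eq_of_notMem h2.2] at h2e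
      subst h2e
      obtain ⟨⟨ho1, hhZ⟩, hB1⟩ := h1
      obtain ⟨⟨ho2, -⟩, hB2⟩ := h2
      have hB1e : B1 = insert h B2 := by rw [← h1e, insert_erase hB1]
      subst hB1e
      obtain ⟨hZS, hZ, hJ, hJj, hBS, hd, hp, y, hy0, hy1⟩ := mem_Obj.1 ho1
      obtain ⟨-, -, -, -, hBS', hd', hp', y', hy0', hy1'⟩ := mem_Obj.1 ho2
      simp only [mem_coe, mem_filter, mem_insert_self, and_true]
      rw [mem_Obj]
      have hhJ : h ∉ J2 := fun h' => hhZ (hJ h')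
      have p1 : 0 < af L c h y := (hy1 h hS hhZ).1 (mem_insert_self _ _)
      have p2 : af L c h y' < 0 := (hy1' h hS hhZ).2 hB2
      set a := af L c h y
      set a' := af L c h y'
      have hcomb : ∀ i, af L c i (y' + (-a' / (a - a')) • (y - y')) =
          (a * af L c i y' + (-a') * af L c i y) / (a - a') := by
        intro i
        rw [af_add]
        have : L i (y - y') = af L c i y - af L c i y' := by simp [af]
        rw [this]
        have : a - a' ≠ 0 := by linarith
        field_simp; ring
      refine ⟨insert_subset hS hZS, by rw [card_insert_of_notMem hhZ, hZ], insert_subset_insert _ hJ,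
        by rw [card_insert_of_notMem hhJ, hJj], hBS', ?_, ?_, y' + (-a' / (a - a')) • (y - y'), ?_, ?_⟩
      · rw [disjoint_insert_left]; exact ⟨hB2, hd'⟩
      · intro T hT
        by_cases hhT : h ∈ T
        · have := hp (T.erase h) (by
            intro i hi; rw [mem_erase] at hi
            exact (mem_insert.1 (hT hi.2)).resolve_left hi.1)
          rwa [show insert h B2 ∪ T.erase h = B2 ∪ T by
            rw [insert_union, ← union_insert, insert_erase hhT]] at this
        · exact hp' T (fun i hi => (mem_insert.1 (hT hi)).resolve_left (fun e => hhT (e ▸ hi)))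
      · intro i hi
        rw [hcomb]
        rcases mem_insert.1 hi with rfl | hi
        · simp only [a, a']; ring
        · rw [hy0 i hi, hy0' i hi]; simp
      · intro i hi hiZ
        rw [mem_insert, not_or] at hiZ
        rw [hcomb]
        have q1 := hy1 i hi hiZ.2
        have q2 := hy1' i hi hiZ.2
        constructor
        · intro hb
          have := q1.1 (mem_insert_of_mem hb)
          have := q2.1 hb
          apply div_pos _ (by linarith)
          have : 0 < -a' := by linarith
          positivity
        · intro hb
          have := q1.2 (by rw [mem_insert]; tauto)
          have := q2.2 hb
          apply div_neg_of_neg_of_pos _ (by linarith)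
          nlinarith
    · rintro ⟨Z, J, B⟩ hx ⟨Z1, J1, B1⟩ hx1 he
      have hz : ∀ Z J B, (Z, J, B) ∈ X.image er ∩ X'.image er → h ∉ Z ∧ h ∉ J := by
        intro Z J B hx
        simp only [mem_inter, mem_image] at hx
        obtain ⟨⟨⟨Z1, J1, B1⟩, h1, h1e⟩, -⟩ := hx
        simp only [her, Prod.mk.injEq] at h1e
        simp only [X, mem_filter] at h1
        obtain ⟨rfl, rfl, h1e⟩ := h1e
        exact ⟨h1.1.2, fun h' => h1.1.2 ((mem_Obj.1 h1.1.1).2.2.1 h')⟩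
      have u1 := hz _ _ _ (mem_coe.1 hx)
      have u2 := hz _ _ _ (mem_coe.1 hx1)
      simp only [Prod.mk.injEq] at he ⊢
      obtain ⟨a1, a2, a3⟩ := he
      refine ⟨?_, ?_, a3⟩
      · rw [← erase_insert u1.1, a1, erase_insert u2.1]
      · rw [← erase_insert u1.2, a2, erase_insert u2.2]


theorem P1_bound {ι Y : Type*} [DecidableEq ι] [Fintype ι] [AddCommGroup Y] [Module ℝ Y]
    (L : ι → Y →ₗ[ℝ] ℝ) (c : ι → ℝ) (U : Finset Y) (j : ℕ) (hj : j ≤ 4) (a : ℝ) (ha : 1 ≤ a)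
    (h5 : ∀ S : Finset ι, (#(Obj (af L c) U 5 (j+1) S) : ℝ) ≤ a * (#S : ℝ)^4) :
    ∀ k : ℕ, ∀ S : Finset ι, #S = k + 4 → (#(Obj (af L c) U 4 j S) : ℝ) ≤
      135 * a * ((k+4)*(k+3)*(k+2)*(k+1)) * (harmonic (k+4) : ℝ) := by
  intro k
  induction k with
  | zero =>
    intro S hS
    have h1 : #(Obj (af L c) U 4 j S) ≤ 256 := by
      calc #(Obj (af L c) U 4 j S) ≤ #(({S} : Finset (Finset ι)) ×ˢ (S.powerset ×ˢ S.powerset)) := by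
            apply card_le_card
            rintro ⟨Z, J, B⟩ ho
            obtain ⟨h1, h2, h3, h4, h5, -⟩ := mem_Obj.1 ho
            have : Z = S := eq_of_subset_of_card_le h1 (by omega)
            subst this
            simp [h3, h5]
        _ = 256 := by simp [hS]
    have h2 : (#(Obj (af L c) U 4 j S) : ℝ) ≤ 256 := by exact_mod_cast h1
    have h3 : (harmonic (0+4) : ℝ) = 25/12 := by
      rw [harmonic]; norm_num [Finset.sum_range_succ]
    rw [h3]
    push_cast
    nlinarith
  | succ k ih =>
    intro S hS
    have hrec := P1_rec L c U j S
    have hk : #S - 4 = k + 1 := by omega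
    rw [hk] at hrec
    have hrec' : ((k:ℝ)+1) * (#(Obj (af L c) U 4 j S) : ℝ) ≤
        ∑ h ∈ S, (#(Obj (af L c) U 4 j (S.erase h)) : ℝ) + ((j:ℝ)+1) * (#(Obj (af L c) U 5 (j+1) S) : ℝ) := by
      exact_mod_cast hrec
    have hs : ∑ h ∈ S, (#(Obj (af L c) U 4 j (S.erase h)) : ℝ) ≤
        ((k:ℝ)+5) * (135 * a * ((k+4)*(k+3)*(k+2)*(k+1)) * (harmonic (k+4) : ℝ)) := by
      calc _ ≤ ∑ h ∈ S, (135 * a * (((k:ℝ)+4)*(k+3)*(k+2)*(k+1)) * (harmonic (k+4) : ℝ)) := by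
            apply sum_le_sum
            intro h hh
            exact ih _ (by rw [card_erase_of_mem hh, hS]; omega)
        _ = _ := by rw [sum_const, hS, nsmul_eq_mul]; push_cast; ring
    have h5' := h5 S
    rw [hS] at h5'
    have hj' : (j:ℝ) ≤ 4 := by exact_mod_cast hj
    have hh : (harmonic (k+1+4) : ℝ) = harmonic (k+4) + 1/((k:ℝ)+5) := by
      rw [show k+1+4 = (k+4)+1 by ring, harmonic_succ]; push_cast; rw [one_div]; ring
    rw [hh]
    have hk0 : (0:ℝ) ≤ k := by positivity
    push_cast at h5' ⊢
    have hb : ((j:ℝ)+1) * (#(Obj (af L c) U 5 (j+1) S) : ℝ) ≤ 5 * (a * ((k:ℝ)+1+4)^4) := by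
      apply mul_le_mul (by linarith) h5' (by positivity) (by norm_num)
    have hp : 5 * ((k:ℝ)+1+4)^4 ≤ (k+1)*135*((k+4)*(k+3)*(k+2)) := by
      nlinarith [pow_nonneg hk0 2, pow_nonneg hk0 3, pow_nonneg hk0 4]
    have hp2 : 5 * (a * ((k:ℝ)+1+4)^4) ≤ a * ((k+1)*135*((k+4)*(k+3)*(k+2))) := by nlinarith
    have : (0:ℝ) < (k:ℝ)+1 := by positivity
    refine le_of_mul_le_mul_left ?_ this
    refine (hrec'.trans (add_le_add hs (hb.trans hp2))).trans (le_of_eq ?_)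
    field_simp
    ring

theorem P1_bound' {ι Y : Type*} [DecidableEq ι] [Fintype ι] [AddCommGroup Y] [Module ℝ Y]
    (L : ι → Y →ₗ[ℝ] ℝ) (c : ι → ℝ) (U : Finset Y) (j : ℕ) (hj : j ≤ 4) (a : ℝ) (ha : 1 ≤ a)
    (h5 : ∀ S : Finset ι, (#(Obj (af L c) U 5 (j+1) S) : ℝ) ≤ a * (#S : ℝ)^4)
    (S : Finset ι) : (#(Obj (af L c) U 4 j S) : ℝ) ≤
      135 * a * (1 + Real.log (Fintype.card ι)) * (#S : ℝ)^4 := by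
  by_cases h4 : #S < 4
  · have : Obj (af L c) U 4 j S = ∅ := by
      rw [eq_empty_iff_forall_notMem]
      rintro ⟨Z, J, B⟩ ho
      have := card_le_card (mem_Obj.1 ho).1
      have := (mem_Obj.1 ho).2.1
      omega
    rw [this]
    have : 0 ≤ Real.log (Fintype.card ι) := Real.log_natCast_nonneg _
    simp
    positivity
  · obtain ⟨k, hk⟩ : ∃ k, #S = k + 4 := ⟨#S - 4, by omega⟩
    refine (P1_bound L c U j hj a ha h5 k S hk).trans ?_
    have h1 : (harmonic (k+4) : ℝ) ≤ 1 + Real.log (Fintype.card ι) := by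
      refine (harmonic_le_one_add_log _).trans ?_
      have : Real.log ((k+4 : ℕ):ℝ) ≤ Real.log (Fintype.card ι) := by
        apply Real.log_le_log (by positivity)
        rw [← hk]; exact_mod_cast card_le_univ S
      linarith
    have h0 : 0 ≤ (harmonic (k+4) : ℝ) := by
      have := (harmonic_pos (n := k+4) (by omega)).le
      exact_mod_cast this
    have h2 : (((k:ℝ)+4)*(k+3)*(k+2)*(k+1)) ≤ (#S : ℝ)^4 := by
      rw [hk]; push_cast
      have hk0 : (0:ℝ) ≤ k := by positivity
      nlinarith [pow_nonneg hk0 2, pow_nonneg hk0 3, pow_nonneg hk0 4]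
    calc _ ≤ 135 * a * ((#S : ℝ)^4) * (1 + Real.log (Fintype.card ι)) := by gcongr
      _ = _ := by ring

theorem P0_five {ι Y : Type*} [DecidableEq ι] [Fintype ι] (f : ι → Y → ℝ) (U : Finset Y)
    (S : Finset ι) : #(Obj f U 5 5 S) ≤ #(cub 5 (pat f U S)) := by
  apply card_le_card_of_injOn (fun o => (o.2.2, o.2.2 ∪ o.2.1))
  · rintro ⟨Z, J, B⟩ ho
    obtain ⟨hZS, hZ, hJ, hJj, hBS, hd, hp, -⟩ := mem_Obj.1 (mem_coe.1 ho)
    rw [mem_coe, mem_cub]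
    refine ⟨subset_union_left, ?_, ?_⟩
    · simp only
      rw [union_sdiff_cancel_left hd.symm, hJj]
    · intro T h1 h2
      simp only at h1 h2
      have := hp (T \ B) (by
        intro i hi; rw [mem_sdiff] at hi
        exact (mem_union.1 (h2 hi.1)).resolve_left hi.2)
      rwa [union_sdiff_of_subset h1] at this
  · rintro ⟨Z, J, B⟩ ho ⟨Z1, J1, B1⟩ ho1 he
    obtain ⟨hZS, hZ, hJ, hJj, hBS, hd, -⟩ := mem_Obj.1 (mem_coe.1 ho)
    obtain ⟨hZS1, hZ1, hJ1, hJj1, hBS1, hd1, -⟩ := mem_Obj.1 (mem_coe.1 ho1)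
    simp only [Prod.mk.injEq] at he ⊢
    obtain ⟨rfl, he⟩ := he
    have e1 : J = J1 := by
      rw [← union_sdiff_cancel_left hd.symm, he, union_sdiff_cancel_left hd1.symm]
    subst e1
    have e2 := eq_of_subset_of_card_le hJ (by omega)
    have e3 := eq_of_subset_of_card_le hJ1 (by omega)
    exact ⟨e2.symm.trans e3, rfl, rfl⟩

theorem P0_zero {ι Y : Type*} [DecidableEq ι] [Fintype ι] [AddCommGroup Y] [Module ℝ Y]
    {L : ι → Y →ₗ[ℝ] ℝ} {c : ι → ℝ} (G : Gn L c) (U : Finset Y) (a : ℝ) (ha : 1 ≤ a)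
    (hc : ∀ S : Finset ι, (#(cub 5 (pat (af L c) U S)) : ℝ) ≤ a * (#S : ℝ)^4)
    (S : Finset ι) : (#(Obj (af L c) U 5 0 S) : ℝ) ≤
      (270 * (1 + Real.log (Fintype.card ι)))^5 * a * (#S : ℝ)^4 := by
  set H := 1 + Real.log (Fintype.card ι) with hH
  have hH1 : 1 ≤ H := by
    have : 0 ≤ Real.log (Fintype.card ι) := Real.log_natCast_nonneg _
    linarith
  have key : ∀ j : ℕ, j ≤ 5 → ∀ S : Finset ι, (#(Obj (af L c) U 5 (5-j) S) : ℝ) ≤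
      (270 * H)^j * a * (#S : ℝ)^4 := by
    intro j
    induction j with
    | zero =>
      intro _ S
      simp only [pow_zero, one_mul]
      refine le_trans ?_ (hc S)
      exact_mod_cast P0_five _ U S
    | succ j ih =>
      intro hj S
      have h1 := P0_le G U (5-(j+1)) (by omega) S
      have h1' : (#(Obj (af L c) U 5 (5-(j+1)) S) : ℝ) ≤ 2 * (#(Obj (af L c) U 4 (5-(j+1)) S) : ℝ) := by
        exact_mod_cast h1
      have hone : 1 ≤ (270 * H)^j * a := by
        have : 1 ≤ (270*H)^j := one_le_pow₀ (by linarith)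
        nlinarith
      have h2 := P1_bound' L c U (5-(j+1)) (by omega) ((270*H)^j*a) hone
        (by rw [show 5-(j+1)+1 = 5-j by omega]; exact ih (by omega)) S
      rw [← hH] at h2
      calc _ ≤ _ := h1'
        _ ≤ 2 * (135 * ((270 * H)^j * a) * H * (#S : ℝ)^4) := by gcongr
        _ = _ := by ring
  exact key 5 le_rfl S


set_option linter.unusedSectionVars false
section tri
variable {ι Y : Type*} [DecidableEq ι] [AddCommGroup Y] [Module ℝ Y]

/-- weak conformity with a sign pattern -/
def conf (L : ι → Y →ₗ[ℝ] ℝ) (c : ι → ℝ) (S B : Finset ι) (y : Y) : Prop :=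
  ∀ i ∈ S, (i ∈ B → 0 ≤ af L c i y) ∧ (i ∉ B → af L c i y ≤ 0)

/-- zero set -/
def zs (L : ι → Y →ₗ[ℝ] ℝ) (c : ι → ℝ) (S : Finset ι) (y : Y) : Finset ι := by
  classical
  exact S.filter (fun i => af L c i y = 0)

theorem mem_zs {L : ι → Y →ₗ[ℝ] ℝ} {c : ι → ℝ} {S : Finset ι} {y : Y} {i : ι} :
    i ∈ zs L c S y ↔ i ∈ S ∧ af L c i y = 0 := by
  classical
  simp [zs]

/-- boundedness of a cell -/
def bddc (L : ι → Y →ₗ[ℝ] ℝ) (S B : Finset ι) : Prop :=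
  ∀ d : Y, d ≠ 0 → ∃ i ∈ S, (i ∈ B ∧ L i d < 0) ∨ (i ∉ B ∧ 0 < L i d)

theorem exit_lemma {L : ι → Y →ₗ[ℝ] ℝ} {c : ι → ℝ} {S B : Finset ι} (hb : bddc L S B) (y d : Y)
    (hy : conf L c S B y) (hd : d ≠ 0) (hz : ∀ i ∈ zs L c S y, L i d = 0) :
    ∃ t : ℝ, 0 < t ∧ conf L c S B (y + t • d) ∧ zs L c S y ⊂ zs L c S (y + t • d) := by
  classical
  set bad := S.filter (fun i => (i ∈ B ∧ L i d < 0) ∨ (i ∉ B ∧ 0 < L i d)) with hbad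
  have hne : bad.Nonempty := by
    obtain ⟨i, hi, h⟩ := hb d hd
    exact ⟨i, mem_filter.2 ⟨hi, h⟩⟩
  obtain ⟨i0, hi0, hmin⟩ := exists_min_image bad (fun i => - af L c i y / L i d) hne
  have hnz : ∀ i ∈ bad, af L c i y ≠ 0 := by
    intro i hi h0
    rw [mem_filter] at hi
    have := hz i (mem_zs.2 ⟨hi.1, h0⟩)
    rw [this] at hi
    simp at hi
  have hpos : ∀ i ∈ bad, 0 < - af L c i y / L i d := by
    intro i hi
    have h0 := hnz i hi
    rw [mem_filter] at hi
    rcases hi.2 with h | h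
    · have := ((hy i hi.1).1 h.1).lt_of_ne h0.symm
      exact div_pos_of_neg_of_neg (by linarith) h.2
    · have := ((hy i hi.1).2 h.1).lt_of_ne h0
      exact div_pos (by linarith) h.2
  have hi0S := (mem_filter.1 hi0).1
  have hL0 : L i0 d ≠ 0 := by
    rcases (mem_filter.1 hi0).2 with h | h
    · exact h.2.ne
    · exact h.2.ne'
  refine ⟨- af L c i0 y / L i0 d, hpos i0 hi0, ?_, ?_⟩
  · intro i hi
    have ht := hpos i0 hi0
    set t := - af L c i0 y / L i0 d with htd
    rw [af_add]
    constructor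
    · intro hB
      have h1 := (hy i hi).1 hB
      by_cases hl : L i d < 0
      · have hbi : i ∈ bad := mem_filter.2 ⟨hi, Or.inl ⟨hB, hl⟩⟩
        have := hmin i hbi
        rw [le_div_iff_of_neg hl] at this
        linarith
      · have := mul_nonneg ht.le (not_lt.1 hl); linarith
    · intro hB
      have h1 := (hy i hi).2 hB
      by_cases hl : 0 < L i d
      · have hbi : i ∈ bad := mem_filter.2 ⟨hi, Or.inr ⟨hB, hl⟩⟩
        have := hmin i hbi
        rw [le_div_iff₀ hl] at this
        linarith
      · have := mul_nonneg ht.le (neg_nonneg.2 (not_lt.1 hl)); linarith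
  · rw [ssubset_iff_of_subset]
    · refine ⟨i0, mem_zs.2 ⟨hi0S, ?_⟩, fun h => hnz i0 hi0 (mem_zs.1 h).2⟩
      rw [af_add]; field_simp; ring
    · intro i hi
      have := mem_zs.1 hi
      refine mem_zs.2 ⟨this.1, ?_⟩
      rw [af_add, this.2, hz i hi]; simp

theorem ex_vertex {L : ι → Y →ₗ[ℝ] ℝ} {c : ι → ℝ} (G : Gn L c) {S B : Finset ι} (hb : bddc L S B) :
    ∀ k : ℕ, ∀ y : Y, conf L c S B y → 5 - #(zs L c S y) ≤ k →
      ∃ v, conf L c S B v ∧ #(zs L c S v) = 5 ∧ zs L c S y ⊆ zs L c S v := by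
  intro k
  induction k with
  | zero =>
    intro y hy h
    exact ⟨y, hy, le_antisymm (G.g2 _ y (fun i hi => (mem_zs.1 hi).2)) (by omega), Subset.refl _⟩
  | succ k ih =>
    intro y hy h
    by_cases h5 : #(zs L c S y) = 5
    · exact ⟨y, hy, h5, Subset.refl _⟩
    · have h5' := G.g2 (zs L c S y) y (fun i hi => (mem_zs.1 hi).2)
      obtain ⟨d, hd, hd0⟩ := G.g0 (zs L c S y) (by omega)
      obtain ⟨t, ht, h1, h2⟩ := exit_lemma hb y d hy hd hd0
      have := card_lt_card h2
      obtain ⟨v, v1, v2, v3⟩ := ih _ h1 (by omega)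
      exact ⟨v, v1, v2, h2.subset.trans v3⟩

open Classical in
/-- chosen vertex -/
def Vx (L : ι → Y →ₗ[ℝ] ℝ) (c : ι → ℝ) (S B Z : Finset ι) : Y :=
  if h : ∃ v, conf L c S B v ∧ #(zs L c S v) = 5 ∧ Z ⊆ zs L c S v then h.choose else 0

theorem Vx_spec {L : ι → Y →ₗ[ℝ] ℝ} {c : ι → ℝ} {S B Z : Finset ι}
    (h : ∃ v, conf L c S B v ∧ #(zs L c S v) = 5 ∧ Z ⊆ zs L c S v) :
    conf L c S B (Vx L c S B Z) ∧ #(zs L c S (Vx L c S B Z)) = 5 ∧ Z ⊆ zs L c S (Vx L c S B Z) := by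
  unfold Vx
  rw [dif_pos h]
  exact h.choose_spec

theorem triang {L : ι → Y →ₗ[ℝ] ℝ} {c : ι → ℝ} (G : Gn L c) {S B : Finset ι} (hb : bddc L S B) :
    ∀ k : ℕ, ∀ y : Y, conf L c S B y → 5 - #(zs L c S y) ≤ k →
      ∃ v, conf L c S B v ∧ #(zs L c S v) = 5 ∧ zs L c S y ⊆ zs L c S v ∧
      ∃ C : Finset (Finset ι), C ⊆ (zs L c S v).powerset ∧
        (∀ Z ∈ C, conf L c S B (Vx L c S B Z) ∧ #(zs L c S (Vx L c S B Z)) = 5) ∧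
        y ∈ convexHull ℝ (Vx L c S B '' (C : Set (Finset ι))) := by
  have base : ∀ y : Y, conf L c S B y → #(zs L c S y) = 5 → 
      ∃ v, conf L c S B v ∧ #(zs L c S v) = 5 ∧ zs L c S y ⊆ zs L c S v ∧
      ∃ C : Finset (Finset ι), C ⊆ (zs L c S v).powerset ∧
        (∀ Z ∈ C, conf L c S B (Vx L c S B Z) ∧ #(zs L c S (Vx L c S B Z)) = 5) ∧
        y ∈ convexHull ℝ (Vx L c S B '' (C : Set (Finset ι))) := by
    intro y hy h5
    have hs := Vx_spec (L := L) (c := c) (S := S) (B := B) (Z := zs L c S y) ⟨y, hy, h5, Subset.refl _⟩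
    refine ⟨y, hy, h5, Subset.refl _, {zs L c S y}, by simp, ?_, ?_⟩
    · intro Z hZ
      rw [mem_singleton] at hZ
      subst hZ
      exact ⟨hs.1, hs.2.1⟩
    · have : y = Vx L c S B (zs L c S y) := by
        rw [← sub_eq_zero]
        apply G.g1 _ h5
        intro i hi
        have h1 := (mem_zs.1 hi).2
        have h2 := (mem_zs.1 (hs.2.2 hi)).2
        simp only [af, map_sub] at *
        linarith
      simp [← this]
  intro k
  induction k with
  | zero =>
    intro y hy h
    exact base y hy (le_antisymm (G.g2 _ y (fun i hi => (mem_zs.1 hi).2)) (by omega))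
  | succ k ih =>
    intro y hy h
    by_cases h5 : #(zs L c S y) = 5
    · exact base y hy h5
    have hs := Vx_spec (L := L) (c := c) (S := S) (B := B) (Z := zs L c S y)
      (ex_vertex G hb _ y hy le_rfl)
    set v := Vx L c S B (zs L c S y) with hv
    have hne : y - v ≠ 0 := by
      intro h0
      rw [sub_eq_zero.1 h0] at h5
      exact h5 hs.2.1
    obtain ⟨t, ht, h1, h2⟩ := exit_lemma hb y (y - v) hy hne (by
      intro i hi
      have h1 := (mem_zs.1 hi).2
      have h2 := (mem_zs.1 (hs.2.2 hi)).2
      simp only [af, map_sub] at *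
      linarith)
    have h5' := G.g2 (zs L c S y) y (fun i hi => (mem_zs.1 hi).2)
    have := card_lt_card h2
    obtain ⟨v', v1, v2, v3, C, C1, C2, C3⟩ := ih _ h1 (by omega)
    refine ⟨v', v1, v2, h2.subset.trans v3, insert (zs L c S y) C, ?_, ?_, ?_⟩
    · exact insert_subset (mem_powerset.2 (h2.subset.trans v3)) C1
    · intro Z hZ
      rcases mem_insert.1 hZ with rfl | hZ
      · exact ⟨hs.1, hs.2.1⟩
      · exact C2 Z hZ
    · have hv' : v ∈ convexHull ℝ (Vx L c S B '' ((insert (zs L c S y) C : Finset (Finset ι)) : Set (Finset ι))) := by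
        apply subset_convexHull
        exact ⟨zs L c S y, by simp, rfl⟩
      have hy' : y + t • (y - v) ∈ convexHull ℝ (Vx L c S B '' ((insert (zs L c S y) C : Finset (Finset ι)) : Set (Finset ι))) := by
        refine convexHull_mono (Set.image_mono ?_) C3
        simp
      have hcv := convex_convexHull ℝ (Vx L c S B '' ((insert (zs L c S y) C : Finset (Finset ι)) : Set (Finset ι)))
      have := hcv hv' hy' (a := t/(1+t)) (b := 1/(1+t)) (by positivity) (by positivity) (by field_simp; ring)
      convert this using 1
      have h3 : (t/(1+t)) • v + (1/(1+t)) • (y + t • (y - v)) = ((1/(1+t))*(1+t)) • y := by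
        module
      rw [h3, one_div, inv_mul_cancel₀ (by positivity), one_smul]

end tri

/-- A cutting type statement for a fixed sample `S`. -/
theorem cells {ι Y : Type*} [DecidableEq ι] [Fintype ι] [AddCommGroup Y] [Module ℝ Y]
    {L : ι → Y →ₗ[ℝ] ℝ} {c : ι → ℝ} (G : Gn L c) (U : Finset Y) (S : Finset ι)
    (hU : ∀ u ∈ U, ∀ i, af L c i u ≠ 0)
    (hb : ∀ u ∈ U, ∀ B : Finset ι, (∀ i ∈ S, i ∈ B ↔ 0 < af L c i u) → bddc L S B) :
    ∃ (lab : Y → (Finset ι × Finset ι × Finset ι) × Finset (Finset ι))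
      (V : (Finset ι × Finset ι × Finset ι) × Finset (Finset ι) → Set Y),
      #(U.image lab) ≤ #(Obj (af L c) U 5 0 S) * 2^32 ∧
      ∀ u ∈ U, u ∈ convexHull ℝ (V (lab u)) ∧
        (∃ g : Fin 32 → Y, V (lab u) = Set.range g) ∧
        (∀ v ∈ V (lab u), ∃ Z : Finset ι, #Z = 5 ∧ ∀ i ∈ Z, af L c i v = 0) ∧
        ∀ i ∈ S, (∀ v ∈ V (lab u), 0 ≤ af L c i v) ∨ (∀ v ∈ V (lab u), af L c i v ≤ 0) := by
  classical
  have key : ∀ u ∈ U, ∃ l : (Finset ι × Finset ι × Finset ι) × Finset (Finset ι),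
      l.1 ∈ Obj (af L c) U 5 0 S ∧ l.2 ⊆ l.1.1.powerset ∧
      (∀ Z ∈ l.2, conf L c S l.1.2.2 (Vx L c S l.1.2.2 Z) ∧ #(zs L c S (Vx L c S l.1.2.2 Z)) = 5) ∧
        u ∈ convexHull ℝ (Vx L c S l.1.2.2 '' (l.2 : Set (Finset ι))) := by
    intro u hu
    set B := S.filter (fun i => 0 < af L c i u) with hB
    have hbb := hb u hu B (by intro i hi; simp [hB, hi])
    have hcf : conf L c S B u := by
      intro i hi
      simp only [hB, mem_filter, hi, true_and]
      exact ⟨fun h => h.le, fun h => not_lt.1 h⟩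
    obtain ⟨v, v1, v2, -, C, C1, C2, C3⟩ := triang G hbb _ u hcf le_rfl
    refine ⟨((zs L c S v, ∅, B), C), ?_, C1, C2, C3⟩
    rw [mem_Obj]
    refine ⟨fun i hi => (mem_zs.1 hi).1, v2, by simp, by simp, filter_subset _ _, by simp, ?_, v,
      fun i hi => (mem_zs.1 hi).2, ?_⟩
    · intro T hT
      rw [subset_empty.1 hT, union_empty, mem_pat]
      exact ⟨u, hu, fun i => by simp [hB]⟩
    · intro i hi hiZ
      have hne : af L c i v ≠ 0 := fun h => hiZ (mem_zs.2 ⟨hi, h⟩)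
      exact ⟨fun h => ((v1 i hi).1 h).lt_of_ne hne.symm, fun h => ((v1 i hi).2 h).lt_of_ne hne⟩
  choose! lab h1 h2 h3 h4 using key
  refine ⟨lab, fun l => Vx L c S l.1.2.2 '' (l.2 : Set (Finset ι)), ?_, ?_⟩
  · calc #(U.image lab) ≤ #((Obj (af L c) U 5 0 S).sigma (fun o => o.1.powerset.powerset)) := by
          apply card_le_card_of_injOn (fun l => ⟨l.1, l.2⟩)
          · intro l hl
            obtain ⟨u, hu, rfl⟩ := mem_image.1 (mem_coe.1 hl)
            rw [mem_coe, mem_sigma]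
            exact ⟨h1 u hu, mem_powerset.2 (h2 u hu)⟩
          · intro l _ l' _ he
            simp only [Sigma.mk.injEq, heq_eq_eq] at he
            exact Prod.ext he.1 he.2
      _ = ∑ o ∈ Obj (af L c) U 5 0 S, 2^32 := by
          rw [card_sigma]
          apply sum_congr rfl
          rintro ⟨Z, J, B⟩ ho
          have := (mem_Obj.1 ho).2.1
          rw [card_powerset, card_powerset, this]; norm_num
      _ = _ := by rw [sum_const, smul_eq_mul]
  · intro u hu
    have hne : (lab u).2.Nonempty := by
      have := convexHull_nonempty_iff.1 ⟨u, h4 u hu⟩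
      simpa using this
    have hcard : #(lab u).2 ≤ 32 := by
      refine (card_le_card (h2 u hu)).trans ?_
      have h5 : ∀ o : Finset ι × Finset ι × Finset ι, o ∈ Obj (af L c) U 5 0 S → #o.1 = 5 := by
        rintro ⟨Z, J, B⟩ ho
        exact (mem_Obj.1 ho).2.1
      have := h5 _ (h1 u hu)
      rw [card_powerset, this]; norm_num
    refine ⟨h4 u hu, ?_, ?_, ?_⟩
    · have : Nonempty (lab u).2 := hne.to_subtype
      obtain ⟨e⟩ : Nonempty ((lab u).2 ↪ Fin 32) := by
        apply Function.Embedding.nonempty_of_card_le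
        simpa using hcard
      refine ⟨fun k => Vx L c S (lab u).1.2.2 (Function.invFun e k : (lab u).2), ?_⟩
      ext v
      simp only [Set.mem_image, mem_coe, Set.mem_range]
      constructor
      · rintro ⟨Z, hZ, rfl⟩
        refine ⟨e ⟨Z, hZ⟩, ?_⟩
        rw [Function.leftInverse_invFun e.injective]
      · rintro ⟨k, rfl⟩
        exact ⟨_, (Function.invFun e k : (lab u).2).2, rfl⟩
    · rintro _ ⟨Z, hZ, rfl⟩
      exact ⟨_, (h3 u hu Z hZ).2, fun i hi => (mem_zs.1 hi).2⟩
    · intro i hi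
      by_cases hB : i ∈ (lab u).1.2.2
      · left
        rintro _ ⟨Z, hZ, rfl⟩
        exact ((h3 u hu Z hZ).1 i hi).1 hB
      · right
        rintro _ ⟨Z, hZ, rfl⟩
        exact ((h3 u hu Z hZ).1 i hi).2 hB


/-- Euclidean four-space -/
abbrev E4 := EuclideanSpace ℝ (Fin 4)

/-- linear parts of the lifted spheres -/
def Lb {ι : Type*} (b : ι → E4) (i : ι) : (ℝ × E4) →ₗ[ℝ] ℝ :=
  LinearMap.fst ℝ ℝ E4 + (innerₛₗ ℝ (b i)) ∘ₗ LinearMap.snd ℝ ℝ E4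

theorem Lb_apply {ι : Type*} (b : ι → E4) (i : ι) (z : ℝ) (x : E4) :
    Lb b i (z, x) = z + inner ℝ (b i) x := by
  simp [Lb]

/-- lifting to the paraboloid -/
def Phi (x : E4) : ℝ × E4 := (‖x‖^2, x)

theorem af_Phi {ι : Type*} (b : ι → E4) (c : ι → ℝ) (i : ι) (x : E4) :
    af (Lb b) c i (Phi x) = ‖x‖^2 + inner ℝ (b i) x + c i := by
  simp [af, Phi, Lb_apply]

theorem af_Phi_cont {ι : Type*} (b : ι → E4) (c : ι → ℝ) (i : ι) :
    Continuous (fun x => af (Lb b) c i (Phi x)) := by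
  simp only [af_Phi]
  fun_prop

theorem sphere_inter_preconn {ι : Type*} [DecidableEq ι] (b : ι → E4) (c : ι → ℝ) (J : Finset ι)
    (hJ : #J ≤ 3) : IsPreconnected {x : E4 | ∀ i ∈ J, af (Lb b) c i (Phi x) = 0} := by
  rcases J.eq_empty_or_nonempty with rfl | ⟨i0, hi0⟩
  · simpa using isPreconnected_univ
  rcases Set.eq_empty_or_nonempty {x : E4 | ∀ i ∈ J, af (Lb b) c i (Phi x) = 0} with he | ⟨x, hx⟩
  · rw [he]; exact isPreconnected_empty
  classical
  set K : Submodule ℝ E4 := Submodule.span ℝ ((J.erase i0).image (fun i => b i - b i0) : Finset E4)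
    with hK
  set D := Kᗮ with hD
  have hmemD : ∀ d : E4, d ∈ D ↔ ∀ i ∈ J, inner ℝ (b i - b i0) d = (0:ℝ) := by
    intro d
    rw [hD, Submodule.mem_orthogonal]
    constructor
    · intro h i hi
      by_cases hii : i = i0
      · subst hii; simp
      · apply h
        apply Submodule.subset_span
        rw [mem_coe, mem_image]
        exact ⟨i, mem_erase.2 ⟨hii, hi⟩, rfl⟩
    · intro h u hu
      induction hu using Submodule.span_induction with
      | mem u hu =>
        rw [mem_coe, mem_image] at hu
        obtain ⟨i, hi, rfl⟩ := hu
        exact h i (mem_of_mem_erase hi)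
      | zero => simp
      | add u v _ _ h1 h2 => rw [inner_add_left, h1, h2, add_zero]
      | smul a u _ h1 => rw [inner_smul_left, h1, mul_zero]
  have hrank : 1 < Module.rank ℝ D := by
    have h1 : Module.finrank ℝ K ≤ 2 := by
      refine (finrank_span_finset_le_card _).trans (card_image_le.trans ?_)
      rw [card_erase_of_mem hi0]; omega
    have h2 := Submodule.finrank_add_finrank_orthogonal K
    rw [finrank_euclideanSpace_fin] at h2
    have h3 : 1 < Module.finrank ℝ D := by rw [hD]; omega
    rw [← Module.finrank_eq_rank]
    exact_mod_cast h3
  set g : D := D.orthogonalProjectionOnto ((1/2:ℝ) • ((2:ℝ) • x + b i0)) with hg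
  have hgi : ∀ d : D, inner ℝ (g : E4) (d : E4) = (1/2:ℝ) * (2 * inner ℝ x (d:E4) + inner ℝ (b i0) (d : E4)) := by
    intro d
    have h1 := Submodule.starProjection_inner_eq_zero (K := D) ((1/2:ℝ) • ((2:ℝ) • x + b i0)) d d.2
    rw [inner_sub_left, sub_eq_zero] at h1
    change _ = inner ℝ (g : E4) (d : E4) at h1
    rw [← h1, inner_smul_left, inner_add_left, inner_smul_left]
    simp
  have heq : {x : E4 | ∀ i ∈ J, af (Lb b) c i (Phi x) = 0} =
      (fun d : D => x + (d : E4)) '' Metric.sphere (-g) ‖g‖ := by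
    have hsph : ∀ d : D, d ∈ Metric.sphere (-g) ‖g‖ ↔ ‖(d:E4)‖^2 + 2 * inner ℝ (g:E4) (d:E4) = 0 := by
      intro d
      rw [mem_sphere_iff_norm, sub_neg_eq_add]
      have h1 : ‖d + g‖^2 = ‖d‖^2 + 2 * inner ℝ d g + ‖g‖^2 := norm_add_sq_real d g
      have h2 : inner ℝ d g = inner ℝ (g:E4) (d:E4) := by
        rw [real_inner_comm]; rfl
      rw [h2] at h1
      have h3 : ‖(d:E4)‖ = ‖d‖ := rfl
      rw [h3]
      constructor
      · intro h; rw [h] at h1; linarith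
      · intro h
        have : ‖d + g‖^2 = ‖g‖^2 := by linarith
        exact (pow_left_inj₀ (norm_nonneg _) (norm_nonneg _) two_ne_zero).1 this
    have hval : ∀ i, ∀ d : E4, af (Lb b) c i (Phi (x + d)) = af (Lb b) c i (Phi x) +
        (‖d‖^2 + 2 * inner ℝ x d + inner ℝ (b i0) d) + inner ℝ (b i - b i0) d := by
      intro i d
      rw [af_Phi, af_Phi, norm_add_sq_real, inner_add_right, inner_sub_left]; ring
    ext y
    simp only [Set.mem_ofPred_eq, Set.mem_image]
    constructor
    · intro hy
      have h0 : ‖y - x‖^2 + 2 * inner ℝ x (y-x) + inner ℝ (b i0) (y-x) = 0 := by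
        have h1 := hval i0 (y - x)
        rw [add_sub_cancel, hy i0 hi0, hx i0 hi0] at h1
        simp at h1; linarith
      have hd : y - x ∈ D := by
        rw [hmemD]
        intro i hi
        have h1 := hval i (y - x)
        rw [add_sub_cancel, hy i hi, hx i hi] at h1
        linarith
      refine ⟨⟨y - x, hd⟩, ?_, by simp⟩
      rw [hsph, hgi]
      simp only
      linarith
    · rintro ⟨d, hd, rfl⟩ i hi
      rw [hsph, hgi] at hd
      rw [hval, hx i hi, (hmemD _).1 d.2 i hi]
      linarith
  rw [heq]
  apply IsPreconnected.image (isPreconnected_sphere hrank _ _)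
  fun_prop

theorem two_points {ι : Type*} [DecidableEq ι] [Fintype ι] {b : ι → E4} {c : ι → ℝ}
    (G : Gn (Lb b) c) (h5 : 5 ≤ Fintype.card ι) (J : Finset ι) (hJ : #J = 4) (x1 x2 x3 : E4)
    (e1 : ∀ i ∈ J, af (Lb b) c i (Phi x1) = 0) (e2 : ∀ i ∈ J, af (Lb b) c i (Phi x2) = 0)
    (e3 : ∀ i ∈ J, af (Lb b) c i (Phi x3) = 0) (h12 : x1 ≠ x2) (h13 : x1 ≠ x3) : x2 = x3 := by
  obtain ⟨h, hh⟩ : ∃ h, h ∉ J := by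
    by_contra hc
    push Not at hc
    have : J = univ := eq_univ_iff_forall.2 hc
    rw [this, card_univ] at hJ
    omega
  have hd : Phi x2 - Phi x1 ≠ 0 := by
    intro h0
    have := congrArg Prod.snd (sub_eq_zero.1 h0)
    exact h12 this.symm
  obtain ⟨-, t, ht⟩ := ker_line G J hJ h hh (Phi x2 - Phi x1) (Phi x3 - Phi x1) hd
    (fun i hi => by have := e1 i hi; have := e2 i hi; simp only [af, map_sub] at *; linarith)
    (fun i hi => by have := e1 i hi; have := e3 i hi; simp only [af, map_sub] at *; linarith)
  have t1 : ‖x3‖^2 - ‖x1‖^2 = t * (‖x2‖^2 - ‖x1‖^2) := congrArg Prod.fst ht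
  have t2 : x3 - x1 = t • (x2 - x1) := congrArg Prod.snd ht
  have hx3 : x3 = x1 + t • (x2 - x1) := by rw [← t2]; simp
  have hx2 : ‖x2‖^2 = ‖x1‖^2 + 2 * inner ℝ x1 (x2 - x1) + ‖x2 - x1‖^2 := by
    rw [← norm_add_sq_real]; simp
  have hx3' : ‖x3‖^2 = ‖x1‖^2 + 2 * (t * inner ℝ x1 (x2 - x1)) + t^2 * ‖x2 - x1‖^2 := by
    rw [hx3, norm_add_sq_real, inner_smul_right, norm_smul, mul_pow]; simp
  have hn : 0 < ‖x2 - x1‖^2 := by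
    have : x2 - x1 ≠ 0 := sub_ne_zero.2 h12.symm
    positivity
  have : (t^2 - t) * ‖x2 - x1‖^2 = 0 := by
    rw [hx3', hx2] at t1
    linear_combination t1
  have h0 : t^2 - t = 0 := (mul_eq_zero.1 this).resolve_right hn.ne'
  have h01 : t = 0 ∨ t = 1 := by
    have : t * (t - 1) = 0 := by linarith
    rcases mul_eq_zero.1 this with h | h
    · left; exact h
    · right; linarith
  rcases h01 with rfl | rfl
  · simp at hx3; exact absurd hx3.symm h13
  · simp at hx3; exact hx3.symm

theorem pat_card {ι : Type*} [DecidableEq ι] [Fintype ι] {b : ι → E4} {c : ι → ℝ}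
    (G : Gn (Lb b) c) (h5 : 5 ≤ Fintype.card ι) (U : Finset (ℝ × E4)) (hU : ∀ u ∈ U, ∃ x, u = Phi x)
    (S : Finset ι) : #(pat (af (Lb b) c) U S) ≤ 64 * (#S + 1)^4 := by
  classical
  -- representatives
  have hrep : ∀ J : Finset ι, #J ≤ 4 → ∃ R : Finset E4, #R ≤ 2 ∧
      (#J = 4 → ∀ x, (∀ i ∈ J, af (Lb b) c i (Phi x) = 0) → x ∈ R) ∧
      ((∃ x, ∀ i ∈ J, af (Lb b) c i (Phi x) = 0) → ∃ x ∈ R, ∀ i ∈ J, af (Lb b) c i (Phi x) = 0) := by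
    intro J hJ
    by_cases hex : ∃ x, ∀ i ∈ J, af (Lb b) c i (Phi x) = 0
    swap
    · exact ⟨∅, by simp, fun _ x hx => absurd ⟨x, hx⟩ hex, fun h => absurd h hex⟩
    obtain ⟨x1, hx1⟩ := hex
    by_cases hex2 : ∃ x, x ≠ x1 ∧ ∀ i ∈ J, af (Lb b) c i (Phi x) = 0
    · obtain ⟨x2, h21, hx2⟩ := hex2
      refine ⟨{x1, x2}, card_le_two, ?_, fun _ => ⟨x1, by simp, hx1⟩⟩
      intro h4 x hx
      by_contra hcon
      simp only [mem_insert, mem_singleton, not_or] at hcon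
      exact hcon.2 (two_points G h5 J h4 x1 x2 x hx1 hx2 hx h21.symm (Ne.symm hcon.1)).symm
    · push Not at hex2
      refine ⟨{x1}, by simp, ?_, fun _ => ⟨x1, by simp, hx1⟩⟩
      intro _ x hx
      by_contra hcon
      rw [mem_singleton] at hcon
      obtain ⟨i, hi, h⟩ := hex2 x hcon
      exact h (hx i hi)
  choose! R hR2 hR4 hRe using hrep
  have hmain : pat (af (Lb b) c) U S ⊆ (S.powerset.filter (fun J => #J ≤ 4)).biUnion (fun J =>
      (R J).biUnion (fun x => (zs (Lb b) c S (Phi x)).powerset.image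
        (fun T => S.filter (fun i => 0 < af (Lb b) c i (Phi x)) ∪ T))) := by
    intro p hp
    rw [mem_pat] at hp
    obtain ⟨u, hu, hpu⟩ := hp
    obtain ⟨x0, rfl⟩ := hU u hu
    -- closed cell
    have hpS : p ⊆ S := fun i hi => ((hpu i).1 hi).1
    have hx0 : conf (Lb b) c S p (Phi x0) := by
      intro i hi
      refine ⟨fun h => ((hpu i).1 h).2.le, fun h => ?_⟩
      by_contra hc
      exact h ((hpu i).2 ⟨hi, not_le.1 hc⟩)
    obtain ⟨x, hx, hmax⟩ : ∃ x, conf (Lb b) c S p (Phi x) ∧ ∀ y, conf (Lb b) c S p (Phi y) →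
        #(zs (Lb b) c S (Phi y)) ≤ #(zs (Lb b) c S (Phi x)) := by
      by_contra hcon
      push Not at hcon
      have : ∀ n : ℕ, ∃ x, conf (Lb b) c S p (Phi x) ∧ n ≤ #(zs (Lb b) c S (Phi x)) := by
        intro n
        induction n with
        | zero => exact ⟨x0, hx0, by simp⟩
        | succ n ih =>
          obtain ⟨x, h1, h2⟩ := ih
          obtain ⟨y, h3, h4⟩ := hcon x h1
          exact ⟨y, h3, by omega⟩
      obtain ⟨x, -, h⟩ := this 6
      have := G.g2 (zs (Lb b) c S (Phi x)) (Phi x) (fun i hi => (mem_zs.1 hi).2)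
      omega
    set J := zs (Lb b) c S (Phi x) with hJ
    -- from a representative
    have fin : ∀ J' : Finset ι, J' ⊆ S → #J' ≤ 4 → ∀ y ∈ R J', conf (Lb b) c S p (Phi y) →
        p ∈ (S.powerset.filter (fun J => #J ≤ 4)).biUnion (fun J =>
      (R J).biUnion (fun x => (zs (Lb b) c S (Phi x)).powerset.image
        (fun T => S.filter (fun i => 0 < af (Lb b) c i (Phi x)) ∪ T))) := by
      intro J' h1 h2 y hy hcy
      simp only [mem_biUnion, mem_image, mem_powerset, mem_filter]
      refine ⟨J', ⟨h1, h2⟩, y, hy, p ∩ zs (Lb b) c S (Phi y), inter_subset_right, ?_⟩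
      ext i
      simp only [mem_union, mem_filter, mem_inter, mem_zs]
      constructor
      · rintro (h | h)
        · by_contra hip
          have := (hcy i h.1).2 hip
          linarith [h.2]
        · exact h.1
      · intro hip
        have hiS := hpS hip
        have := (hcy i hiS).1 hip
        rcases this.lt_or_eq with h | h
        · left; exact ⟨hiS, h⟩
        · right; exact ⟨hip, hiS, h.symm⟩
    have hJS : J ⊆ S := fun i hi => (mem_zs.1 hi).1
    have hJ0 : ∀ i ∈ J, af (Lb b) c i (Phi x) = 0 := fun i hi => (mem_zs.1 hi).2
    by_cases hJ4 : 4 ≤ #J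
    · obtain ⟨J', hJ', hc4⟩ := exists_subset_card_eq hJ4
      exact fin J' (hJ'.trans hJS) hc4.le x
        (hR4 J' hc4.le hc4 x (fun i hi => hJ0 i (hJ' hi))) hx
    · push Not at hJ4
      obtain ⟨y, hyR, hy0⟩ := hRe J (by omega) ⟨x, hJ0⟩
      refine fin J hJS (by omega) y hyR ?_
      have hpre := sphere_inter_preconn b c J (by omega)
      set O1 : Set E4 := {w | ∀ i ∈ S \ J, (i ∈ p → 0 < af (Lb b) c i (Phi w)) ∧
        (i ∉ p → af (Lb b) c i (Phi w) < 0)} with hO1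
      set O2 : Set E4 := {w | ∃ i ∈ S \ J, (i ∈ p ∧ af (Lb b) c i (Phi w) < 0) ∨
        (i ∉ p ∧ 0 < af (Lb b) c i (Phi w))} with hO2
      have o1 : IsOpen O1 := by
        have : O1 = ⋂ i ∈ S \ J, {w | (i ∈ p → 0 < af (Lb b) c i (Phi w)) ∧
          (i ∉ p → af (Lb b) c i (Phi w) < 0)} := by
          ext w; simp [hO1]
        rw [this]
        apply isOpen_biInter_finset
        intro i _
        by_cases hip : i ∈ p
        · simp only [hip, true_imp_iff, not_true, false_imp_iff, and_true]
          exact isOpen_lt continuous_const (af_Phi_cont b c i)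
        · simp only [hip, true_imp_iff, false_imp_iff, true_and, not_false_iff]
          exact isOpen_lt (af_Phi_cont b c i) continuous_const
      have o2 : IsOpen O2 := by
        have : O2 = ⋃ i ∈ S \ J, {w | (i ∈ p ∧ af (Lb b) c i (Phi w) < 0) ∨
          (i ∉ p ∧ 0 < af (Lb b) c i (Phi w))} := by
          ext w; simp [hO2]
        rw [this]
        apply isOpen_biUnion
        intro i _
        by_cases hip : i ∈ p
        · simp only [hip, true_and, not_true, false_and, or_false]
          exact isOpen_lt (af_Phi_cont b c i) continuous_const
        · simp only [hip, true_and, false_and, not_false_iff, false_or]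
          exact isOpen_lt continuous_const (af_Phi_cont b c i)
      have hdis : Disjoint O1 O2 := by
        rw [Set.disjoint_left]
        rintro w h1 ⟨i, hi, h | h⟩
        · have := (h1 i hi).1 h.1; linarith [h.2]
        · have := (h1 i hi).2 h.1; linarith [h.2]
      have hcov : {x : E4 | ∀ i ∈ J, af (Lb b) c i (Phi x) = 0} ⊆ O1 ∪ O2 := by
        intro w hw
        by_cases hw2 : w ∈ O2
        · exact Or.inr hw2
        left
        simp only [hO2, Set.mem_ofPred_eq] at hw2
        push Not at hw2
        have hcw : conf (Lb b) c S p (Phi w) := by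
          intro i hi
          by_cases hiJ : i ∈ J
          · rw [hw i hiJ]; simp
          · have := hw2 i (mem_sdiff.2 ⟨hi, hiJ⟩)
            exact ⟨this.1, this.2⟩
        have hsub : J ⊆ zs (Lb b) c S (Phi w) := fun i hi => mem_zs.2 ⟨hJS hi, hw i hi⟩
        have heq := eq_of_subset_of_card_le hsub (hmax w hcw)
        intro i hi
        rw [mem_sdiff] at hi
        have hne : af (Lb b) c i (Phi w) ≠ 0 := by
          intro h; apply hi.2; rw [heq]; exact mem_zs.2 ⟨hi.1, h⟩
        exact ⟨fun h => ((hcw i hi.1).1 h).lt_of_ne hne.symm, fun h => ((hcw i hi.1).2 h).lt_of_ne hne⟩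
      have hxO : x ∈ O1 := by
        intro i hi
        rw [mem_sdiff] at hi
        have hne : af (Lb b) c i (Phi x) ≠ 0 := by
          intro h; exact hi.2 (mem_zs.2 ⟨hi.1, h⟩)
        exact ⟨fun h => ((hx i hi.1).1 h).lt_of_ne hne.symm, fun h => ((hx i hi.1).2 h).lt_of_ne hne⟩
      have := hpre.subset_left_of_subset_union o1 o2 hdis hcov ⟨x, hJ0, hxO⟩
      have hyO : y ∈ O1 := this hy0
      intro i hi
      by_cases hiJ : i ∈ J
      · rw [hy0 i hiJ]; simp
      · have := hyO i (mem_sdiff.2 ⟨hi, hiJ⟩)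
        exact ⟨fun h => (this.1 h).le, fun h => (this.2 h).le⟩
  have hcJ : #(S.powerset.filter (fun J => #J ≤ 4)) ≤ (#S + 1)^4 := by
    have hs : S.powerset.filter (fun J => #J ≤ 4) ⊆ (range 5).biUnion (fun k => S.powersetCard k) := by
      intro J hJ
      rw [mem_filter, mem_powerset] at hJ
      rw [mem_biUnion]
      exact ⟨#J, mem_range.2 (by omega), mem_powersetCard.2 ⟨hJ.1, rfl⟩⟩
    refine (card_le_card hs).trans (card_biUnion_le.trans ?_)
    calc ∑ k ∈ range 5, #(S.powersetCard k) ≤ ∑ k ∈ range 5, (#S)^k := by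
          apply sum_le_sum
          intro k _
          rw [card_powersetCard]
          exact Nat.choose_le_pow _ _
      _ ≤ (#S + 1)^4 := by
          simp only [sum_range_succ, range_zero, sum_empty]
          ring_nf
          nlinarith [Nat.zero_le (#S), Nat.zero_le ((#S)^2), Nat.zero_le ((#S)^3)]
  refine (card_le_card hmain).trans ?_
  refine (card_biUnion_le_card_mul _ _ 64 ?_).trans ?_
  · intro J hJ
    rw [mem_filter] at hJ
    refine (card_biUnion_le_card_mul _ _ 32 ?_).trans ?_
    · intro x _
      refine card_image_le.trans ?_
      rw [card_powerset]
      have := G.g2 (zs (Lb b) c S (Phi x)) (Phi x) (fun i hi => (mem_zs.1 hi).2)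
      calc 2^_ ≤ 2^5 := Nat.pow_le_pow_right (by norm_num) this
        _ = 32 := by norm_num
    · have := hR2 J hJ.2
      omega
  · rw [mul_comm]; exact Nat.mul_le_mul_left _ hcJ

theorem pat_vc {ι : Type*} [DecidableEq ι] {b : ι → E4} {c : ι → ℝ}
    (U : Finset (ℝ × E4)) (hU0 : ∀ u ∈ U, ∀ i, af (Lb b) c i u ≠ 0)
    (S : Finset ι) (X : Finset ι) (hX : (pat (af (Lb b) c) U S).Shatters X) : #X ≤ 6 := by
  classical
  by_contra hcon
  have hnl : ¬ LinearIndependent ℝ (fun i : X => (((1:ℝ), b i, c i) : ℝ × E4 × ℝ)) := by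
    intro h
    have := h.fintype_card_le_finrank
    rw [Fintype.card_coe] at this
    simp at this
    omega
  rw [Fintype.not_linearIndependent_iff] at hnl
  obtain ⟨g, hg, i0, hi0⟩ := hnl
  set g' : ι → ℝ := fun i => if h : i ∈ X then g ⟨i, h⟩ else 0
  obtain ⟨p, hp, hpX⟩ := hX (t := X.filter (fun i => 0 < g' i)) (filter_subset _ _)
  obtain ⟨u, hu, hpu⟩ := mem_pat.1 hp
  obtain ⟨p', hp', hpX'⟩ := hX (t := X) (Subset.refl _)
  obtain ⟨u', hu', hpu'⟩ := mem_pat.1 hp'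
  have hXS : X ⊆ S := by
    intro i hi
    rw [← hpX', mem_inter] at hi
    exact ((hpu' i).1 hi.2).1
  have hsum : ∑ i : X, g i * af (Lb b) c i u = 0 := by
    obtain ⟨z, x⟩ := u
    have h1 := congrArg Prod.fst hg
    have h2 := congrArg (fun q : ℝ × E4 × ℝ => inner ℝ q.2.1 x) hg
    have h3 := congrArg (fun q : ℝ × E4 × ℝ => q.2.2) hg
    simp only [Prod.fst_sum, Prod.snd_sum, Prod.smul_fst, Prod.smul_snd, smul_eq_mul, mul_one,
      Prod.fst_zero, Prod.snd_zero, sum_inner, inner_smul_left, inner_zero_left] at h1 h2 h3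
    simp only [af, Lb_apply, mul_add, sum_add_distrib]
    rw [h3, ← sum_mul, h1]
    simp at h2 ⊢
    exact h2
  have hpos : 0 < ∑ i : X, g i * af (Lb b) c i u := by
    have hs : ∀ i : X, (0 < af (Lb b) c i u ↔ 0 < g i) := by
      intro i
      have h1 : (i:ι) ∈ X ∩ p ↔ (i:ι) ∈ X.filter (fun i => 0 < g' i) := by rw [hpX]
      simp only [mem_inter, i.2, true_and, mem_filter, hpu, hXS i.2, g', dif_pos] at h1
      exact h1
    have hterm : ∀ i : X, g i ≠ 0 → 0 < g i * af (Lb b) c i u := by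
      intro i hgi
      rcases lt_or_gt_of_ne hgi with h | h
      · have h1 : ¬ 0 < af (Lb b) c i u := fun h' => absurd ((hs i).1 h') (by linarith)
        have h2 := (not_lt.1 h1).lt_of_ne (hU0 u hu i)
        exact mul_pos_of_neg_of_neg h h2
      · exact mul_pos h ((hs i).2 h)
    apply sum_pos'
    · intro i _
      by_cases h : g i = 0
      · rw [h]; simp
      · exact (hterm i h).le
    · exact ⟨i0, mem_univ _, hterm i0 hi0⟩
  linarith

theorem Obj_bound {ι : Type*} [DecidableEq ι] [Fintype ι] {b : ι → E4} {c : ι → ℝ}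
    (G : Gn (Lb b) c) (h5 : 5 ≤ Fintype.card ι) (U : Finset (ℝ × E4)) (hU : ∀ u ∈ U, ∃ x, u = Phi x)
    (hU0 : ∀ u ∈ U, ∀ i, af (Lb b) c i u ≠ 0) (S : Finset ι) :
    (#(Obj (af (Lb b) c) U 5 0 S) : ℝ) ≤
      (270 * (1 + Real.log (Fintype.card ι)))^5 * 6144 * (#S : ℝ)^4 := by
  apply P0_zero G U 6144 (by norm_num)
  intro S
  have h1 := cub_bound S 5 6 (pat (af (Lb b) c) U S) (by
    intro p hp
    obtain ⟨u, hu, h⟩ := mem_pat.1 hp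
    intro i hi; exact ((h i).1 hi).1) (fun X hX => pat_vc U hU0 S X hX)
  have h2 := pat_card G h5 U hU S
  rcases S.eq_empty_or_nonempty with rfl | hne
  · have : cub 5 (pat (af (Lb b) c) U ∅) = ∅ := by
      rw [eq_empty_iff_forall_notMem]
      intro q hq
      rw [mem_cub] at hq
      obtain ⟨h1, h2, h3⟩ := hq
      obtain ⟨u, hu, h⟩ := mem_pat.1 (h3 _ h1 (Subset.refl _))
      have : q.2 = ∅ := by ext i; simp [h]
      rw [this] at h2
      simp at h2
    rw [this]; simp
  have h3 : 1 ≤ #S := hne.card_pos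
  have h4 : #(cub 5 (pat (af (Lb b) c) U S)) ≤ 6144 * (#S)^4 := by
    calc _ ≤ _ := h1
      _ ≤ Nat.choose 6 5 * (64 * (#S + 1)^4) := Nat.mul_le_mul_left _ h2
      _ ≤ Nat.choose 6 5 * (64 * (#S + #S)^4) := by gcongr
      _ = 6144 * (#S)^4 := by
        rw [show Nat.choose 6 5 = 6 by rfl]; ring
  exact_mod_cast h4


theorem hitting {α : Type*} [DecidableEq α] (W : Finset α) (r : ℝ) (hr : 1 ≤ r) :
    ∀ k : ℕ, ∀ F : Finset (Finset α), #F = k → (∀ X ∈ F, X ⊆ W ∧ (#W : ℝ) < r * #X) →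
    ∃ R ⊆ W, (∀ X ∈ F, ∃ w ∈ R, w ∈ X) ∧ (#R : ℝ) ≤ r * Real.log #F + 1 := by
  classical
  intro k
  induction k using Nat.strong_induction_on with
  | _ k ih =>
  intro F hk hF
  rcases F.eq_empty_or_nonempty with rfl | hne
  · exact ⟨∅, by simp, by simp, by simp⟩
  have hFpos : (0:ℝ) < #F := by exact_mod_cast hne.card_pos
  have hr0 : 0 < r := by linarith
  obtain ⟨X0, hX0⟩ := hne
  have hWne : W.Nonempty := by
    obtain ⟨h1, h2⟩ := hF X0 hX0
    rw [nonempty_iff_ne_empty]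
    rintro rfl
    rw [subset_empty.1 h1] at h2
    simp at h2
  have hWpos : (0:ℝ) < #W := by exact_mod_cast hWne.card_pos
  obtain ⟨w, hw, hwF⟩ : ∃ w ∈ W, (#F : ℝ) ≤ r * #(F.filter (fun X => w ∈ X)) := by
    by_contra hcon
    push Not at hcon
    have h1 := sum_lt_sum_of_nonempty hWne hcon
    rw [← mul_sum] at h1
    have h2 := sum_card_bipartiteAbove_eq_sum_card_bipartiteBelow (s := F) (t := W) (fun X w => w ∈ X)
    simp only [bipartiteBelow, bipartiteAbove] at h2
    have h3 : ∑ X ∈ F, #(W.filter (fun w => w ∈ X)) = ∑ X ∈ F, #X := by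
      apply sum_congr rfl
      intro X hX
      congr 1
      ext i
      simp only [mem_filter]
      exact ⟨fun h => h.2, fun h => ⟨(hF X hX).1 h, h⟩⟩
    rw [h3] at h2
    have h4 : (∑ w ∈ W, (#(F.filter (fun X => w ∈ X)) : ℝ)) = ∑ X ∈ F, (#X : ℝ) := by
      exact_mod_cast h2.symm
    rw [h4, mul_sum, sum_const, nsmul_eq_mul] at h1
    have h5 : ∑ X ∈ F, (#W : ℝ) ≤ ∑ X ∈ F, r * (#X:ℝ) := sum_le_sum (fun X hX => (hF X hX).2.le)
    rw [sum_const, nsmul_eq_mul] at h5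
    linarith
  set F' := F.filter (fun X => ¬ w ∈ X) with hF'
  have hsplit : #(F.filter (fun X => w ∈ X)) + #F' = #F := card_filter_add_card_filter_not _
  have hsplit' : (#(F.filter (fun X => w ∈ X)) : ℝ) + #F' = #F := by exact_mod_cast hsplit
  have hlt : #F' < k := by
    rcases Nat.eq_zero_or_pos #(F.filter (fun X => w ∈ X)) with h | h
    · rw [h] at hwF; simp at hwF; subst hwF; simp at hX0
    · omega
  obtain ⟨R', hR'W, hR'h, hR'c⟩ := ih _ hlt F' rfl (fun X hX => hF X (mem_filter.1 hX).1)
  rcases F'.eq_empty_or_nonempty with he | hne'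
  · refine ⟨{w}, by simpa using hw, ?_, ?_⟩
    · intro X hX
      refine ⟨w, by simp, ?_⟩
      by_contra hc
      have : X ∈ F' := mem_filter.2 ⟨hX, hc⟩
      rw [he] at this; simp at this
    · have : 0 ≤ Real.log #F := Real.log_natCast_nonneg _
      simp
      positivity
  · refine ⟨insert w R', insert_subset hw hR'W, ?_, ?_⟩
    · intro X hX
      by_cases hc : w ∈ X
      · exact ⟨w, by simp, hc⟩
      · obtain ⟨v, hv, hvX⟩ := hR'h X (mem_filter.2 ⟨hX, hc⟩)
        exact ⟨v, by simp [hv], hvX⟩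
    · have hF'pos : (0:ℝ) < #F' := by exact_mod_cast hne'.card_pos
      have hle : (#F' : ℝ) ≤ #F * (1 - 1/r) := by
        have : (#F : ℝ)/r ≤ #(F.filter (fun X => w ∈ X)) := by
          rw [div_le_iff₀ hr0]; linarith
        have h2 : (#F : ℝ) * (1 - 1/r) = #F - #F/r := by ring
        rw [h2]; linarith
      have hp : 0 < 1 - 1/r := by
        by_contra hc
        have : (#F : ℝ) * (1 - 1/r) ≤ 0 := mul_nonpos_of_nonneg_of_nonpos hFpos.le (not_lt.1 hc)
        linarith
      have hlog : Real.log #F' ≤ Real.log #F - 1/r := by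
        have h1 := Real.log_le_log hF'pos hle
        rw [Real.log_mul hFpos.ne' hp.ne'] at h1
        have h2 := Real.log_le_sub_one_of_pos hp
        linarith
      have hc : (#(insert w R') : ℝ) ≤ #R' + 1 := by exact_mod_cast card_insert_le _ _
      have : r * Real.log #F' ≤ r * Real.log #F - 1 := by
        have := mul_le_mul_of_nonneg_left hlog hr0.le
        rw [mul_sub, mul_one_div_cancel hr0.ne'] at this
        exact this
      linarith

open Matrix in
theorem det_ev {n : ℕ} (B : Matrix (Fin n) (Fin n) ℝ) (t : Fin n → ℝ) (ht : Function.Injective t) :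
    ∀ᶠ η in nhdsWithin (0:ℝ) (Set.Ioi 0), (η • vandermonde t + B).det ≠ 0 := by
  set p : Polynomial ℝ := ((Polynomial.X : Polynomial ℝ) • (vandermonde t).map Polynomial.C + B.map Polynomial.C).det with hp
  have hp0 : p ≠ 0 := by
    intro h0
    have := Polynomial.coeff_det_X_add_C_card (vandermonde t) B
    rw [← hp, h0] at this
    simp only [Polynomial.coeff_zero] at this
    exact det_vandermonde_ne_zero_iff.2 ht this.symm
  have heval : ∀ η : ℝ, p.eval η = (η • vandermonde t + B).det := by
    intro η
    rw [hp, ← Polynomial.coe_evalRingHom, RingHom.map_det]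
    congr 1
    ext i j
    simp
  have hfin : {η : ℝ | p.eval η = 0}.Finite := by
    have := p.roots.toFinset.finite_toSet
    refine this.subset ?_
    intro η hη
    simp [hp0]
    exact hη
  have h1 : {η : ℝ | p.eval η = 0}ᶜ ∈ nhdsWithin (0:ℝ) (Set.Ioi 0) := by
    have h2 : nhdsWithin (0:ℝ) (Set.Ioi 0) ≤ Filter.cofinite :=
      (nhdsWithin_mono _ (fun x hx => ne_of_gt hx)).trans (nhdsNE_le_cofinite 0)
    exact h2 hfin.compl_mem_cofinite
  filter_upwards [h1] with η hη
  rw [← heval]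
  exact hη

/-- direction of perturbation -/
def tv (t : ℝ) : E4 := WithLp.toLp 2 ![t, t^2, t^3, t^4]

/-- perturbed normals -/
def pb {ι : Type*} (b0 : ι → E4) (t : ι → ℝ) (η : ℝ) (i : ι) : E4 := (1+η)⁻¹ • (b0 i + η • tv (t i))
/-- perturbed constants -/
def pc {ι : Type*} (c0 : ι → ℝ) (t : ι → ℝ) (η : ℝ) (i : ι) : ℝ := (1+η)⁻¹ * (c0 i + η * (t i)^5)

theorem Lb_pb {ι : Type*} (b0 : ι → E4) (t : ι → ℝ) (η : ℝ) (hη : 0 < η) (i : ι) (z : ℝ) (x : E4) :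
    (1+η) * Lb (pb b0 t η) i (z, x) = (1+η) * z + (b0 i 0 + η * t i) * x 0 +
      (b0 i 1 + η * (t i)^2) * x 1 + (b0 i 2 + η * (t i)^3) * x 2 + (b0 i 3 + η * (t i)^4) * x 3 := by
  have : 1 + η ≠ 0 := by positivity
  rw [Lb_apply, pb, inner_smul_left, mul_add]
  simp only [EuclideanSpace.inner_eq_star_dotProduct]
  simp [dotProduct, Fin.sum_univ_four, tv]
  field_simp
  simp only [Matrix.vecHead, Matrix.vecTail, Function.comp]
  simp only [show Fin.succ (0 : Fin 3) = 1 from rfl, show Fin.succ (0 : Fin 2) = 1 from rfl, show Fin.succ (0 : Fin 1) = 1 from rfl, show Fin.succ (1 : Fin 2) = 2 from rfl, show Fin.succ (1 : Fin 3) = 2 from rfl, show Fin.succ (2 : Fin 3) = 3 from rfl]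
  ring

theorem gen_ev {ι : Type*} [DecidableEq ι] [Fintype ι] (b0 : ι → E4) (c0 : ι → ℝ) (t : ι → ℝ)
    (ht : Function.Injective t) :
    ∀ᶠ η in nhdsWithin (0:ℝ) (Set.Ioi 0), Gn (Lb (pb b0 t η)) (pc c0 t η) := by
  have h5 : ∀ᶠ η in nhdsWithin (0:ℝ) (Set.Ioi 0), ∀ k : Fin 5 → ι, Function.Injective k →
      (η • Matrix.vandermonde (t ∘ k) + Matrix.of (fun a => ![1, b0 (k a) 0, b0 (k a) 1, b0 (k a) 2, b0 (k a) 3])).det ≠ 0 := by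
    rw [Filter.eventually_all]
    intro k
    by_cases hk : Function.Injective k
    · filter_upwards [det_ev (Matrix.of (fun a => ![1, b0 (k a) 0, b0 (k a) 1, b0 (k a) 2, b0 (k a) 3])) (t ∘ k) (ht.comp hk)] with η h _
      exact h
    · filter_upwards with η h
      exact absurd h hk
  have h6 : ∀ᶠ η in nhdsWithin (0:ℝ) (Set.Ioi 0), ∀ k : Fin 6 → ι, Function.Injective k →
      (η • Matrix.vandermonde (t ∘ k) + Matrix.of (fun a => ![1, b0 (k a) 0, b0 (k a) 1, b0 (k a) 2, b0 (k a) 3, c0 (k a)])).det ≠ 0 := by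
    rw [Filter.eventually_all]
    intro k
    by_cases hk : Function.Injective k
    · filter_upwards [det_ev (Matrix.of (fun a => ![1, b0 (k a) 0, b0 (k a) 1, b0 (k a) 2, b0 (k a) 3, c0 (k a)])) (t ∘ k) (ht.comp hk)] with η h _
      exact h
    · filter_upwards with η h
      exact absurd h hk
  have inj : ∀ (n : ℕ) (Z : Finset ι), #Z = n → ∃ k : Fin n → ι, Function.Injective k ∧ ∀ a, k a ∈ Z := by
    intro n Z hZ
    subst hZ
    exact ⟨fun a => (Z.equivFin.symm a : ι), fun a b h => by simpa using h, fun a => (Z.equivFin.symm a).2⟩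
  filter_upwards [h5, h6, self_mem_nhdsWithin] with η e5 e6 hη
  have hη : 0 < η := hη
  refine ⟨?_, ?_, ?_⟩
  · intro Z hZ
    set M : (ℝ × E4) →ₗ[ℝ] (Z → ℝ) := LinearMap.pi (fun i => Lb (pb b0 t η) i)
    have hker : LinearMap.ker M ≠ ⊥ := by
      apply LinearMap.ker_ne_bot_of_finrank_lt
      simp
      omega
    obtain ⟨d, hd, hd0⟩ := Submodule.exists_mem_ne_zero_of_ne_bot hker
    refine ⟨d, hd0, fun i hi => ?_⟩
    have := congrFun (LinearMap.mem_ker.1 hd) ⟨i, hi⟩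
    exact this
  · intro Z hZ d hd
    obtain ⟨k, hk, hkZ⟩ := inj 5 Z hZ
    obtain ⟨z, x⟩ := d
    have h0 := Matrix.eq_zero_of_mulVec_eq_zero (e5 k hk) (v := ![z, x 0, x 1, x 2, x 3]) (by
      ext a
      have h1 := Lb_pb b0 t η hη (k a) z x
      rw [hd (k a) (hkZ a), mul_zero] at h1
      simp [Matrix.mulVec, dotProduct, Fin.sum_univ_five, Matrix.vandermonde_apply]
      linear_combination -h1)
    have a0 := congrFun h0 0
    have a1 := congrFun h0 1
    have a2 := congrFun h0 2
    have a3 := congrFun h0 3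
    have a4 := congrFun h0 4
    simp at a0 a1 a2 a3 a4
    rw [Prod.mk_eq_zero]
    refine ⟨a0, ?_⟩
    ext j
    fin_cases j <;> simp [a1, a2, a3, a4]
  · intro Z y hy
    by_contra hcon
    push Not at hcon
    obtain ⟨Z', hZ', hc⟩ := exists_subset_card_eq (show 6 ≤ #Z by omega)
    obtain ⟨k, hk, hkZ⟩ := inj 6 Z' hc
    obtain ⟨z, x⟩ := y
    have h0 := Matrix.eq_zero_of_mulVec_eq_zero (e6 k hk) (v := ![z, x 0, x 1, x 2, x 3, 1]) (by
      ext a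
      have h1 := Lb_pb b0 t η hη (k a) z x
      have h2 := hy (k a) (hZ' (hkZ a))
      have h3 : (1+η) * pc c0 t η (k a) = c0 (k a) + η * (t (k a))^5 := by
        have : 1 + η ≠ 0 := by positivity
        rw [pc]; field_simp
      simp only [af] at h2
      have h4 : (1+η) * Lb (pb b0 t η) (k a) (z, x) + (1+η) * pc c0 t η (k a) = 0 := by
        rw [← mul_add, h2, mul_zero]
      rw [h1, h3] at h4
      simp [Matrix.mulVec, dotProduct, Fin.sum_univ_six, Matrix.vandermonde_apply]
      linear_combination h4)
    have a5 := congrFun h0 5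
    simp at a5

theorem perturb {ι : Type*} [DecidableEq ι] [Fintype ι] (b0 : ι → E4) (c0 : ι → ℝ) (U : Finset E4)
    (hU : ∀ u ∈ U, ∀ i, af (Lb b0) c0 i (Phi u) ≠ 0) :
    ∃ (b : ι → E4) (c : ι → ℝ), Gn (Lb b) c ∧ (∀ i, ‖b i - b0 i‖ < 1/64) ∧
      ∀ u ∈ U, ∀ i, (0 < af (Lb b) c i (Phi u) ↔ 0 < af (Lb b0) c0 i (Phi u)) ∧
        af (Lb b) c i (Phi u) ≠ 0 := by
  set t : ι → ℝ := fun i => ((Fintype.equivFin ι i : ℕ) : ℝ)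
  have ht : Function.Injective t := by
    intro i j h
    simp only [t, Nat.cast_inj] at h
    exact (Fintype.equivFin ι).injective (Fin.ext h)
  have tb : ∀ i, Filter.Tendsto (fun η => pb b0 t η i) (nhdsWithin (0:ℝ) (Set.Ioi 0)) (nhds (b0 i)) := by
    intro i
    have : ContinuousAt (fun η => pb b0 t η i) 0 := by
      unfold pb
      apply ContinuousAt.fun_smul
      · apply ContinuousAt.inv₀ (by fun_prop) (by norm_num)
      · fun_prop
    have h := this.tendsto
    simp only [pb, add_zero, inv_one, zero_smul, one_smul] at h
    exact h.mono_left nhdsWithin_le_nhds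
  have tc : ∀ i, Filter.Tendsto (fun η => pc c0 t η i) (nhdsWithin (0:ℝ) (Set.Ioi 0)) (nhds (c0 i)) := by
    intro i
    have : ContinuousAt (fun η => pc c0 t η i) 0 := by
      unfold pc
      apply ContinuousAt.fun_mul
      · apply ContinuousAt.inv₀ (by fun_prop) (by norm_num)
      · fun_prop
    have h := this.tendsto
    simp only [pc, add_zero, inv_one, zero_mul, one_mul] at h
    exact h.mono_left nhdsWithin_le_nhds
  have e1 : ∀ᶠ η in nhdsWithin (0:ℝ) (Set.Ioi 0), ∀ i, ‖pb b0 t η i - b0 i‖ < 1/64 := by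
    rw [Filter.eventually_all]
    intro i
    have := (tb i).eventually (Metric.ball_mem_nhds (b0 i) (ε := 1/64) (by norm_num))
    filter_upwards [this] with η h
    rw [← dist_eq_norm]; exact h
  have e2 : ∀ᶠ η in nhdsWithin (0:ℝ) (Set.Ioi 0), ∀ u ∈ U, ∀ i,
      (0 < af (Lb (pb b0 t η)) (pc c0 t η) i (Phi u) ↔ 0 < af (Lb b0) c0 i (Phi u)) ∧
        af (Lb (pb b0 t η)) (pc c0 t η) i (Phi u) ≠ 0 := by
    rw [Filter.eventually_all_finset]
    intro u hu
    rw [Filter.eventually_all]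
    intro i
    have hT : Filter.Tendsto (fun η => af (Lb (pb b0 t η)) (pc c0 t η) i (Phi u))
        (nhdsWithin (0:ℝ) (Set.Ioi 0)) (nhds (af (Lb b0) c0 i (Phi u))) := by
      simp only [af_Phi]
      exact ((tendsto_const_nhds.add ((tb i).inner tendsto_const_nhds)).add (tc i))
    rcases lt_or_gt_of_ne (hU u hu i) with h | h
    · filter_upwards [hT.eventually (gt_mem_nhds h)] with η h'
      exact ⟨⟨fun h1 => by linarith, fun h1 => by linarith⟩, h'.ne⟩
    · filter_upwards [hT.eventually (lt_mem_nhds h)] with η h'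
      exact ⟨⟨fun _ => h, fun _ => h'⟩, h'.ne'⟩
  obtain ⟨η, h1, h2, h3⟩ := ((gen_ev b0 c0 t ht).and (e1.and e2)).exists
  exact ⟨pb b0 t η, pc c0 t η, h1, h2, h3⟩


/-- directions of the bounding box -/
def bx (k : Fin 6) : E4 := WithLp.toLp 2 (![![1,0,0,0], ![0,1,0,0], ![0,0,1,0], ![0,0,0,1], ![-1,-1,-1,-1], ![0,0,0,0]] k)

theorem box_zero (b : Fin 6 → E4) (hb : ∀ k, ‖b k - bx k‖ < 1/64) (z : ℝ) (x : E4)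
    (h1 : ∀ k, k ≠ 5 → 0 ≤ z + inner ℝ (b k) x) (h2 : z + inner ℝ (b 5) x ≤ 0) : (z, x) = (0 : ℝ × E4) := by
  have hd : ∀ k, |inner ℝ (b k) x - inner ℝ (bx k) x| ≤ ‖x‖ / 64 := by
    intro k
    rw [← inner_sub_left]
    refine (abs_real_inner_le_norm _ _).trans ?_
    have := mul_le_mul_of_nonneg_right (hb k).le (norm_nonneg x)
    linarith
  have e0 : inner ℝ (bx 0) x = x 0 := by simp [bx, EuclideanSpace.inner_eq_star_dotProduct, dotProduct, Fin.sum_univ_four]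
  have e1 : inner ℝ (bx 1) x = x 1 := by simp [bx, EuclideanSpace.inner_eq_star_dotProduct, dotProduct, Fin.sum_univ_four]
  have e2 : inner ℝ (bx 2) x = x 2 := by simp [bx, EuclideanSpace.inner_eq_star_dotProduct, dotProduct, Fin.sum_univ_four]
  have e3 : inner ℝ (bx 3) x = x 3 := by simp [bx, EuclideanSpace.inner_eq_star_dotProduct, dotProduct, Fin.sum_univ_four]
  have e4 : inner ℝ (bx 4) x = - x 0 - x 1 - x 2 - x 3 := by
    simp [bx, EuclideanSpace.inner_eq_star_dotProduct, dotProduct, Fin.sum_univ_four]; ring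
  have e5 : inner ℝ (bx 5) x = 0 := by simp [bx, EuclideanSpace.inner_eq_star_dotProduct, dotProduct, Fin.sum_univ_four]
  have d0 := abs_le.1 (hd 0)
  have d1 := abs_le.1 (hd 1)
  have d2 := abs_le.1 (hd 2)
  have d3 := abs_le.1 (hd 3)
  have d4 := abs_le.1 (hd 4)
  have d5 := abs_le.1 (hd 5)
  rw [e0] at d0; rw [e1] at d1; rw [e2] at d2; rw [e3] at d3; rw [e4] at d4; rw [e5] at d5
  have p0 := h1 0 (by decide)
  have p1 := h1 1 (by decide)
  have p2 := h1 2 (by decide)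
  have p3 := h1 3 (by decide)
  have p4 := h1 4 (by decide)
  set e := ‖x‖ / 64 with he
  have hn : ‖x‖^2 = x 0 ^2 + x 1 ^2 + x 2 ^2 + x 3 ^2 := by
    rw [EuclideanSpace.real_norm_sq_eq, Fin.sum_univ_four]
  have he0 : 0 ≤ e := by positivity
  have q0 : x 0 ^2 ≤ (8*e)^2 := sq_le_sq' (by linarith) (by linarith)
  have q1 : x 1 ^2 ≤ (8*e)^2 := sq_le_sq' (by linarith) (by linarith)
  have q2 : x 2 ^2 ≤ (8*e)^2 := sq_le_sq' (by linarith) (by linarith)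
  have q3 : x 3 ^2 ≤ (8*e)^2 := sq_le_sq' (by linarith) (by linarith)
  have hx64 : ‖x‖ = 64 * e := by rw [he]; ring
  have he00 : e = 0 := by
    rw [hx64] at hn
    nlinarith
  have hx : x = 0 := by rw [← norm_eq_zero, hx64, he00, mul_zero]
  subst hx
  simp at h2 p0
  simp
  linarith

theorem convex_sign {ι Y : Type*} [AddCommGroup Y] [Module ℝ Y] (L : ι → Y →ₗ[ℝ] ℝ) (c : ι → ℝ) (i : ι)
    (V : Set Y) (u : Y) (hu : u ∈ convexHull ℝ V) (h0 : ∀ v ∈ V, 0 ≤ af L c i v) : 0 ≤ af L c i u := by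
  have : convexHull ℝ V ⊆ {y | 0 ≤ af L c i y} := by
    refine convexHull_min h0 ?_
    have : {y | 0 ≤ af L c i y} = {y | - c i ≤ L i y} := by
      ext y; simp only [af, Set.mem_ofPred_eq]; constructor <;> intro h <;> linarith
    rw [this]
    exact convex_halfSpace_ge (L i).isLinear _
  exact this hu

theorem convex_sign' {ι Y : Type*} [AddCommGroup Y] [Module ℝ Y] (L : ι → Y →ₗ[ℝ] ℝ) (c : ι → ℝ) (i : ι)
    (V : Set Y) (u : Y) (hu : u ∈ convexHull ℝ V) (h0 : ∀ v ∈ V, af L c i v ≤ 0) : af L c i u ≤ 0 := by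
  have : convexHull ℝ V ⊆ {y | af L c i y ≤ 0} := by
    refine convexHull_min h0 ?_
    have : {y | af L c i y ≤ 0} = {y | L i y ≤ - c i} := by
      ext y; simp only [af, Set.mem_ofPred_eq]; constructor <;> intro h <;> linarith
    rw [this]
    exact convex_halfSpace_le (L i).isLinear _
  exact this hu

/-- normals with a box -/
def bz {J : Type*} (b0 : J → E4) : (J × Bool) ⊕ Fin 6 → E4 := Sum.elim (fun p => b0 p.1) bx
/-- constants with a box -/
def cz {J : Type*} (c0 : J → Bool → ℝ) (c : ℝ) : (J × Bool) ⊕ Fin 6 → ℝ :=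
  Sum.elim (fun p => c0 p.1 p.2) (fun k => if k = 5 then -c else c)

/-- constant in the partition theorem -/
def KP : ℝ := 270^5 * 6144 * 328^4 * 2^32

theorem part_core {J : Type} [DecidableEq J] [Fintype J] [Nonempty J] (b0 : J → E4) (c0 : J → Bool → ℝ)
    (U : Finset E4) (hU : ∀ u ∈ U, ∀ j s, ‖u‖^2 + inner ℝ (b0 j) u + c0 j s ≠ 0) (r : ℝ) (hr : 1 ≤ r) :
    ∃ (Λ : Type) (lab : E4 → Λ) (T : Finset Λ) (X : Λ → Finset J),
      (#T : ℝ) ≤ KP * (1 + Real.log (8 * Fintype.card J))^9 * r^4 ∧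
      ∀ u ∈ U, lab u ∈ T ∧ r * #(X (lab u)) ≤ Fintype.card J ∧
        ∀ u' ∈ U, lab u = lab u' → ∀ j ∉ X (lab u), ∀ s, 0 < ‖u‖^2 + inner ℝ (b0 j) u + c0 j s →
          0 < ‖u'‖^2 + inner ℝ (b0 j) u' + c0 j s := by
  classical
  obtain ⟨c1, hc1⟩ : ∃ c1 : ℝ, ∀ u ∈ U, ∀ k, |‖u‖^2 + inner ℝ (bx k) u| < c1 := by
    refine ⟨1 + ∑ u ∈ U, ∑ k, |‖u‖^2 + inner ℝ (bx k) u|, fun u hu k => ?_⟩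
    have h1 := single_le_sum (s := univ) (f := fun k => |‖u‖^2 + inner ℝ (bx k) u|) (fun k _ => abs_nonneg _) (mem_univ k)
    have h2 := single_le_sum (s := U) (f := fun u => ∑ k, |‖u‖^2 + inner ℝ (bx k) u|) (fun k _ => sum_nonneg (fun k _ => abs_nonneg _)) hu
    linarith
  have hbase : ∀ u ∈ U, ∀ i : (J × Bool) ⊕ Fin 6, af (Lb (bz b0)) (cz c0 c1) i (Phi u) ≠ 0 := by
    intro u hu i
    rw [af_Phi]
    rcases i with ⟨j, s⟩ | k
    · exact hU u hu j s
    · have := abs_lt.1 (hc1 u hu k)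
      simp only [bz, cz, Sum.elim_inr]
      split_ifs <;> intro h <;> linarith
  obtain ⟨b, c, G, hb, hsgn⟩ := perturb (bz b0) (cz c0 c1) U hbase
  set f := af (Lb b) c with hf
  set vert : (Fin 5 → (J × Bool) ⊕ Fin 6) → ℝ × E4 := fun k => if h : ∃ y, ∀ a, f (k a) y = 0 then h.choose else 0 with hvert
  set cross : Set (ℝ × E4) → Finset J := fun V => univ.filter (fun j => ∃ s, ¬ ((∀ v ∈ V, 0 ≤ f (Sum.inl (j,s)) v) ∨ (∀ v ∈ V, f (Sum.inl (j,s)) v ≤ 0))) with hcross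
  set F : Finset (Finset J) := ((univ : Finset (Fin 32 → Fin 5 → (J × Bool) ⊕ Fin 6)).image (fun k => cross (Set.range (fun a => vert (k a))))).filter (fun X => (#(univ : Finset J) : ℝ) < r * #X) with hF
  obtain ⟨R, -, hR1, hR2⟩ := hitting (univ : Finset J) r hr _ F rfl (by
    intro X hX
    exact ⟨subset_univ _, (mem_filter.1 hX).2⟩)
  set S : Finset ((J × Bool) ⊕ Fin 6) := (R ×ˢ (univ : Finset Bool)).disjSum univ with hS
  set n := Fintype.card J with hn
  have hn1 : 1 ≤ n := Fintype.card_pos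
  have hn1' : (1:ℝ) ≤ n := by exact_mod_cast hn1
  set lg := 1 + Real.log (8 * n) with hlg
  have hcι : Fintype.card ((J × Bool) ⊕ Fin 6) = 2 * n + 6 := by
    rw [Fintype.card_sum, Fintype.card_prod]; simp; omega
  have hcι' : ((Fintype.card ((J × Bool) ⊕ Fin 6) : ℕ):ℝ) ≤ 8 * n := by
    rw [hcι]; push_cast; linarith
  have hlogι : Real.log (Fintype.card ((J × Bool) ⊕ Fin 6)) ≤ Real.log (8 * n) := by
    apply Real.log_le_log _ hcι'
    rw [hcι]; push_cast; linarith
  have hlogpos : 0 ≤ Real.log (8*n) := Real.log_nonneg (by linarith)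
  have hlg1 : 1 ≤ lg := by linarith
  have hFc : Real.log #F ≤ 160 * Real.log (8*n) := by
    have h1 : #F ≤ (Fintype.card ((J × Bool) ⊕ Fin 6))^160 := by
      refine (card_filter_le _ _).trans (card_image_le.trans ?_)
      rw [card_univ, Fintype.card_fun, Fintype.card_fun, Fintype.card_fin, Fintype.card_fin, ← pow_mul]
    rcases Nat.eq_zero_or_pos #F with h0 | h0
    · rw [h0]; simp; positivity
    · have h2 : Real.log #F ≤ Real.log ((Fintype.card ((J × Bool) ⊕ Fin 6) : ℝ)^160) := by
        apply Real.log_le_log (by exact_mod_cast h0)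
        exact_mod_cast h1
      rw [Real.log_pow] at h2
      push_cast at h2
      linarith
  have hScard : (#S : ℝ) ≤ 328 * (r * lg) := by
    have h1 : #S = #R * 2 + 6 := by
      rw [hS, card_disjSum, card_product]; simp
    rw [h1]; push_cast
    have h2 : r * Real.log #F ≤ r * (160 * Real.log (8*n)) := by gcongr
    have h3 : 1 ≤ r * lg := by nlinarith
    have h4 : r * Real.log (8*n) ≤ r * lg := by
      have : Real.log (8*n) ≤ lg := by linarith
      gcongr
    nlinarith
  set U' : Finset (ℝ × E4) := U.image Phi with hU'
  have hU0 : ∀ u ∈ U', ∀ i, af (Lb b) c i u ≠ 0 := by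
    intro u hu i
    obtain ⟨x, hx, rfl⟩ := mem_image.1 hu
    exact (hsgn x hx i).2
  obtain ⟨lab, V, hl1, hl2⟩ := cells G U' S hU0 (by
    intro u hu B hB
    obtain ⟨x, hx, rfl⟩ := mem_image.1 hu
    intro d hd
    by_contra hcon
    push Not at hcon
    apply hd
    obtain ⟨z, y⟩ := d
    have hinS : ∀ k, (Sum.inr k : (J × Bool) ⊕ Fin 6) ∈ S := by intro k; rw [hS]; exact inr_mem_disjSum.2 (mem_univ _)
    apply box_zero (fun k => b (Sum.inr k)) (fun k => by simpa [bz] using hb (Sum.inr k)) z y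
    · intro k hk
      have h1 := hcon (Sum.inr k) (hinS k)
      rw [Lb_apply] at h1
      apply h1.1
      rw [hB _ (hinS k), (hsgn x hx _).1, af_Phi]
      have := abs_lt.1 (hc1 x hx k)
      simp only [bz, cz, Sum.elim_inr, if_neg hk]
      linarith
    · have h1 := hcon (Sum.inr 5) (hinS 5)
      rw [Lb_apply] at h1
      apply h1.2
      rw [hB _ (hinS 5), (hsgn x hx _).1, af_Phi]
      have := abs_lt.1 (hc1 x hx 5)
      simp only [bz, cz, Sum.elim_inr, if_true]
      linarith)
  refine ⟨_, fun u => lab (Phi u), U'.image lab, fun l => cross (V l), ?_, ?_⟩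
  · have h1 := Obj_bound G (by omega) U' (fun u hu => by obtain ⟨x, _, rfl⟩ := mem_image.1 hu; exact ⟨x, rfl⟩) hU0 S
    have h2 : (#(U'.image lab) : ℝ) ≤ #(Obj (af (Lb b) c) U' 5 0 S) * 2^32 := by
      have h3 : #(U'.image lab) ≤ #(Obj (af (Lb b) c) U' 5 0 S) * 2^32 := by convert hl1
      exact_mod_cast h3
    calc (#(U'.image lab) : ℝ) ≤ #(Obj (af (Lb b) c) U' 5 0 S) * 2^32 := h2
      _ ≤ ((270 * (1 + Real.log (Fintype.card ((J × Bool) ⊕ Fin 6))))^5 * 6144 * (#S : ℝ)^4) * 2^32 := by gcongr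
      _ ≤ ((270 * lg)^5 * 6144 * (328 * (r * lg))^4) * 2^32 := by
          have : 0 ≤ Real.log (Fintype.card ((J × Bool) ⊕ Fin 6)) := Real.log_natCast_nonneg _
          have : 1 + Real.log (Fintype.card ((J × Bool) ⊕ Fin 6)) ≤ lg := by linarith
          gcongr
      _ = KP * lg^9 * r^4 := by rw [KP]; ring
  · intro u hu
    have hu' : Phi u ∈ U' := mem_image_of_mem _ hu
    obtain ⟨a1, ⟨g, hg⟩, a3, a4⟩ := hl2 _ hu'
    refine ⟨mem_image_of_mem _ hu', ?_, ?_⟩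
    · by_contra hcon
      push Not at hcon
      have hZ : ∀ a, ∃ k : Fin 5 → (J × Bool) ⊕ Fin 6, vert k = g a := by
        intro a
        obtain ⟨Z, hZ1, hZ2⟩ := a3 (g a) (by rw [hg]; exact ⟨a, rfl⟩)
        set e : Fin 5 ≃ Z := (finCongr hZ1.symm).trans Z.equivFin.symm
        refine ⟨fun a => (e a : (J × Bool) ⊕ Fin 6), ?_⟩
        have hex : ∃ y, ∀ a, f (e a : (J × Bool) ⊕ Fin 6) y = 0 := ⟨g a, fun a' => hZ2 _ (e a').2⟩
        rw [hvert]
        simp only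
        rw [dif_pos hex]
        have h1 := hex.choose_spec
        set y := hex.choose
        have h2 : y - g a = 0 := by
          apply G.g1 Z hZ1
          intro i hi
          have h3 := h1 (e.symm ⟨i, hi⟩)
          rw [Equiv.apply_symm_apply] at h3
          have h4 := hZ2 i hi
          simp only [hf, af] at h3 h4
          rw [map_sub]; linarith
        exact sub_eq_zero.1 h2
      choose k hk using hZ
      have hmem : cross (V (lab (Phi u))) ∈ F := by
        rw [hF, mem_filter]
        refine ⟨mem_image.2 ⟨k, mem_univ _, ?_⟩, by simpa using hcon⟩
        rw [hg]
        congr 2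
        ext a
        all_goals rw [hk]
      obtain ⟨w, hwR, hwX⟩ := hR1 _ hmem
      obtain ⟨s, hs⟩ := (mem_filter.1 hwX).2
      apply hs
      apply a4
      simp [hS, hwR]
    · intro u1 hu1 hlab j hj s hpos
      obtain ⟨c1, -⟩ := hl2 (Phi u1) (mem_image_of_mem _ hu1)
      have hlab : lab (Phi u) = lab (Phi u1) := hlab
      rw [← hlab] at c1
      have hj' : (∀ v ∈ V (lab (Phi u)), 0 ≤ f (Sum.inl (j,s)) v) ∨ (∀ v ∈ V (lab (Phi u)), f (Sum.inl (j,s)) v ≤ 0) := by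
        by_contra hcon
        exact hj (mem_filter.2 ⟨mem_univ _, s, hcon⟩)
      have e1 := hsgn u hu (Sum.inl (j,s))
      have e2 := hsgn u1 hu1 (Sum.inl (j,s))
      rw [af_Phi (bz b0)] at e1 e2
      simp only [bz, cz, Sum.elim_inl] at e1 e2
      rw [← e2.1]
      rw [← e1.1] at hpos
      rcases hj' with h | h
      · exact lt_of_le_of_ne (convex_sign _ _ _ _ _ c1 h) (Ne.symm e2.2)
      · have := convex_sign' _ _ _ _ _ a1 h
        linarith


/-- incidence relation: `w - u` lies on the sphere -/
def Inc (m : ℕ) (u w : Fin 4 → ℤ) : Prop := ∑ i, (w i - u i)^2 = (m : ℤ)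

/-- embedding of integer points -/
def emb (u : Fin 4 → ℤ) : E4 := WithLp.toLp 2 (fun k => (u k : ℝ))

theorem emb_val (m : ℕ) (u w : Fin 4 → ℤ) (c : ℝ) :
    ‖emb u‖^2 + inner ℝ ((-2 : ℝ) • emb w) (emb u) + (‖emb w‖^2 - m + c) =
      ((∑ i, (w i - u i)^2 - (m : ℤ) : ℤ) : ℝ) + c := by
  rw [inner_smul_left, EuclideanSpace.real_norm_sq_eq, EuclideanSpace.real_norm_sq_eq]
  simp only [EuclideanSpace.inner_eq_star_dotProduct]
  simp [dotProduct, Fin.sum_univ_four, emb]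
  ring

theorem part_thm (m : ℕ) (W U : Finset (Fin 4 → ℤ)) (hW : W.Nonempty) (r : ℝ) (hr : 1 ≤ r) :
    ∃ (Λ : Type) (lab : (Fin 4 → ℤ) → Λ) (T : Finset Λ) (X : Λ → Finset (Fin 4 → ℤ)),
      (#T : ℝ) ≤ KP * (1 + Real.log (8 * #W))^9 * r^4 ∧
      ∀ u ∈ U, lab u ∈ T ∧ X (lab u) ⊆ W ∧ r * #(X (lab u)) ≤ #W ∧
        ∀ u' ∈ U, lab u = lab u' → ∀ w ∈ W, w ∉ X (lab u) → Inc m u w → Inc m u' w := by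
  classical
  have : Nonempty W := hW.to_subtype
  have hne : ∀ (n : ℤ) (s : Bool), (n : ℝ) + (if s then 1/2 else -1/2) ≠ 0 := by
    intro n s h
    have h2 : (2 * n + (if s then 1 else -1) : ℝ) = 0 := by split_ifs at h ⊢ <;> linarith
    split_ifs at h2
    · have : 2 * n + 1 = 0 := by exact_mod_cast h2
      omega
    · have : 2 * n + -1 = 0 := by exact_mod_cast h2
      omega
  obtain ⟨Λ, lab, T, X, h1, h2⟩ := part_core (J := W) (fun w => (-2 : ℝ) • emb w.1)
    (fun w s => ‖emb w.1‖^2 - m + (if s then 1/2 else -1/2)) (U.image emb) (by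
      intro u hu j s
      obtain ⟨x, hx, rfl⟩ := mem_image.1 hu
      rw [emb_val]
      exact hne _ _) r hr
  refine ⟨Λ, fun u => lab (emb u), T, fun l => (X l).image Subtype.val, by simpa using h1, fun u hu => ?_⟩
  obtain ⟨a1, a2, a3⟩ := h2 (emb u) (mem_image_of_mem _ hu)
  refine ⟨a1, ?_, ?_, ?_⟩
  · intro x hx
    obtain ⟨y, _, rfl⟩ := mem_image.1 hx
    exact y.2
  · rw [card_image_of_injective _ Subtype.val_injective]
    simpa using a2
  · intro u' hu' hl w hw hwX hinc
    have hwX' : (⟨w, hw⟩ : W) ∉ X (lab (emb u)) := fun h => hwX (mem_image.2 ⟨_, h, rfl⟩)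
    obtain ⟨b1, b2, b3⟩ := h2 (emb u') (mem_image_of_mem _ hu')
    have hl' : lab (emb u') = lab (emb u) := hl.symm
    have c1 := a3 (emb u') (mem_image_of_mem _ hu') hl _ hwX' true
    have c2 := b3 (emb u) (mem_image_of_mem _ hu) hl' ⟨w, hw⟩ (by rw [hl']; exact hwX') false
    simp only [emb_val] at c1 c2
    unfold Inc at *
    set N := ∑ i, (w i - u i)^2 - (m : ℤ) with hN
    set N' := ∑ i, (w i - u' i)^2 - (m : ℤ) with hN'
    have hN0 : N = 0 := by rw [hN, hinc]; simp
    rw [hN0] at c1 c2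
    simp at c1 c2
    have d1 : (-1 : ℝ) < N' := by linarith
    have d2 : (N' : ℝ) < 1 := by
      by_contra h
      push Not at h
      have := c2 (by linarith)
      norm_num at this
    have d1' : -1 < N' := by exact_mod_cast d1
    have d2' : N' < 1 := by exact_mod_cast d2
    omega


section incidence
variable {α β : Type} (inc : α → β → Prop)

open Classical in
/-- number of incidences -/
def II (U : Finset α) (W : Finset β) : ℕ := ∑ u ∈ U, #(W.filter (fun w => inc u w))

open Classical in
theorem II_dual (U : Finset α) (W : Finset β) : II inc U W = II (fun w u => inc u w) W U :=
  sum_card_bipartiteAbove_eq_sum_card_bipartiteBelow inc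

open Classical in
theorem kst (U : Finset α) (X : Finset β) (t : ℝ)
    (h3 : ∀ T ⊆ U, #T = 3 → (#(X.filter (fun w => ∀ u ∈ T, inc u w)) : ℝ) ≤ t) (l : ℝ) (hl : 0 < l) (ht : 0 ≤ t) :
    (II inc U X : ℝ) ≤ (2 + l) * #X + t * (#U : ℝ)^3 / l^2 := by
  rw [II_dual]
  unfold II
  set d : β → ℕ := fun w => #(U.filter (fun u => inc u w)) with hd
  have h1 : (∑ w ∈ X, (d w).choose 3 : ℕ) = ∑ T ∈ powersetCard 3 U, #(X.filter (fun w => ∀ u ∈ T, inc u w)) := by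
    refine Eq.trans ?_ (sum_card_bipartiteAbove_eq_sum_card_bipartiteBelow (fun w (T : Finset α) => ∀ u ∈ T, inc u w) (s := X) (t := powersetCard 3 U))
    apply sum_congr rfl
    intro w _
    rw [hd, ← card_powersetCard]
    congr 1
    ext T
    simp only [mem_powersetCard, bipartiteAbove, mem_filter, subset_iff]
    constructor
    · rintro ⟨h1, h2⟩
      exact ⟨⟨fun x hx => (h1 hx).1, h2⟩, fun u hu => (h1 hu).2⟩
    · rintro ⟨⟨h1, h2⟩, h3⟩
      exact ⟨fun x hx => ⟨h1 hx, h3 x hx⟩, h2⟩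
  have h2 : ((∑ w ∈ X, (d w).choose 3 : ℕ) : ℝ) ≤ t * ((#U).choose 3 : ℕ) := by
    rw [h1, Nat.cast_sum, ← card_powersetCard, mul_comm, ← nsmul_eq_mul]
    apply sum_le_card_nsmul
    intro T hT
    rw [mem_powersetCard] at hT
    exact h3 T hT.1 hT.2
  have h4 : ∀ w, (((d w - 2 : ℕ) : ℝ))^3 ≤ 6 * ((d w).choose 3 : ℕ) := by
    intro w
    have h5 := Nat.pow_sub_le_descFactorial (d w) 3
    rw [Nat.descFactorial_eq_factorial_mul_choose] at h5
    have : d w + 1 - 3 = d w - 2 := by omega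
    rw [this] at h5
    have h6 : (Nat.factorial 3) = 6 := rfl
    rw [h6] at h5
    exact_mod_cast h5
  have h5 : (6:ℝ) * ((#U).choose 3 : ℕ) ≤ (#U : ℝ)^3 := by
    have h5 := Nat.descFactorial_le_pow (#U) 3
    rw [Nat.descFactorial_eq_factorial_mul_choose] at h5
    have h6 : (Nat.factorial 3) = 6 := rfl
    rw [h6] at h5
    exact_mod_cast h5
  have h6 : ∑ w ∈ X, (((d w - 2 : ℕ) : ℝ))^3 ≤ t * (#U:ℝ)^3 := by
    calc ∑ w ∈ X, (((d w - 2 : ℕ) : ℝ))^3 ≤ ∑ w ∈ X, 6 * ((d w).choose 3 : ℝ) := sum_le_sum (fun w _ => h4 w)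
      _ = 6 * ((∑ w ∈ X, (d w).choose 3 : ℕ) : ℝ) := by rw [← mul_sum]; push_cast; rfl
      _ ≤ 6 * (t * ((#U).choose 3 : ℕ)) := by gcongr
      _ = t * (6 * ((#U).choose 3 : ℕ)) := by ring
      _ ≤ t * (#U:ℝ)^3 := by gcongr
  have h7 : ∀ w, (d w : ℝ) ≤ (2 + l) + (((d w - 2 : ℕ) : ℝ))^3 / l^2 := by
    intro w
    have h8 : (d w : ℝ) ≤ 2 + ((d w - 2 : ℕ) : ℝ) := by
      have : d w ≤ 2 + (d w - 2) := by omega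
      exact_mod_cast this
    set a : ℝ := ((d w - 2 : ℕ) : ℝ)
    have ha : 0 ≤ a := Nat.cast_nonneg _
    have h9 : a ≤ l + a^3/l^2 := by
      rcases le_total a l with h | h
      · have : 0 ≤ a^3/l^2 := by positivity
        linarith
      · have : a ≤ a^3/l^2 := by
          rw [le_div_iff₀ (by positivity)]
          nlinarith [mul_le_mul_of_nonneg_left (pow_le_pow_left₀ hl.le h 2) ha]
        linarith
    linarith
  calc ((∑ w ∈ X, d w : ℕ) : ℝ) = ∑ w ∈ X, (d w : ℝ) := by push_cast; rfl
    _ ≤ ∑ w ∈ X, ((2 + l) + (((d w - 2 : ℕ) : ℝ))^3 / l^2) := sum_le_sum (fun w _ => h7 w)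
    _ = (2+l) * #X + (∑ w ∈ X, (((d w - 2 : ℕ) : ℝ))^3) / l^2 := by
        rw [sum_add_distrib, sum_const, nsmul_eq_mul, sum_div]; ring
    _ ≤ (2 + l) * #X + t * (#U : ℝ)^3 / l^2 := by gcongr

open Classical in
/-- partition hypothesis -/
def HasPart (U : Finset α) (W : Finset β) (L : ℝ) : Prop :=
  ∀ r : ℝ, 1 ≤ r → ∃ (Λ : Type) (lab : α → Λ) (T : Finset Λ) (X : Λ → Finset β),
      (#T : ℝ) ≤ L * r^4 ∧
      ∀ u ∈ U, lab u ∈ T ∧ X (lab u) ⊆ W ∧ r * #(X (lab u)) ≤ #W ∧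
        ∀ u' ∈ U, lab u = lab u' → ∀ w ∈ W, w ∉ X (lab u) → inc u w → inc u' w

open Classical in
theorem one_step (U : Finset α) (W : Finset β) (L t : ℝ) (ht : 1 ≤ t) (hL : 0 ≤ L) (hW : W.Nonempty)
    (hP : HasPart inc U W L)
    (h3 : ∀ T ⊆ U, #T = 3 → (#(W.filter (fun w => ∀ u ∈ T, inc u w)) : ℝ) ≤ t) (r : ℝ) (hr : 1 ≤ r) :
    ∃ U1 ⊆ U, (#U1 : ℝ) ≤ 2 * (L * r^4) ∧
      (II inc U W : ℝ) ≤ 2 * L * r^3 * #W + (1+t) * #U * ((#W : ℝ)/r)^((2:ℝ)/3) + t * #U + II inc U1 W := by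
  obtain ⟨Λ, lab, T, X, hT, hu⟩ := hP r hr
  have hr0 : 0 < r := by linarith
  set Uc : Λ → Finset α := fun l => U.filter (fun u => lab u = l) with hUc
  have hn0 : (0:ℝ) < #W := by exact_mod_cast hW.card_pos
  set q : ℝ := ((#W : ℝ)/r)^((2:ℝ)/3) with hq
  have hq0 : 0 ≤ q := by positivity
  set U1 := U.filter (fun u => #(Uc (lab u)) ≤ 2) with hU1
  have hmap : ∀ u ∈ U, lab u ∈ T := fun u h => (hu u h).1
  refine ⟨U1, filter_subset _ _, ?_, ?_⟩
  · have h1 : #U1 ≤ 2 * #T := by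
      apply card_le_mul_card_image_of_maps_to (f := lab) (t := T)
      · intro u h
        exact hmap u (mem_filter.1 h).1
      · intro l _
        by_cases hl : ∃ u ∈ U1, lab u = l
        · obtain ⟨u, hu1, rfl⟩ := hl
          refine le_trans (card_le_card ?_) (mem_filter.1 hu1).2
          intro x hx
          rw [mem_filter] at hx
          exact mem_filter.2 ⟨(mem_filter.1 hx.1).1, hx.2⟩
        · rw [card_eq_zero.2]
          · omega
          · rw [filter_eq_empty_iff]
            intro x hx h
            exact hl ⟨x, hx, h⟩
    have : (#U1 : ℝ) ≤ 2 * #T := by exact_mod_cast h1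
    linarith
  · -- split
    have hsplit : II inc U W = II inc U1 W + II inc (U.filter (fun u => ¬ #(Uc (lab u)) ≤ 2)) W := by
      unfold II; rw [sum_filter_add_sum_filter_not]
    set U2 := U.filter (fun u => ¬ #(Uc (lab u)) ≤ 2) with hU2
    have hII2 : II inc U2 W ≤ ∑ l ∈ T, (II inc (Uc l) (X l) + 0) + ∑ u ∈ U2, #((W \ X (lab u)).filter (fun w => inc u w)) := by
      have e1 : II inc U2 W ≤ ∑ u ∈ U2, (#((X (lab u)).filter (fun w => inc u w)) + #((W \ X (lab u)).filter (fun w => inc u w))) := by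
        unfold II
        apply sum_le_sum
        intro u _
        rw [← card_union_of_disjoint]
        · apply card_le_card
          intro w hw
          rw [mem_filter] at hw
          by_cases h : w ∈ X (lab u)
          · exact mem_union_left _ (mem_filter.2 ⟨h, hw.2⟩)
          · exact mem_union_right _ (mem_filter.2 ⟨mem_sdiff.2 ⟨hw.1, h⟩, hw.2⟩)
        · apply disjoint_filter_filter
          exact disjoint_sdiff
      rw [sum_add_distrib] at e1
      refine e1.trans (Nat.add_le_add_right ?_ _)
      calc ∑ u ∈ U2, #((X (lab u)).filter (fun w => inc u w)) ≤ ∑ u ∈ U, #((X (lab u)).filter (fun w => inc u w)) :=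
            sum_le_sum_of_subset (filter_subset _ _)
        _ = ∑ l ∈ T, ∑ u ∈ U with lab u = l, #((X (lab u)).filter (fun w => inc u w)) := (sum_fiberwise_of_maps_to hmap _).symm
        _ = ∑ l ∈ T, (II inc (Uc l) (X l) + 0) := by
            apply sum_congr rfl
            intro l _
            rw [add_zero]
            apply sum_congr rfl
            intro u hul
            rw [(mem_filter.1 hul).2]
    -- noncrossing
    have hnc : ∀ u ∈ U2, (#((W \ X (lab u)).filter (fun w => inc u w)) : ℝ) ≤ t := by
      intro u hu2
      rw [hU2, mem_filter] at hu2
      obtain ⟨T3, hT3, hc3⟩ := exists_subset_card_eq (show 3 ≤ #(Uc (lab u)) by omega)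
      refine le_trans ?_ (h3 T3 (hT3.trans (filter_subset _ _)) hc3)
      norm_cast
      apply card_le_card
      intro w hw
      rw [mem_filter, mem_sdiff] at hw
      refine mem_filter.2 ⟨hw.1.1, fun u' hu' => ?_⟩
      have := mem_filter.1 (hT3 hu')
      exact (hu u hu2.1).2.2.2 u' this.1 this.2.symm w hw.1.1 hw.1.2 hw.2
    have hnc' : ((∑ u ∈ U2, #((W \ X (lab u)).filter (fun w => inc u w)) : ℕ) : ℝ) ≤ t * #U := by
      push_cast
      calc _ ≤ #U2 • t := sum_le_card_nsmul _ _ _ hnc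
        _ = t * #U2 := by rw [nsmul_eq_mul, mul_comm]
        _ ≤ t * #U := by
          have : #U2 ≤ #U := card_le_card (filter_subset _ _)
          gcongr
    have hcell : ∀ l ∈ T, ((II inc (Uc l) (X l) + 0 : ℕ) : ℝ) ≤ 2 * (#W / r) + (1+t) * #(Uc l) * q := by
      intro l _
      rw [add_zero]
      rcases (Uc l).eq_empty_or_nonempty with he | ⟨u, hul⟩
      · rw [he]; simp [II]; positivity
      · have hcp : (0:ℝ) < #(Uc l) := by exact_mod_cast card_pos.2 ⟨u, hul⟩
        rw [hUc, mem_filter] at hul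
        obtain ⟨hul, rfl⟩ := hul
        obtain ⟨-, hX, hXr, -⟩ := hu u hul
        have hXc : (#(X (lab u)) : ℝ) ≤ #W / r := by rw [le_div_iff₀ hr0]; linarith
        set N : ℝ := #W / r with hN
        have hN0 : 0 < N := by positivity
        set p : ℝ := N^((1:ℝ)/3) with hp
        have hp0 : 0 < p := by positivity
        have hp3 : p^3 = N := by
          rw [hp, ← Real.rpow_natCast, ← Real.rpow_mul hN0.le]; norm_num
        have hp2 : p^2 = q := by
          rw [hp, ← Real.rpow_natCast, ← Real.rpow_mul hN0.le, hq]; norm_num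
        have hk := kst inc (Uc (lab u)) (X (lab u)) t (by
          intro T3 h1 h2
          refine le_trans ?_ (h3 T3 (h1.trans (filter_subset _ _)) h2)
          norm_cast
          exact card_le_card (filter_subset_filter _ hX)) (#(Uc (lab u)) / p) (by positivity) (by linarith)
        refine hk.trans ?_
        set x : ℝ := (#(Uc (lab u)) : ℝ)
        have h1 : (2 + x / p) * #(X (lab u)) ≤ (2 + x/p) * N := by gcongr
        have h2 : (2 + x/p) * N = 2 * N + x * q := by
          rw [← hp2, ← hp3]; field_simp
        have h4 : t * x^3 / (x/p)^2 = t * x * q := by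
          rw [← hp2]; field_simp
        rw [h4]
        linarith
    have hsum : ((∑ l ∈ T, (II inc (Uc l) (X l) + 0) : ℕ) : ℝ) ≤ 2 * L * r^3 * #W + (1+t) * #U * q := by
      rw [Nat.cast_sum]
      have hcard : (∑ l ∈ T, (#(Uc l) : ℝ)) = #U := by
        rw [card_eq_sum_card_fiberwise hmap]; push_cast; rfl
      calc _ ≤ ∑ l ∈ T, (2 * (#W / r) + (1+t) * #(Uc l) * q) := sum_le_sum hcell
        _ = #T * (2 * (#W/r)) + (1+t) * (∑ l ∈ T, (#(Uc l) : ℝ)) * q := by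
            rw [sum_add_distrib, sum_const, nsmul_eq_mul, mul_sum, sum_mul]
        _ ≤ (L * r^4) * (2 * (#W/r)) + (1+t) * #U * q := by rw [hcard]; gcongr
        _ = 2 * L * r^3 * #W + (1+t) * #U * q := by field_simp
    rw [hsplit]
    have := (Nat.cast_le (α := ℝ)).2 hII2
    push_cast at this hnc' hsum ⊢
    linarith

open Classical in
set_option maxHeartbeats 1000000 in
theorem incidence (U : Finset α) (W : Finset β) (L t : ℝ) (ht : 1 ≤ t) (hL : 1 ≤ L) (hW : W.Nonempty)
    (hP : ∀ U' ⊆ U, HasPart inc U' W L)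
    (h3 : ∀ T ⊆ U, #T = 3 → (#(W.filter (fun w => ∀ u ∈ T, inc u w)) : ℝ) ≤ t)
    (h3' : ∀ T ⊆ W, #T = 3 → (#(U.filter (fun u => ∀ w ∈ T, inc u w)) : ℝ) ≤ t) (k : ℕ) :
    ∀ U' ⊆ U, #U' < 2^k → (II inc U' W : ℝ) ≤
      k * (16 * t * (4*L)^11 * ((#U:ℝ)^((9:ℝ)/11) * (#W:ℝ)^((8:ℝ)/11) + #U + #W)) := by
  induction k with
  | zero =>
    intro U' _ h
    have : U' = ∅ := by rw [← card_eq_zero]; omega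
    simp [this, II]
  | succ k ih =>
    intro U' hU' hk
    set n : ℝ := (#W : ℝ) with hn
    set N : ℝ := (#U : ℝ) with hN
    set x : ℝ := (#U' : ℝ) with hx
    set B : ℝ := 16 * t * (4*L)^11 with hB
    set Q : ℝ := N^((9:ℝ)/11) * n^((8:ℝ)/11) with hQ
    have hn1 : 1 ≤ n := by rw [hn]; exact_mod_cast hW.card_pos
    have hN0 : 0 ≤ N := Nat.cast_nonneg _
    have hQ0 : 0 ≤ Q := by positivity
    have hx0 : 0 ≤ x := Nat.cast_nonneg _
    have hxN : x ≤ N := by rw [hx, hN]; exact_mod_cast card_le_card hU'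
    have hL11 : (1:ℝ) ≤ (4*L)^11 := one_le_pow₀ (by linarith)
    have hL1 : 4 * L ≤ (4*L)^11 := le_self_pow₀ (by linarith) (by norm_num)
    have hB0 : 0 ≤ B := by positivity
    have hBt : 16 * t ≤ B := by rw [hB]; nlinarith
    have hcov : ∀ y : ℝ, y ≤ B * (Q + N + n) → y ≤ ((k+1 : ℕ):ℝ) * (B * (Q + N + n)) := by
      intro y hy
      have : 0 ≤ (k:ℝ) * (B * (Q + N + n)) := by positivity
      push_cast
      linarith
    have h3U : ∀ T ⊆ U', #T = 3 → (#(W.filter (fun w => ∀ u ∈ T, inc u w)) : ℝ) ≤ t :=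
      fun T hT h => h3 T (hT.trans hU') h
    rcases U'.eq_empty_or_nonempty with rfl | hne
    · apply hcov; simp [II]; positivity
    have hx1 : 1 ≤ x := by rw [hx]; exact_mod_cast hne.card_pos
    by_cases hbig : n^4 < x
    · apply hcov
      rw [II_dual]
      have := kst (fun w u => inc u w) W U' t (by
        intro T hT h
        refine le_trans ?_ (h3' T hT h)
        norm_cast
        exact card_le_card (filter_subset_filter _ hU')) 1 one_pos (by linarith)
      have h5 : n^3 ≤ n^4 := pow_le_pow_right₀ hn1 (by norm_num)
      have h6 : t * n^3 ≤ t * x := by gcongr; linarith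
      have h7 : (2+1) * x + t * n^3 / 1^2 ≤ B * N := by
        have : 16 * t * N ≤ B * N := by gcongr
        have : t * x ≤ t * N := by gcongr
        have : 1 * N ≤ t * N := by gcongr
        rw [one_pow, div_one]
        linarith
      have h8 : B * N ≤ B * (Q + N + n) := by gcongr; linarith
      linarith
    push Not at hbig
    by_cases hsmall : x^3 < n * (4*L)^11
    · apply hcov
      have := kst inc U' W t h3U 1 one_pos (by linarith)
      have h6 : t * x^3 ≤ t * (n * (4*L)^11) := by gcongr
      have h7 : (2+1) * n + t * x^3 / 1^2 ≤ B * n := by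
        have : n ≤ n * (4*L)^11 := by nlinarith
        have : t * n ≤ t * (n * (4*L)^11) := by gcongr
        have : 1 * n ≤ t * n := by gcongr
        rw [one_pow, div_one]
        have : B * n = 16 * (t * (n * (4*L)^11)) := by rw [hB]; ring
        have : 0 ≤ t * (n * (4*L)^11) := by positivity
        linarith
      have h8 : B * n ≤ B * (Q + N + n) := by gcongr; linarith
      linarith
    push Not at hsmall
    have hnpos : 0 < n := by linarith
    have hxpos : 0 < x := by linarith
    set a : ℝ := x^((1:ℝ)/11) with ha
    set b : ℝ := n^((1:ℝ)/11) with hb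
    have ha0 : 0 < a := by positivity
    have hb0 : 0 < b := by positivity
    have ha11 : a^11 = x := by
      rw [ha, ← Real.rpow_natCast, ← Real.rpow_mul hx0]; norm_num
    have hb11 : b^11 = n := by
      rw [hb, ← Real.rpow_natCast, ← Real.rpow_mul hnpos.le]; norm_num
    set r : ℝ := a^3 / b / (4*L) with hr
    have hr1 : 1 ≤ r := by
      rw [hr, div_div, le_div_iff₀ (by positivity), one_mul]
      rw [← pow_le_pow_iff_left₀ (by positivity) (by positivity) (show (11:ℕ) ≠ 0 by norm_num)]
      rw [mul_pow, hb11, ← pow_mul, mul_comm 3 11, pow_mul, ha11]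
      exact hsmall
    have hab : a ≤ b^4 := by
      rw [← pow_le_pow_iff_left₀ (by positivity) (by positivity) (show (11:ℕ) ≠ 0 by norm_num)]
      rw [ha11, ← pow_mul, mul_comm 4 11, pow_mul, hb11]
      exact hbig
    obtain ⟨U1, hU1, hc1, hI⟩ := one_step inc U' W L t ht (by linarith) hW (hP U' hU') h3U r hr1
    have hr4 : 2 * (L * r^4) ≤ x / 2 := by
      have e1 : r^4 = a^11 * (a / b^4) / (4*L)^4 := by rw [hr]; field_simp
      have e2 : a / b^4 ≤ 1 := by rw [div_le_one (by positivity)]; exact hab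
      have e3 : a^11 * (a / b^4) ≤ x * 1 := by rw [ha11]; gcongr
      have e4 : L * r^4 * (4 * (4*L)^3) = a^11 * (a/b^4) := by rw [e1]; field_simp
      have e5 : (1:ℝ) ≤ (4*L)^3 := one_le_pow₀ (by linarith)
      have e6 : 0 ≤ L * r^4 := by positivity
      nlinarith [mul_le_mul_of_nonneg_left e5 e6]
    have hU1k : #U1 < 2^k := by
      have h1 : (#U1 : ℝ) ≤ x / 2 := hc1.trans hr4
      have h2 : (2 * #U1 : ℝ) ≤ #U' := by rw [hx] at h1; linarith
      have h3 : 2 * #U1 ≤ #U' := by exact_mod_cast h2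
      rw [pow_succ] at hk
      omega
    have hrec := ih U1 (hU1.trans hU') hU1k
    have hQx : x^((9:ℝ)/11) * n^((8:ℝ)/11) = a^9 * b^8 := by
      rw [ha, hb, ← Real.rpow_natCast, ← Real.rpow_natCast, ← Real.rpow_mul hx0, ← Real.rpow_mul hnpos.le]
      norm_num
    have hQQ : a^9 * b^8 ≤ Q := by
      rw [← hQx, hQ]; gcongr
    have t1 : 2 * L * r^3 * n ≤ Q := by
      have e1 : 2 * L * r^3 * n = a^9 * b^8 * (2 * L / (4*L)^3) := by
        rw [← hb11, hr]; field_simp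
      rw [e1]
      have e2 : 2 * L / (4*L)^3 ≤ 1 := by
        rw [div_le_one (by positivity)]
        have e3 : L ≤ L^3 := le_self_pow₀ hL (by norm_num)
        have e4 : (4*L)^3 = 64 * L^3 := by ring
        linarith
      have : a^9 * b^8 * (2 * L / (4*L)^3) ≤ a^9 * b^8 * 1 := by gcongr
      linarith
    have t2 : (1+t) * x * (n / r)^((2:ℝ)/3) ≤ (2*t) * (4*L) * Q := by
      have e1 : n / r = (b^4 / a)^3 * (4*L) := by
        rw [← hb11, hr]; field_simp
      have e2 : ((b^4 / a)^3)^((2:ℝ)/3) = (b^4/a)^2 := by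
        rw [← Real.rpow_natCast, ← Real.rpow_mul (by positivity), ← Real.rpow_natCast]; norm_num
      have e3 : (n/r)^((2:ℝ)/3) ≤ (b^4/a)^2 * (4*L) := by
        rw [e1, Real.mul_rpow (by positivity) (by positivity), e2]
        gcongr
        have := Real.rpow_le_rpow_of_exponent_le (show 1 ≤ 4*L by linarith) (show (2:ℝ)/3 ≤ 1 by norm_num)
        rwa [Real.rpow_one] at this
      have e4 : x * ((b^4/a)^2 * (4*L)) = (a^9*b^8) * (4*L) := by
        rw [← ha11]; field_simp
      calc (1+t) * x * (n / r)^((2:ℝ)/3) ≤ (2*t) * x * ((b^4/a)^2 * (4*L)) := by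
            gcongr; linarith
        _ = (2*t) * (4*L) * (a^9*b^8) := by rw [mul_assoc, e4]; ring
        _ ≤ _ := by gcongr
    have t3 : (2*t) * (4*L) * Q ≤ (2*t) * (4*L)^11 * Q := by gcongr
    have t4 : Q ≤ t * (4*L)^11 * Q := by
      have : 1 ≤ t * (4*L)^11 := one_le_mul_of_one_le_of_one_le ht hL11
      exact le_mul_of_one_le_left hQ0 this
    have t5 : t * x ≤ B * N := by
      have : t * x ≤ t * N := by gcongr
      have : 16 * t * N ≤ B * N := by gcongr
      have : 0 ≤ t * N := by positivity
      linarith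
    have t6 : B * Q = 16 * (t * (4*L)^11 * Q) := by rw [hB]; ring
    have t7 : 0 ≤ B * n := by positivity
    have t8 : 0 ≤ t * (4*L)^11 * Q := by positivity
    have t9 : ((k+1:ℕ):ℝ) * (B * (Q + N + n)) = k * (B * (Q + N + n)) + B * Q + B * N + B * n := by
      push_cast; ring
    rw [t9]
    linarith

end incidence


theorem lin_le_two_pow (ε : ℝ) (hε : 0 < ε) : ∃ K : ℝ, 1 ≤ K ∧ ∀ a : ℕ, ((a:ℝ) + 1) ≤ K * (2:ℝ)^(ε * a) := by
  have hl : 0 < Real.log 2 := Real.log_pos (by norm_num)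
  refine ⟨1 + 1/(ε * Real.log 2), by simp; positivity, fun a => ?_⟩
  have h1 : ε * a * Real.log 2 + 1 ≤ (2:ℝ)^(ε * a) := by
    rw [Real.rpow_def_of_pos (by norm_num)]
    have := Real.add_one_le_exp (Real.log 2 * (ε * a))
    linarith
  have h2 : (0:ℝ) ≤ a := Nat.cast_nonneg a
  set c := ε * Real.log 2 with hc
  have hc0 : 0 < c := by positivity
  calc (a:ℝ) + 1 ≤ (1 + 1/c) * (c * a + 1) := by
        have : (1 + 1/c) * (c * a + 1) = a + 1 + c * a + 1 / c := by field_simp; ring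
        rw [this]
        have : 0 ≤ c * a := by positivity
        have : 0 ≤ 1 / c := by positivity
        linarith
    _ ≤ _ := by
        have : c * a + 1 ≤ (2:ℝ)^(ε * a) := by rw [hc]; linarith
        gcongr

theorem divisor_bound (ε : ℝ) (hε : 0 < ε) : ∃ C : ℝ, 1 ≤ C ∧ ∀ n : ℕ, 0 < n → (#n.divisors : ℝ) ≤ C * (n:ℝ)^ε := by
  obtain ⟨K, hK1, hK⟩ := lin_le_two_pow ε hε
  obtain ⟨N, hN⟩ := exists_nat_ge ((2:ℝ)^(1/ε))
  refine ⟨K^N, one_le_pow₀ hK1, fun n hn => ?_⟩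
  rw [Nat.card_divisors hn.ne']
  have hfac : (n:ℝ)^ε = ∏ p ∈ n.primeFactors, (p:ℝ)^(ε * (n.factorization p)) := by
    have h0 : (n:ℝ) = ∏ p ∈ n.primeFactors, (p:ℝ)^(n.factorization p) := by
      have h1 : n = ∏ p ∈ n.primeFactors, p^(n.factorization p) := (Nat.prod_factorization_pow_eq_self hn.ne').symm
      exact_mod_cast congrArg (Nat.cast (R := ℝ)) h1
    conv_lhs => rw [h0]
    rw [← Real.finsetProd_rpow _ _ (fun p _ => by positivity)]
    apply prod_congr rfl
    intro p _
    rw [mul_comm, Real.rpow_mul (by positivity), Real.rpow_natCast]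
  have hterm : ∀ p ∈ n.primeFactors, ((n.factorization p : ℝ) + 1) ≤ (if p < N then K else 1) * (p:ℝ)^(ε * (n.factorization p)) := by
    intro p hp
    have hp2 : 2 ≤ p := (Nat.prime_of_mem_primeFactors hp).two_le
    have hp2' : (2:ℝ) ≤ p := by exact_mod_cast hp2
    set a := n.factorization p
    split_ifs with h
    · refine (hK a).trans ?_
      gcongr
    · push Not at h
      rw [one_mul]
      have h1 : (2:ℝ)^(1/ε) ≤ p := hN.trans (by exact_mod_cast h)
      have h2 : (2:ℝ) ≤ (p:ℝ)^ε := by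
        have := Real.rpow_le_rpow (by positivity) h1 hε.le
        rwa [← Real.rpow_mul (by norm_num), one_div, inv_mul_cancel₀ hε.ne', Real.rpow_one] at this
      rw [Real.rpow_mul (by positivity), Real.rpow_natCast]
      have h3 : (a:ℝ) + 1 ≤ 2^a := by exact_mod_cast (Nat.lt_two_pow_self (n := a))
      exact h3.trans (pow_le_pow_left₀ (by norm_num) h2 a)
  push_cast
  calc ∏ p ∈ n.primeFactors, ((n.factorization p : ℝ) + 1)
      ≤ ∏ p ∈ n.primeFactors, ((if p < N then K else 1) * (p:ℝ)^(ε * (n.factorization p))) :=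
        prod_le_prod (fun p _ => by positivity) hterm
    _ = (∏ p ∈ n.primeFactors, (if p < N then K else 1)) * (n:ℝ)^ε := by rw [prod_mul_distrib, hfac]
    _ ≤ K^N * (n:ℝ)^ε := by
        gcongr
        rw [← prod_filter, prod_const]
        apply pow_le_pow_right₀ hK1
        calc #(n.primeFactors.filter (fun p => p < N)) ≤ #(range N) := card_le_card (fun p hp => mem_range.2 (mem_filter.1 hp).2)
          _ = N := card_range N

section ideals
set_option linter.unusedSectionVars false
variable {R : Type*} [CommRing R] [IsDedekindDomain R]

/-- at most `n` divisors -/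
def DB (I : Ideal R) (n : ℕ) : Prop := ∃ F : Finset (Ideal R), (∀ J, J ∣ I → J ∈ F) ∧ #F ≤ n

theorem DB_mul {I J : Ideal R} {a b : ℕ} (h1 : DB I a) (h2 : DB J b) : DB (I * J) (a * b) := by
  classical
  obtain ⟨F, hF, hFc⟩ := h1
  obtain ⟨G, hG, hGc⟩ := h2
  refine ⟨image₂ (· * ·) F G, ?_, (card_image₂_le _ _ _).trans (Nat.mul_le_mul hFc hGc)⟩
  intro D hD
  obtain ⟨d1, d2, h1, h2, rfl⟩ := exists_dvd_and_dvd_of_dvd_mul hD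
  exact mem_image₂_of_mem (hF _ h1) (hG _ h2)

theorem DB_prime_pow {q : Ideal R} (hq : Prime q) (k : ℕ) : DB (q^k) (k+1) := by
  classical
  refine ⟨(range (k+1)).image (fun i => q^i), ?_, by simpa using card_image_le (s := range (k+1)) (f := fun i => q^i)⟩
  intro J hJ
  obtain ⟨i, hi, h⟩ := (dvd_prime_pow hq k).1 hJ
  rw [associated_iff_eq] at h
  exact mem_image.2 ⟨i, mem_range.2 (by omega), h.symm⟩

theorem DB_mono {I : Ideal R} {a b : ℕ} (h1 : DB I a) (h : a ≤ b) : DB I b := by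
  obtain ⟨F, hF, hFc⟩ := h1
  exact ⟨F, hF, hFc.trans h⟩

theorem DB_p_pow [Module.Free ℤ R] [Module.Finite ℤ R] [CharZero R] (hr : Module.finrank ℤ R ≤ 2) (p : ℕ) (hp : p.Prime) (k : ℕ) :
    DB (Ideal.span {((p:ℤ) : R)}^k) ((k+1)^2) := by
  have hnorm : Ideal.absNorm (Ideal.span {((p:ℤ) : R)}) = p^(Module.finrank ℤ R) := by
    rw [Ideal.absNorm_span_singleton]
    have := Algebra.norm_algebraMap (S := R) (p:ℤ)
    simp only [algebraMap_int_eq, eq_intCast] at this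
    rw [this, Int.natAbs_pow]; simp
  have hne : Ideal.span {((p:ℤ) : R)} ≠ 0 := by
    intro h
    simp only [Ideal.zero_eq_bot, Ideal.span_singleton_eq_bot] at h
    have : (p:ℤ) = 0 := by exact_mod_cast h
    have := hp.pos
    omega
  by_cases hpr : Prime (Ideal.span {((p:ℤ) : R)})
  · exact DB_mono (DB_prime_pow hpr k) (by nlinarith)
  by_cases hu : IsUnit (Ideal.span {((p:ℤ) : R)})
  · rw [Ideal.isUnit_iff.1 hu, ← Ideal.one_eq_top, one_pow]
    refine DB_mono (b := (k+1)^2) (a := 1) ⟨{1}, ?_, by simp⟩ (Nat.one_le_pow _ _ (by omega))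
    intro J hJ
    simpa using isUnit_iff_dvd_one.2 hJ
  have hirr : ¬ Irreducible (Ideal.span {((p:ℤ) : R)}) := fun h => hpr h.prime
  rw [irreducible_iff] at hirr
  push Not at hirr
  obtain ⟨I, J, hIJ, hI, hJ⟩ := hirr hu
  rw [hIJ] at hnorm ⊢
  rw [map_mul] at hnorm
  have hle : p^(Module.finrank ℤ R) ∣ p^2 := pow_dvd_pow p hr
  have key : ∀ I J : Ideal R, ¬ IsUnit I → ¬ IsUnit J → Ideal.absNorm I * Ideal.absNorm J = p^(Module.finrank ℤ R) → Prime I := by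
    intro I J hI hJ h
    obtain ⟨i, hi, hi'⟩ := (Nat.dvd_prime_pow hp).1 (Dvd.intro _ h)
    obtain ⟨j, hj, hj'⟩ := (Nat.dvd_prime_pow hp).1 (Dvd.intro_left _ h)
    have i0 : i ≠ 0 := by
      rintro rfl
      rw [pow_zero, Ideal.absNorm_eq_one_iff] at hi'
      exact hI (Ideal.isUnit_iff.2 hi')
    have j0 : j ≠ 0 := by
      rintro rfl
      rw [pow_zero, Ideal.absNorm_eq_one_iff] at hj'
      exact hJ (Ideal.isUnit_iff.2 hj')
    rw [hi', hj', ← pow_add] at h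
    have := Nat.pow_right_injective hp.two_le h
    have i1 : i = 1 := by omega
    rw [i1, pow_one] at hi'
    have hpI := Ideal.isPrime_of_irreducible_absNorm (I := I) (by rw [hi']; exact hp)
    apply Ideal.prime_of_isPrime _ hpI
    rintro rfl
    simp at hi'
    exact hp.pos.ne hi'
  have hIp := key I J hI hJ hnorm
  have hJp := key J I hJ hI (by rw [mul_comm]; exact hnorm)
  rw [mul_pow, sq]
  exact DB_mul (DB_prime_pow hIp k) (DB_prime_pow hJp k)

theorem DB_nat [Module.Free ℤ R] [Module.Finite ℤ R] [CharZero R] (hr : Module.finrank ℤ R ≤ 2) (n : ℕ) :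
    0 < n → DB (Ideal.span {((n:ℤ) : R)}) ((#n.divisors)^2) := by
  induction n using Nat.recOnPosPrimePosCoprime with
  | prime_pow p k hp hk =>
    intro _
    have := DB_p_pow (R := R) hr p hp k
    rw [Nat.divisors_prime_pow hp, card_map, card_range]
    rw [Ideal.span_singleton_pow] at this
    push_cast at this ⊢
    exact this
  | zero => intro h; omega
  | one =>
    intro _
    refine ⟨{1}, ?_, by simp⟩
    intro J hJ
    simp only [Nat.cast_one, Int.cast_one, Ideal.span_singleton_one, ← Ideal.one_eq_top] at hJ
    simpa using isUnit_iff_dvd_one.2 hJ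
  | coprime a b ha hb hab iha ihb =>
    intro _
    have h := DB_mul (iha (by omega)) (ihb (by omega))
    rw [Ideal.span_singleton_mul_span_singleton, ← mul_pow] at h
    rw [hab.card_divisors_mul]
    push_cast at h ⊢
    exact h

end ideals


/-- square root of `-D` -/
def th (D : ℕ) : ℂ := (Real.sqrt D : ℂ) * Complex.I

theorem th_sq (D : ℕ) : th D * th D = -(D:ℂ) := by
  unfold th
  have h : ((Real.sqrt D : ℝ) : ℂ) * (Real.sqrt D : ℝ) = (D:ℂ) := by
    rw [← Complex.ofReal_mul, Real.mul_self_sqrt (Nat.cast_nonneg D)]; simp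
  calc _ = (((Real.sqrt D : ℝ) : ℂ) * (Real.sqrt D : ℝ)) * (Complex.I * Complex.I) := by ring
    _ = _ := by rw [h, Complex.I_mul_I]; ring

theorem th_conj (D : ℕ) : (starRingEnd ℂ) (th D) = - th D := by
  simp [th]

theorem th_int (D : ℕ) : IsIntegral ℤ (th D) := by
  refine ⟨Polynomial.X^2 + Polynomial.C (D:ℤ), Polynomial.monic_X_pow_add_C _ (by norm_num), ?_⟩
  simp [sq, th_sq]

theorem th_int' (D : ℕ) : IsIntegral ℚ (th D) := (th_int D).tower_top

/-- the imaginary quadratic field -/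
abbrev KQ (D : ℕ) := IntermediateField.adjoin ℚ {th D}

instance (D : ℕ) : FiniteDimensional ℚ (KQ D) :=
  IntermediateField.adjoin.finiteDimensional (th_int' D)

instance (D : ℕ) : NumberField (KQ D) where

theorem KQ_rank (D : ℕ) : Module.finrank ℤ (NumberField.RingOfIntegers (KQ D)) ≤ 2 := by
  rw [NumberField.RingOfIntegers.rank, IntermediateField.adjoin.finrank (th_int' D)]
  have h : (Polynomial.X^2 + Polynomial.C (D:ℚ)) ≠ 0 := (Polynomial.monic_X_pow_add_C _ (by norm_num)).ne_zero
  have h2 : Polynomial.aeval (th D) (Polynomial.X^2 + Polynomial.C (D:ℚ)) = 0 := by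
    simp [sq, th_sq]
  have h1 := Polynomial.natDegree_le_of_dvd (minpoly.dvd ℚ (th D) h2) h
  rwa [Polynomial.natDegree_X_pow_add_C] at h1

/-- embedding in the complex numbers -/
def ph (D : ℕ) : NumberField.RingOfIntegers (KQ D) →+* ℂ :=
  (algebraMap (KQ D) ℂ).comp (algebraMap (NumberField.RingOfIntegers (KQ D)) (KQ D))

theorem ph_inj (D : ℕ) : Function.Injective (ph D) := by
  unfold ph
  rw [RingHom.coe_comp]
  exact (algebraMap (KQ D) ℂ).injective.comp (NumberField.RingOfIntegers.coe_injective)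

theorem ph_int (D : ℕ) (x) : IsIntegral ℤ (ph D x) := by
  have h1 : IsIntegral ℤ (algebraMap (NumberField.RingOfIntegers (KQ D)) (KQ D) x) := NumberField.RingOfIntegers.isIntegral_coe x
  exact h1.map (IsScalarTower.toAlgHom ℤ (KQ D) ℂ)

theorem ex_th (D : ℕ) : ∃ t, ph D t = th D := by
  set y : KQ D := ⟨th D, IntermediateField.mem_adjoin_simple_self ℚ (th D)⟩
  have hy : IsIntegral ℤ y := by
    have := th_int D
    rw [show th D = algebraMap (KQ D) ℂ y from rfl] at this
    exact (isIntegral_algebraMap_iff (algebraMap (KQ D) ℂ).injective).1 this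
  exact ⟨⟨y, hy⟩, rfl⟩

theorem same_ideal (D M : ℕ) (hM : 0 < M) (t) (ht : ph D t = th D) (P T P' T' : ℤ)
    (h1 : P^2 + D * T^2 = M) (h2 : P'^2 + D * T'^2 = M)
    (hs : Ideal.span {((P : NumberField.RingOfIntegers (KQ D)) + T * t)} = Ideal.span {((P' : NumberField.RingOfIntegers (KQ D)) + T' * t)}) :
    ∃ j : ℤ, j ∈ Icc (-2:ℤ) 2 ∧ 2 * (P * P' + D * T * T') = M * j := by
  rw [Ideal.span_singleton_eq_span_singleton] at hs
  obtain ⟨ε, hε⟩ := hs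
  set e := ph D ε with he
  have he1 : ((P:ℂ) + T * th D) * e = P' + T' * th D := by
    have := congrArg (ph D) hε
    simp only [map_mul, map_add, map_intCast, ht] at this
    exact this
  have hMc : (P:ℂ)^2 + D * T^2 = M := by exact_mod_cast congrArg (Int.cast (R := ℂ)) h1
  have he2 : (M:ℂ) * e = (P * P' + D * T * T') + (P * T' - T * P') * th D := by
    have h := congrArg (fun z => ((P:ℂ) - T * th D) * z) he1
    have h3 := th_sq D
    linear_combination h - e * hMc + (e * T^2 - T * T') * h3
  have hM0 : (M:ℂ) ≠ 0 := by exact_mod_cast hM.ne'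
  have he3 : (M:ℂ) * (starRingEnd ℂ e) = (P * P' + D * T * T') - (P * T' - T * P') * th D := by
    have := congrArg (starRingEnd ℂ) he2
    simp only [map_mul, map_add, map_sub, th_conj, map_natCast, map_intCast] at this
    linear_combination this
  have hintg : IsIntegral ℤ (e + starRingEnd ℂ e) := by
    have h3 := ph_int D ε
    refine IsIntegral.add h3 ?_
    exact h3.map (starRingEnd ℂ).toIntAlgHom
  have hval : e + starRingEnd ℂ e = algebraMap ℚ ℂ ((2 * (P * P' + D * T * T') : ℤ) / (M:ℚ)) := by
    have : (M:ℂ) * (e + starRingEnd ℂ e) = 2 * (P * P' + D * T * T') := by rw [mul_add, he2, he3]; ring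
    rw [eq_ratCast]
    push_cast
    rw [eq_div_iff hM0, mul_comm]
    exact this
  rw [hval, isIntegral_algebraMap_iff (algebraMap ℚ ℂ).injective] at hintg
  obtain ⟨j, hj⟩ := IsIntegrallyClosed.isIntegral_iff.1 hintg
  have hMq : (M:ℚ) ≠ 0 := by exact_mod_cast hM.ne'
  rw [eq_intCast, eq_div_iff hMq] at hj
  have hj' : 2 * (P * P' + D * T * T') = M * j := by
    have : j * (M:ℤ) = 2 * (P * P' + D * T * T') := by exact_mod_cast hj
    linarith
  refine ⟨j, ?_, hj'⟩
  have hsq : (P * P' + D * T * T')^2 + D * (P * T' - T * P')^2 = (M:ℤ)^2 := by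
    calc _ = (P^2 + D * T^2) * (P'^2 + D * T'^2) := by ring
      _ = _ := by rw [h1, h2]; ring
  have hle : (P * P' + D * T * T')^2 ≤ (M:ℤ)^2 := by
    have : 0 ≤ (D:ℤ) * (P * T' - T * P')^2 := by positivity
    linarith
  have hj4 : (M:ℤ)^2 * j^2 ≤ (M:ℤ)^2 * 4 := by
    have : ((M:ℤ) * j)^2 = 4 * (P * P' + D * T * T')^2 := by rw [← hj']; ring
    nlinarith
  have hj5 : j^2 ≤ 4 := le_of_mul_le_mul_left hj4 (by positivity)
  rw [mem_Icc]
  constructor <;> nlinarith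

theorem norm_count (ε : ℝ) (hε : 0 < ε) : ∃ C : ℝ, 1 ≤ C ∧ ∀ D M : ℕ, 0 < D → 0 < M → ∀ F : Finset (ℤ × ℤ),
    (∀ x ∈ F, x.1^2 + D * x.2^2 = M) → (#F : ℝ) ≤ C * (M:ℝ)^ε := by
  classical
  obtain ⟨C, hC1, hC⟩ := divisor_bound (ε/2) (by linarith)
  refine ⟨10 * C^2, by nlinarith, fun D M hD hM F hF => ?_⟩
  obtain ⟨t, ht⟩ := ex_th D
  obtain ⟨G, hG, hGc⟩ := DB_nat (R := NumberField.RingOfIntegers (KQ D)) (KQ_rank D) M hM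
  set f : ℤ × ℤ → Ideal (NumberField.RingOfIntegers (KQ D)) := fun x => Ideal.span {((x.1 : NumberField.RingOfIntegers (KQ D)) + x.2 * t)} with hf
  have hmap : ∀ x ∈ F, f x ∈ G := by
    intro x hx
    apply hG
    rw [Ideal.dvd_iff_le, Ideal.span_singleton_le_span_singleton]
    refine ⟨(x.1 : NumberField.RingOfIntegers (KQ D)) - x.2 * t, ph_inj D ?_⟩
    simp only [map_mul, map_add, map_sub, map_intCast, ht]
    have hMc : (x.1:ℂ)^2 + D * x.2^2 = M := by exact_mod_cast congrArg (Int.cast (R := ℂ)) (hF x hx)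
    have := th_sq D
    push_cast
    linear_combination -hMc + x.2^2 * this
  have hcard : #F ≤ 10 * #G := by
    apply card_le_mul_card_image_of_maps_to hmap
    intro I _
    rcases (F.filter (fun x => f x = I)).eq_empty_or_nonempty with he | ⟨⟨P, T⟩, hx⟩
    · rw [he]; simp
    · rw [mem_filter] at hx
      have hPT := hF _ hx.1
      simp only at hPT
      set key : ℤ × ℤ → ℤ × Bool := fun y => (2 * (P * y.1 + D * T * y.2) / M, decide (0 ≤ P * y.2 - T * y.1)) with hkey
      have hM0 : (M:ℤ) ≠ 0 := by exact_mod_cast hM.ne'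
      have hsame : ∀ y ∈ F.filter (fun x => f x = I), ∃ j : ℤ, j ∈ Icc (-2:ℤ) 2 ∧ 2 * (P * y.1 + D * T * y.2) = M * j := by
        intro y hy
        rw [mem_filter] at hy
        exact same_ideal D M hM t ht P T y.1 y.2 hPT (hF y hy.1) (hx.2.trans hy.2.symm)
      calc #(F.filter (fun x => f x = I)) ≤ #(Icc (-2:ℤ) 2 ×ˢ (univ : Finset Bool)) := by
            apply card_le_card_of_injOn key
            · intro y hy
              obtain ⟨j, hj, hj2⟩ := hsame y hy
              rw [hkey]
              simp only [coe_product, Set.mem_prod, hj2, Int.mul_ediv_cancel_left _ hM0]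
              exact ⟨hj, mem_coe.2 (mem_univ _)⟩
            · intro y hy y' hy' hyy
              obtain ⟨j, hj, hj2⟩ := hsame y hy
              obtain ⟨j', hj', hj2'⟩ := hsame y' hy'
              have hy1 := hF y (mem_filter.1 hy).1
              have hy1' := hF y' (mem_filter.1 hy').1
              rw [hkey] at hyy
              simp only [Prod.mk.injEq, hj2, hj2', Int.mul_ediv_cancel_left _ hM0, decide_eq_decide] at hyy
              obtain ⟨rfl, hsg⟩ := hyy
              have hz : P * y.1 + D * T * y.2 = P * y'.1 + D * T * y'.2 := by linarith
              have hs1 : (P * y.1 + D * T * y.2)^2 + D * (P * y.2 - T * y.1)^2 = (M:ℤ)^2 := by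
                calc _ = (P^2 + D * T^2) * (y.1^2 + D * y.2^2) := by ring
                  _ = _ := by rw [hPT, hy1]; ring
              have hs2 : (P * y'.1 + D * T * y'.2)^2 + D * (P * y'.2 - T * y'.1)^2 = (M:ℤ)^2 := by
                calc _ = (P^2 + D * T^2) * (y'.1^2 + D * y'.2^2) := by ring
                  _ = _ := by rw [hPT, hy1']; ring
              have hD0 : (D:ℤ) ≠ 0 := by exact_mod_cast hD.ne'
              have hxx : (P * y.2 - T * y.1)^2 = (P * y'.2 - T * y'.1)^2 := by
                apply mul_left_cancel₀ hD0
                rw [hz] at hs1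
                linarith
              have hx0 : P * y.2 - T * y.1 = P * y'.2 - T * y'.1 := by
                rcases sq_eq_sq_iff_eq_or_eq_neg.1 hxx with h | h
                · exact h
                · by_cases h0 : 0 ≤ P * y.2 - T * y.1
                  · have := hsg.1 h0
                    linarith
                  · have : ¬ 0 ≤ P * y'.2 - T * y'.1 := fun h' => h0 (hsg.2 h')
                    push Not at this h0
                    linarith
              have a1 : y.1 = y'.1 := by
                apply mul_left_cancel₀ hM0
                rw [← hPT]
                linear_combination P * hz - D * T * hx0
              have a2 : y.2 = y'.2 := by
                apply mul_left_cancel₀ hM0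
                rw [← hPT]
                linear_combination T * hz + P * hx0
              exact Prod.ext a1 a2
        _ = 10 := by rw [card_product]; simp
  have h1 : (#F : ℝ) ≤ 10 * (#M.divisors : ℝ)^2 := by
    have : #F ≤ 10 * (#M.divisors)^2 := hcard.trans (Nat.mul_le_mul_left _ hGc)
    exact_mod_cast this
  have h2 := hC M hM
  calc (#F : ℝ) ≤ 10 * (#M.divisors : ℝ)^2 := h1
    _ ≤ 10 * (C * (M:ℝ)^(ε/2))^2 := by gcongr
    _ = 10 * C^2 * (M:ℝ)^ε := by
        rw [mul_pow, ← Real.rpow_natCast ((M:ℝ)^(ε/2)), ← Real.rpow_mul (Nat.cast_nonneg _)]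
        norm_num; ring_nf


/-! ### Points equidistant from three points -/

open Matrix in
theorem gram_ne (e g c : Fin 4 → ℤ) (he0 : e ≠ 0) (hg0 : g ≠ 0) (heg : e ≠ g)
    (he : e ⬝ᵥ e = -2 * (e ⬝ᵥ c)) (hg : g ⬝ᵥ g = -2 * (g ⬝ᵥ c)) :
    0 < (g ⬝ᵥ g) * (e ⬝ᵥ e) - (e ⬝ᵥ g)^2 := by
  set A := g ⬝ᵥ g with hA
  set B := e ⬝ᵥ g with hB
  set C := e ⬝ᵥ e with hC
  have hA0 : A ≠ 0 := fun h => hg0 (dotProduct_self_eq_zero.1 h)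
  have hC0 : C ≠ 0 := fun h => he0 (dotProduct_self_eq_zero.1 h)
  have nn : ∀ v : Fin 4 → ℤ, 0 ≤ v ⬝ᵥ v := fun v => Finset.sum_nonneg (fun i _ => mul_self_nonneg _)
  have hApos : 0 < A := lt_of_le_of_ne (nn g) (Ne.symm hA0)
  have hid : (A • e - B • g) ⬝ᵥ (A • e - B • g) = A * (A * C - B^2) := by
    simp only [sub_dotProduct, dotProduct_sub, smul_dotProduct, dotProduct_smul, smul_eq_mul,
      dotProduct_comm g e, ← hA, ← hB, ← hC]
    ring
  have hge : 0 ≤ A * C - B^2 := by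
    have := nn (A • e - B • g)
    rw [hid] at this
    exact nonneg_of_mul_nonneg_right this hApos
  refine lt_of_le_of_ne hge (fun h0 => ?_)
  rw [← h0, mul_zero] at hid
  have hv := dotProduct_self_eq_zero.1 hid
  have hvc : (A • e - B • g) ⬝ᵥ c = 0 := by rw [hv]; simp
  simp only [sub_dotProduct, smul_dotProduct, smul_eq_mul] at hvc
  have h1 : A * (C - B) = 0 := by linear_combination A * he - B * hg - 2 * hvc
  have h2 : C = B := by
    rcases mul_eq_zero.1 h1 with h | h
    · exact absurd h hA0
    · linarith
  have h3 : C * (A - C) = 0 := by rw [← h2] at h0; linear_combination -h0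
  have h4 : A = C := by
    rcases mul_eq_zero.1 h3 with h | h
    · exact absurd h hC0
    · linarith
  have h5 : (e - g) ⬝ᵥ (e - g) = 0 := by
    simp only [sub_dotProduct, dotProduct_sub, dotProduct_comm g e, ← hA, ← hB, ← hC]
    linarith
  exact heg (sub_eq_zero.1 (dotProduct_self_eq_zero.1 h5))

open Matrix in
theorem indep_four (e g p q v : Fin 4 → ℤ)
    (h1 : 0 < (g ⬝ᵥ g) * (e ⬝ᵥ e) - (e ⬝ᵥ g)^2)
    (h2 : 0 < (q ⬝ᵥ q) * (p ⬝ᵥ p) - (p ⬝ᵥ q)^2)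
    (ep : e ⬝ᵥ p = 0) (eq : e ⬝ᵥ q = 0) (gp : g ⬝ᵥ p = 0) (gq : g ⬝ᵥ q = 0)
    (ve : v ⬝ᵥ e = 0) (vg : v ⬝ᵥ g = 0) (vp : v ⬝ᵥ p = 0) (vq : v ⬝ᵥ q = 0) : v = 0 := by
  have key : ∀ e g : Fin 4 → ℤ, 0 < (g ⬝ᵥ g) * (e ⬝ᵥ e) - (e ⬝ᵥ g)^2 → ∀ a b : ℤ,
      a * (e ⬝ᵥ e) + b * (e ⬝ᵥ g) = 0 → a * (e ⬝ᵥ g) + b * (g ⬝ᵥ g) = 0 → a = 0 ∧ b = 0 := by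
    intro e g h a b ha hb
    constructor
    · have : a * ((g ⬝ᵥ g) * (e ⬝ᵥ e) - (e ⬝ᵥ g)^2) = 0 := by
        linear_combination (g ⬝ᵥ g) * ha - (e ⬝ᵥ g) * hb
      exact (mul_eq_zero.1 this).resolve_right h.ne'
    · have : b * ((g ⬝ᵥ g) * (e ⬝ᵥ e) - (e ⬝ᵥ g)^2) = 0 := by
        linear_combination (e ⬝ᵥ e) * hb - (e ⬝ᵥ g) * ha
      exact (mul_eq_zero.1 this).resolve_right h.ne'
  have hdet : (Matrix.of ![e, g, p, q]).det ≠ 0 := by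
    intro hd
    obtain ⟨a, ha0, ha⟩ := Matrix.exists_vecMul_eq_zero_iff.2 hd
    apply ha0
    have hs : a 0 • e + a 1 • g + a 2 • p + a 3 • q = 0 := by
      ext i
      have := congrFun ha i
      simp only [vecMul, dotProduct, Fin.sum_univ_four] at this
      simpa using this
    have d : ∀ z, a 0 * (e ⬝ᵥ z) + a 1 * (g ⬝ᵥ z) + a 2 * (p ⬝ᵥ z) + a 3 * (q ⬝ᵥ z) = 0 := by
      intro z
      have := congrArg (fun y => y ⬝ᵥ z) hs
      simpa only [add_dotProduct, smul_dotProduct, smul_eq_mul, zero_dotProduct] using this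
    have de := d e
    have dg := d g
    have dp := d p
    have dq := d q
    rw [dotProduct_comm p e, dotProduct_comm q e, dotProduct_comm g e, ep, eq] at de
    rw [dotProduct_comm p g, dotProduct_comm q g, gp, gq] at dg
    rw [dotProduct_comm q p, ep, gp] at dp
    rw [eq, gq] at dq
    obtain ⟨a0, a1⟩ := key e g h1 (a 0) (a 1) (by linarith) (by linarith)
    obtain ⟨a2, a3⟩ := key p q h2 (a 2) (a 3) (by linarith) (by linarith)
    ext i
    fin_cases i <;> simpa
  refine Matrix.eq_zero_of_mulVec_eq_zero hdet ?_
  ext i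
  fin_cases i
  · simpa [mulVec, dotProduct_comm] using ve
  · simpa [mulVec, dotProduct_comm] using vg
  · simpa [mulVec, dotProduct_comm] using vp
  · simpa [mulVec, dotProduct_comm] using vq

open Matrix in
theorem Inc_iff (m : ℕ) (u w : Fin 4 → ℤ) : Inc m u w ↔ (w - u) ⬝ᵥ (w - u) = (m:ℤ) := by
  simp only [Inc, dotProduct, Pi.sub_apply, sq]

theorem Inc_symm (m : ℕ) (u w : Fin 4 → ℤ) : Inc m u w ↔ Inc m w u := by
  simp only [Inc]
  have : ∀ i, (w i - u i)^2 = (u i - w i)^2 := fun i => by ring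
  simp [this]

open Matrix in
theorem inc_perp (m : ℕ) (u0 u w1 w2 : Fin 4 → ℤ) (h01 : Inc m u0 w1) (h02 : Inc m u0 w2)
    (h1 : Inc m u w1) (h2 : Inc m u w2) : (u - u0) ⬝ᵥ (w2 - w1) = 0 := by
  rw [Inc_iff] at *
  simp only [dotProduct, Fin.sum_univ_four, Pi.sub_apply] at *
  have : 2 * ((u 0 - u0 0) * (w2 0 - w1 0) + (u 1 - u0 1) * (w2 1 - w1 1) + (u 2 - u0 2) * (w2 2 - w1 2) + (u 3 - u0 3) * (w2 3 - w1 3)) = 0 := by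
    linear_combination h1 - h2 + h02 - h01
  linarith

open Matrix in
theorem inc_chord (m : ℕ) (u0 u w : Fin 4 → ℤ) (h0 : Inc m u0 w) (h : Inc m u w) :
    (u - u0) ⬝ᵥ (u - u0) = -2 * ((u - u0) ⬝ᵥ (u0 - w)) := by
  rw [Inc_iff] at *
  simp only [dotProduct, Fin.sum_univ_four, Pi.sub_apply] at *
  linear_combination h - h0

open Matrix in
theorem inc_chord_le (m : ℕ) (u0 u w : Fin 4 → ℤ) (h0 : Inc m u0 w) (h : Inc m u w) :
    (u - u0) ⬝ᵥ (u - u0) ≤ 4 * m := by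
  rw [Inc_iff] at *
  simp only [dotProduct, Fin.sum_univ_four, Pi.sub_apply] at *
  have k : ∀ a b c : ℤ, (a - b) * (a - b) ≤ 2 * ((c - a) * (c - a)) + 2 * ((c - b) * (c - b)) := by
    intro a b c
    nlinarith [sq_nonneg ((c - a) + (c - b))]
  have := k (u 0) (u0 0) (w 0)
  have := k (u 1) (u0 1) (w 1)
  have := k (u 2) (u0 2) (w 2)
  have := k (u 3) (u0 3) (w 3)
  linarith

theorem M_bound (A B C m : ℤ) (hm : 0 ≤ m) (hA0 : 0 ≤ A) (hC0 : 0 ≤ C) (hA : A ≤ 4 * m) (hC : C ≤ 4 * m)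
    (hΔ : 0 < A * C - B^2) :
    (A * C - B^2) * (A * (C - B))^2 + (A * B * (C - B) + A * C * (A - B))^2 ≤ 81920 * m^6 := by
  have hAC : A * C ≤ 16 * m^2 := by nlinarith
  have hB : |B| ≤ 4 * m := abs_le_of_sq_le_sq (by nlinarith) (by linarith)
  have aA : |A| ≤ 4 * m := by rwa [abs_of_nonneg hA0]
  have aC : |C| ≤ 4 * m := by rwa [abs_of_nonneg hC0]
  have aCB : |C - B| ≤ 8 * m := (abs_sub _ _).trans (by linarith)
  have aAB : |A - B| ≤ 8 * m := (abs_sub _ _).trans (by linarith)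
  have b1 : |A * (C - B)| ≤ (4 * m) * (8 * m) := by
    rw [abs_mul]; exact mul_le_mul aA aCB (abs_nonneg _) (by linarith)
  have b2 : |A * B * (C - B) + A * C * (A - B)| ≤ 256 * m^3 := by
    have x1 : |A * B * (C - B)| ≤ (4*m) * (4*m) * (8*m) := by
      rw [abs_mul, abs_mul]; gcongr
    have x2 : |A * C * (A - B)| ≤ (4*m) * (4*m) * (8*m) := by
      rw [abs_mul, abs_mul]; gcongr
    refine (abs_add_le _ _).trans ?_
    linarith
  have c1 : (A * (C - B))^2 ≤ (32 * m^2)^2 := sq_le_sq' (by nlinarith [(abs_le.1 b1).1]) (by nlinarith [(abs_le.1 b1).2])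
  have c2 : (A * B * (C - B) + A * C * (A - B))^2 ≤ (256 * m^3)^2 := sq_le_sq' (by linarith [(abs_le.1 b2).1]) (by linarith [(abs_le.1 b2).2])
  have d : (A * C - B^2) * (A * (C - B))^2 ≤ (16 * m^2) * (32 * m^2)^2 := by
    apply mul_le_mul (by nlinarith [sq_nonneg B]) c1 (sq_nonneg _) (by positivity)
  nlinarith

set_option maxHeartbeats 2000000 in
open Matrix in
theorem three_count (ε : ℝ) (hε : 0 < ε) : ∃ K : ℝ, 1 ≤ K ∧ ∀ m : ℕ, 0 < m → ∀ w1 w2 w3 : Fin 4 → ℤ,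
    w1 ≠ w2 → w1 ≠ w3 → w2 ≠ w3 → ∀ F : Finset (Fin 4 → ℤ),
    (∀ u ∈ F, Inc m u w1 ∧ Inc m u w2 ∧ Inc m u w3) → (#F : ℝ) ≤ K * (m:ℝ)^ε := by
  obtain ⟨K, hK1, hK⟩ := norm_count (ε/6) (by positivity)
  refine ⟨K * (81920:ℝ)^(ε/6) + 2, by
    have : 0 ≤ K * (81920:ℝ)^(ε/6) := by positivity
    linarith, ?_⟩
  intro m hm w1 w2 w3 h12 h13 h23 F hF
  have hm1 : (1:ℝ) ≤ (m:ℝ)^ε := Real.one_le_rpow (by exact_mod_cast hm) hε.le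
  have hK0 : 0 ≤ K * (81920:ℝ)^(ε/6) := by positivity
  by_cases h3 : #F ≤ 2
  · calc (#F:ℝ) ≤ 2 := by exact_mod_cast h3
      _ ≤ (K * (81920:ℝ)^(ε/6) + 2) * 1 := by linarith
      _ ≤ _ := by gcongr
  push Not at h3
  obtain ⟨u0, u1, u2, m0, m1, m2, h01, h02, h12'⟩ := Finset.two_lt_card_iff.1 h3
  obtain ⟨i01, i02, i03⟩ := hF u0 m0
  obtain ⟨i11, i12, i13⟩ := hF u1 m1
  obtain ⟨i21, i22, i23⟩ := hF u2 m2
  set e := u1 - u0 with he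
  set g := u2 - u0 with hg
  set p := w2 - w1 with hp
  set q := w3 - w1 with hq
  set c := u0 - w1 with hc
  have hc1 : e ⬝ᵥ e = -2 * (e ⬝ᵥ c) := inc_chord m u0 u1 w1 i01 i11
  have hc2 : g ⬝ᵥ g = -2 * (g ⬝ᵥ c) := inc_chord m u0 u2 w1 i01 i21
  have hΔ := gram_ne e g c (sub_ne_zero.2 (Ne.symm h01)) (sub_ne_zero.2 (Ne.symm h02))
    (fun h => h12' (sub_left_injective h)) hc1 hc2
  have hΔ2 := gram_ne p q (w1 - u0) (sub_ne_zero.2 (Ne.symm h12)) (sub_ne_zero.2 (Ne.symm h13))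
    (fun h => h23 (sub_left_injective h))
    (inc_chord m w1 w2 u0 ((Inc_symm _ _ _).1 i01) ((Inc_symm _ _ _).1 i02))
    (inc_chord m w1 w3 u0 ((Inc_symm _ _ _).1 i01) ((Inc_symm _ _ _).1 i03))
  have ep : e ⬝ᵥ p = 0 := inc_perp m u0 u1 w1 w2 i01 i02 i11 i12
  have eq : e ⬝ᵥ q = 0 := inc_perp m u0 u1 w1 w3 i01 i03 i11 i13
  have gp : g ⬝ᵥ p = 0 := inc_perp m u0 u2 w1 w2 i01 i02 i21 i22
  have gq : g ⬝ᵥ q = 0 := inc_perp m u0 u2 w1 w3 i01 i03 i21 i23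
  have hA4 : g ⬝ᵥ g ≤ 4 * m := inc_chord_le m u0 u2 w1 i01 i21
  have hC4 : e ⬝ᵥ e ≤ 4 * m := inc_chord_le m u0 u1 w1 i01 i11
  have nn : ∀ v : Fin 4 → ℤ, 0 ≤ v ⬝ᵥ v := fun v => Finset.sum_nonneg (fun i _ => mul_self_nonneg _)
  have hA0 := nn g
  have hC0 := nn e
  have hgne : g ⬝ᵥ g ≠ 0 := fun h => (sub_ne_zero.2 (Ne.symm h02)) (dotProduct_self_eq_zero.1 h)
  have hge : g ⬝ᵥ e = e ⬝ᵥ g := dotProduct_comm _ _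
  have lin : ∀ u ∈ F, ((g ⬝ᵥ g) * (e ⬝ᵥ e) - (e ⬝ᵥ g)^2) • (u - u0) =
      ((g ⬝ᵥ g) * ((u - u0) ⬝ᵥ e) - (e ⬝ᵥ g) * ((u - u0) ⬝ᵥ g)) • e +
      ((e ⬝ᵥ e) * ((u - u0) ⬝ᵥ g) - (e ⬝ᵥ g) * ((u - u0) ⬝ᵥ e)) • g := by
    intro u hu
    obtain ⟨j1, j2, j3⟩ := hF u hu
    have xp : (u - u0) ⬝ᵥ p = 0 := inc_perp m u0 u w1 w2 i01 i02 j1 j2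
    have xq : (u - u0) ⬝ᵥ q = 0 := inc_perp m u0 u w1 w3 i01 i03 j1 j3
    rw [← sub_eq_zero]
    generalize u - u0 = x at *
    refine indep_four e g p q _ hΔ hΔ2 ep eq gp gq ?_ ?_ ?_ ?_
    · simp only [sub_dotProduct, add_dotProduct, smul_dotProduct, smul_eq_mul, hge]; ring
    · simp only [sub_dotProduct, add_dotProduct, smul_dotProduct, smul_eq_mul, hge]; ring
    · simp only [sub_dotProduct, add_dotProduct, smul_dotProduct, smul_eq_mul, xp, ep, gp]; ring
    · simp only [sub_dotProduct, add_dotProduct, smul_dotProduct, smul_eq_mul, xq, eq, gq]; ring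
  have xc : ∀ u ∈ F, (u - u0) ⬝ᵥ (u - u0) = -2 * ((u - u0) ⬝ᵥ c) := fun u hu =>
    inc_chord m u0 u w1 i01 (hF u hu).1
  have hMb := M_bound (g ⬝ᵥ g) (e ⬝ᵥ g) (e ⬝ᵥ e) m (by positivity) hA0 hC0 hA4 hC4 hΔ
  set A := g ⬝ᵥ g with hA
  set B := e ⬝ᵥ g with hB
  set C := e ⬝ᵥ e with hC
  set Δ := A * C - B^2 with hΔd
  set k := A * B * (C - B) + A * C * (A - B) with hk
  set MM := Δ * (A * (C - B))^2 + k^2 with hMM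
  have conic : ∀ u ∈ F, (2 * Δ * ((u - u0) ⬝ᵥ g) - k)^2 +
      Δ * (2 * (A * ((u - u0) ⬝ᵥ e) - B * ((u - u0) ⬝ᵥ g)) - A * (C - B))^2 = MM := by
    intro u hu
    have l := lin u hu
    have x2 := xc u hu
    generalize u - u0 = x at *
    have l1 := congrArg (fun y => y ⬝ᵥ c) l
    have l2 := congrArg (fun y => y ⬝ᵥ x) l
    simp only [add_dotProduct, smul_dotProduct, smul_eq_mul] at l1 l2
    rw [dotProduct_comm e x, dotProduct_comm g x] at l2
    generalize x ⬝ᵥ e = X at *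
    generalize x ⬝ᵥ g = Y at *
    have hcon : A * X^2 - 2 * B * X * Y + C * Y^2 = (A * C - A * B) * X + (A * C - B * C) * Y := by
      linear_combination (-1) * l2 + Δ * x2 - 2 * l1 - (A * X - B * Y) * hc1 - (C * Y - B * X) * hc2
    rw [hMM, hk]
    linear_combination (exp := 1) 4 * A * Δ * hcon
  let f : (Fin 4 → ℤ) → ℤ × ℤ := fun u => (2 * Δ * ((u - u0) ⬝ᵥ g) - k,
      2 * (A * ((u - u0) ⬝ᵥ e) - B * ((u - u0) ⬝ᵥ g)) - A * (C - B))
  have finj : Set.InjOn f F := by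
    intro u hu u' hu' h
    have hh := Prod.mk.inj h
    have hY : (u - u0) ⬝ᵥ g = (u' - u0) ⬝ᵥ g := by
      have : Δ * ((u - u0) ⬝ᵥ g) = Δ * ((u' - u0) ⬝ᵥ g) := by linarith [hh.1]
      exact mul_left_cancel₀ hΔ.ne' this
    have hX : (u - u0) ⬝ᵥ e = (u' - u0) ⬝ᵥ e := by
      have h2 := hh.2
      rw [hY] at h2
      have : A * ((u - u0) ⬝ᵥ e) = A * ((u' - u0) ⬝ᵥ e) := by linarith
      exact mul_left_cancel₀ hgne this
    have l := lin u hu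
    rw [hX, hY, ← lin u' hu'] at l
    have l2 := smul_right_injective (Fin 4 → ℤ) hΔ.ne' l
    exact sub_left_injective l2
  have hMpos : 0 < MM := by
    have h0 : 0 ≤ MM := by positivity
    refine lt_of_le_of_ne h0 (fun hz => h01 (finj m0 m1 ?_))
    have z : ∀ u ∈ F, f u = (0, 0) := by
      intro u hu
      have h := conic u hu
      rw [← hz] at h
      have a1 : (2 * Δ * ((u - u0) ⬝ᵥ g) - k)^2 = 0 := by
        have := mul_nonneg hΔ.le (sq_nonneg (2 * (A * ((u - u0) ⬝ᵥ e) - B * ((u - u0) ⬝ᵥ g)) - A * (C - B)))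
        have := sq_nonneg (2 * Δ * ((u - u0) ⬝ᵥ g) - k)
        linarith
      rw [a1, zero_add] at h
      have a2 := (mul_eq_zero.1 h).resolve_left hΔ.ne'
      exact Prod.ext (pow_eq_zero_iff (two_ne_zero) |>.1 a1) (pow_eq_zero_iff (two_ne_zero) |>.1 a2)
    rw [z u0 m0, z u1 m1]
  classical
  have hcount := hK Δ.toNat MM.toNat (by omega) (by omega) (F.image f) (by
    intro x hx
    obtain ⟨u, hu, rfl⟩ := mem_image.1 hx
    rw [Int.toNat_of_nonneg hΔ.le, Int.toNat_of_nonneg hMpos.le]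
    exact conic u hu)
  rw [card_image_of_injOn finj] at hcount
  have hMr : (MM.toNat : ℝ) ≤ 81920 * (m:ℝ)^6 := by
    have : (MM.toNat : ℤ) ≤ 81920 * (m:ℤ)^6 := by rw [Int.toNat_of_nonneg hMpos.le]; exact hMb
    exact_mod_cast this
  calc (#F:ℝ) ≤ K * (MM.toNat:ℝ)^(ε/6) := hcount
    _ ≤ K * (81920 * (m:ℝ)^6)^(ε/6) := by gcongr
    _ = K * (81920:ℝ)^(ε/6) * (m:ℝ)^ε := by
        rw [Real.mul_rpow (by norm_num) (by positivity), ← Real.rpow_natCast (m:ℝ) 6, ← Real.rpow_mul (Nat.cast_nonneg _)]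
        rw [← mul_assoc]; congr 2; push_cast; ring
    _ ≤ _ := by gcongr; linarith


/-! ### Dyadic decomposition -/

theorem level_one (X w Y N2 : ℝ) (hX : 0 < X) (hw : 0 < w) (hY : 0 ≤ Y)
    (h : X * w ≤ Y * w^((8:ℝ)/11)) (hN : X * w ≤ N2) :
    X^2 * w ≤ Y^((11:ℝ)/8) * N2^((5:ℝ)/8) := by
  have hXw : 0 < X * w := mul_pos hX hw
  have h1 : (X * w)^((11:ℝ)/8) ≤ Y^((11:ℝ)/8) * w := by
    calc (X * w)^((11:ℝ)/8) ≤ (Y * w^((8:ℝ)/11))^((11:ℝ)/8) := by gcongr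
      _ = Y^((11:ℝ)/8) * w := by
        rw [Real.mul_rpow hY (by positivity), ← Real.rpow_mul hw.le]
        norm_num
  have h2 : (X * w)^((11:ℝ)/8) * (X * w)^((5:ℝ)/8) = (X^2 * w) * w := by
    rw [← Real.rpow_add hXw]
    norm_num
    ring
  have h3 : (X^2 * w) * w ≤ (Y^((11:ℝ)/8) * N2^((5:ℝ)/8)) * w := by
    rw [← h2]
    calc (X * w)^((11:ℝ)/8) * (X * w)^((5:ℝ)/8) ≤ (Y^((11:ℝ)/8) * w) * N2^((5:ℝ)/8) := by gcongr
      _ = _ := by ring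
  exact le_of_mul_le_mul_right h3 hw

open Classical in
theorem dyadic {α : Type} (inc : α → α → Prop) (U W : Finset α) (f g : α → ℕ) (N t J : ℕ) (ht : 1 ≤ t)
    (hN : 1 ≤ N) (K : ℝ) (hK : 1 ≤ K)
    (hI : ∀ U' ⊆ U, ∀ W' ⊆ W, W'.Nonempty → (II inc U' W' : ℝ) ≤ K * ((#U':ℝ)^((9:ℝ)/11) * (#W':ℝ)^((8:ℝ)/11) + #U' + #W'))
    (h0 : ∀ w ∈ W, g w ≤ ∑ u ∈ U with inc u w, f u)
    (f1 : ∀ u ∈ U, 1 ≤ f u) (g1 : ∀ w ∈ W, 1 ≤ g w)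
    (fs : ∑ u ∈ U, f u ≤ N^t) (gs : ∑ w ∈ W, g w ≤ N^(t+1))
    (fm : ∀ u ∈ U, f u ≤ N^(t-1)) (gm : ∀ w ∈ W, g w ≤ N^t)
    (hJ : Nat.log 2 (N^t) < J) :
    ((∑ w ∈ W, g w ^ 2 : ℕ) : ℝ) ≤ 144 * K^2 * (J:ℝ)^3 *
      ((N:ℝ)^((12 * (t:ℝ) + 5)/8) * ((∑ u ∈ U, f u ^ 2 : ℕ) : ℝ)^((1:ℝ)/4) + (N:ℝ)^(2 * t)) := by
  set E : ℝ := ((∑ u ∈ U, f u ^ 2 : ℕ) : ℝ) with hE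
  have hE0 : 0 ≤ E := Nat.cast_nonneg _
  have hNr : (1:ℝ) ≤ N := by exact_mod_cast hN
  have hN0 : (0:ℝ) < N := by linarith
  have hJ1 : (1:ℝ) ≤ J := by exact_mod_cast (by omega : 1 ≤ J)
  let Uj : ℕ → Finset α := fun j => U.filter (fun u => Nat.log 2 (f u) = j)
  let Wk : ℕ → Finset α := fun k => W.filter (fun w => Nat.log 2 (g w) = k)
  have fJ : ∀ u ∈ U, Nat.log 2 (f u) ∈ range J := by
    intro u hu
    rw [mem_range]
    refine lt_of_le_of_lt (Nat.log_mono_right ((fm u hu).trans (Nat.pow_le_pow_right hN (by omega)))) hJ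
  have gJ : ∀ w ∈ W, Nat.log 2 (g w) ∈ range J := by
    intro w hw
    rw [mem_range]
    exact lt_of_le_of_lt (Nat.log_mono_right (gm w hw)) hJ
  have hUlo : ∀ j, ∀ u ∈ Uj j, 2^j ≤ f u := by
    intro j u hu
    obtain ⟨hu2, rfl⟩ := mem_filter.1 hu
    exact Nat.pow_log_le_self 2 (by have := f1 u hu2; omega)
  have hUhi : ∀ j, ∀ u ∈ Uj j, f u ≤ 2 * 2^j := by
    intro j u hu
    obtain ⟨hu2, rfl⟩ := mem_filter.1 hu
    have := Nat.lt_pow_succ_log_self (b := 2) (by norm_num) (f u)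
    rw [pow_succ] at this
    omega
  have hWlo : ∀ j, ∀ u ∈ Wk j, 2^j ≤ g u := by
    intro j u hu
    obtain ⟨hu2, rfl⟩ := mem_filter.1 hu
    exact Nat.pow_log_le_self 2 (by have := g1 u hu2; omega)
  have hWhi : ∀ j, ∀ u ∈ Wk j, g u ≤ 2 * 2^j := by
    intro j u hu
    obtain ⟨hu2, rfl⟩ := mem_filter.1 hu
    have := Nat.lt_pow_succ_log_self (b := 2) (by norm_num) (g u)
    rw [pow_succ] at this
    omega
  have hUs : ∀ j, Uj j ⊆ U := fun j => filter_subset _ _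
  have hWs : ∀ j, Wk j ⊆ W := fun j => filter_subset _ _
  have U1 : ∀ j, (2:ℝ)^j * #(Uj j) ≤ (N:ℝ)^t := by
    intro j
    have : 2^j * #(Uj j) ≤ N^t := by
      calc 2^j * #(Uj j) = ∑ u ∈ Uj j, 2^j := by rw [sum_const, smul_eq_mul, mul_comm]
        _ ≤ ∑ u ∈ Uj j, f u := sum_le_sum (hUlo j)
        _ ≤ ∑ u ∈ U, f u := sum_le_sum_of_subset (hUs j)
        _ ≤ _ := fs
    exact_mod_cast this
  have U2 : ∀ j, ((2:ℝ)^j)^2 * #(Uj j) ≤ E := by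
    intro j
    have : (2^j)^2 * #(Uj j) ≤ ∑ u ∈ U, f u ^ 2 := by
      calc (2^j)^2 * #(Uj j) = ∑ u ∈ Uj j, (2^j)^2 := by rw [sum_const, smul_eq_mul, mul_comm]
        _ ≤ ∑ u ∈ Uj j, (f u)^2 := sum_le_sum (fun u hu => Nat.pow_le_pow_left (hUlo j u hu) 2)
        _ ≤ _ := sum_le_sum_of_subset (hUs j)
    rw [hE]
    exact_mod_cast this
  have W1 : ∀ j, (2:ℝ)^j * #(Wk j) ≤ (N:ℝ)^(t+1) := by
    intro j
    have : 2^j * #(Wk j) ≤ N^(t+1) := by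
      calc 2^j * #(Wk j) = ∑ u ∈ Wk j, 2^j := by rw [sum_const, smul_eq_mul, mul_comm]
        _ ≤ ∑ u ∈ Wk j, g u := sum_le_sum (hWlo j)
        _ ≤ ∑ u ∈ W, g u := sum_le_sum_of_subset (hWs j)
        _ ≤ _ := gs
    exact_mod_cast this
  have lev : ∀ k, (Wk k).Nonempty → (2:ℝ)^k * #(Wk k) ≤ J * (2 * K * ((N:ℝ)^(7 * (t:ℝ)/11) * E^((2:ℝ)/11) * (#(Wk k):ℝ)^((8:ℝ)/11)
      + (N:ℝ)^t + (N:ℝ)^(t-1) * #(Wk k))) := by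
    intro k hne
    have a1 : 2^k * #(Wk k) ≤ ∑ j ∈ range J, 2 * 2^j * II inc (Uj j) (Wk k) := by
      calc 2^k * #(Wk k) = ∑ w ∈ Wk k, 2^k := by rw [sum_const, smul_eq_mul, mul_comm]
        _ ≤ ∑ w ∈ Wk k, ∑ u ∈ U with inc u w, f u :=
            sum_le_sum (fun w hw => (hWlo k w hw).trans (h0 w (hWs k hw)))
        _ = ∑ w ∈ Wk k, ∑ u ∈ U, if inc u w then f u else 0 := by simp only [sum_filter]
        _ = ∑ u ∈ U, ∑ w ∈ Wk k, if inc u w then f u else 0 := sum_comm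
        _ = ∑ u ∈ U, f u * #((Wk k).filter (fun w => inc u w)) := by
            refine sum_congr rfl (fun u _ => ?_)
            rw [← sum_filter, sum_const, smul_eq_mul, mul_comm]
        _ = ∑ j ∈ range J, ∑ u ∈ Uj j, f u * #((Wk k).filter (fun w => inc u w)) :=
            (sum_fiberwise_of_maps_to fJ _).symm
        _ ≤ ∑ j ∈ range J, ∑ u ∈ Uj j, 2 * 2^j * #((Wk k).filter (fun w => inc u w)) := by
            gcongr with j hj u hu
            exact hUhi j u hu
        _ = _ := by
            refine sum_congr rfl (fun j _ => ?_)
            rw [II, mul_sum]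
    have a2 : (2:ℝ)^k * #(Wk k) ≤ ∑ j ∈ range J, 2 * (2:ℝ)^j * (II inc (Uj j) (Wk k) : ℝ) := by
      exact_mod_cast a1
    refine a2.trans ?_
    rw [show (J:ℝ) = (#(range J):ℝ) by simp, ← nsmul_eq_mul]
    refine sum_le_card_nsmul _ _ _ (fun j _ => ?_)
    rcases (Uj j).eq_empty_or_nonempty with h | h
    · rw [h, II, sum_empty]
      simp only [Nat.cast_zero, mul_zero]
      positivity
    have b1 : (2:ℝ)^j ≤ (N:ℝ)^(t-1) := by
      obtain ⟨u, hu⟩ := h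
      have : 2^j ≤ N^(t-1) := (hUlo j u hu).trans (fm u (hUs j hu))
      exact_mod_cast this
    have b2 := hI (Uj j) (hUs j) (Wk k) (hWs k) hne
    have hx : (0:ℝ) < #(Uj j) := by exact_mod_cast card_pos.2 h
    have b3 : (2:ℝ)^j * (#(Uj j):ℝ)^((9:ℝ)/11) ≤ (N:ℝ)^(7 * (t:ℝ)/11) * E^((2:ℝ)/11) := by
      have c1 : (2:ℝ)^j * (#(Uj j):ℝ)^((9:ℝ)/11) = ((2:ℝ)^j * #(Uj j))^((7:ℝ)/11) * (((2:ℝ)^j)^2 * #(Uj j))^((2:ℝ)/11) := by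
        have p0 : (0:ℝ) < (2:ℝ)^j := by positivity
        generalize (2:ℝ)^j = z at *
        rw [Real.mul_rpow p0.le hx.le, Real.mul_rpow (by positivity) hx.le, ← Real.rpow_natCast z 2, ← Real.rpow_mul p0.le]
        calc z * (#(Uj j):ℝ)^((9:ℝ)/11) = z^((7:ℝ)/11 + ((2:ℕ):ℝ) * (2/11)) * (#(Uj j):ℝ)^((7:ℝ)/11 + 2/11) := by norm_num
          _ = _ := by rw [Real.rpow_add p0, Real.rpow_add hx]; ring
      rw [c1]
      have c2 : (N:ℝ)^(7 * (t:ℝ)/11) = ((N:ℝ)^t)^((7:ℝ)/11) := by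
        rw [← Real.rpow_natCast (N:ℝ) t, ← Real.rpow_mul hN0.le]; congr 1; ring
      rw [c2]
      have := U1 j
      have := U2 j
      gcongr
    calc 2 * (2:ℝ)^j * (II inc (Uj j) (Wk k) : ℝ) ≤ 2 * (2:ℝ)^j * (K * ((#(Uj j):ℝ)^((9:ℝ)/11) * (#(Wk k):ℝ)^((8:ℝ)/11) + #(Uj j) + #(Wk k))) := by gcongr
      _ = 2 * K * (((2:ℝ)^j * (#(Uj j):ℝ)^((9:ℝ)/11)) * (#(Wk k):ℝ)^((8:ℝ)/11) + (2:ℝ)^j * #(Uj j) + (2:ℝ)^j * #(Wk k)) := by ring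
      _ ≤ _ := by
        have := U1 j
        gcongr
  set Q : ℝ := 6 * K * J with hQ
  have hQ1 : 1 ≤ Q := by nlinarith
  set main : ℝ := (N:ℝ)^((12 * (t:ℝ) + 5)/8) * E^((1:ℝ)/4) with hmain
  have hmain0 : 0 ≤ main := by positivity
  have lev2 : ∀ k, ((2:ℝ)^k)^2 * #(Wk k) ≤ Q^2 * (main + (N:ℝ)^(2*t)) := by
    intro k
    rcases (Wk k).eq_empty_or_nonempty with h | h
    · rw [h]; simp; positivity
    have hl := lev k h
    have hw : (0:ℝ) < #(Wk k) := by exact_mod_cast card_pos.2 h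
    have hX : (2:ℝ)^k ≤ (N:ℝ)^t := by
      obtain ⟨w, hw⟩ := h
      have : 2^k ≤ N^t := (hWlo k w hw).trans (gm w (hWs k hw))
      exact_mod_cast this
    have hXp : (0:ℝ) < (2:ℝ)^k := by positivity
    have hw1 := W1 k
    generalize (2:ℝ)^k = X at *
    generalize (#(Wk k):ℝ) = w at *
    have hQQ : Q ≤ Q^2 := by nlinarith
    have hNt : (0:ℝ) ≤ (N:ℝ)^(2*t) := by positivity
    have hcase : X * w ≤ (Q * ((N:ℝ)^(7 * (t:ℝ)/11) * E^((2:ℝ)/11))) * w^((8:ℝ)/11) ∨ X * w ≤ Q * (N:ℝ)^t ∨ X * w ≤ Q * ((N:ℝ)^(t-1) * w) := by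
      by_contra hcon
      push Not at hcon
      obtain ⟨c1, c2, c3⟩ := hcon
      rw [hQ] at c1 c2 c3
      nlinarith
    rcases hcase with h1 | h1 | h1
    · have := level_one X w _ _ hXp hw (by positivity) h1 hw1
      refine this.trans ?_
      have e1 : (Q * ((N:ℝ)^(7 * (t:ℝ)/11) * E^((2:ℝ)/11)))^((11:ℝ)/8) * ((N:ℝ)^(t+1))^((5:ℝ)/8) = Q^((11:ℝ)/8) * main := by
        rw [Real.mul_rpow (x := Q) (by positivity) (by positivity), Real.mul_rpow (y := E^((2:ℝ)/11)) (by positivity) (by positivity),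
          ← Real.rpow_mul hN0.le, ← Real.rpow_mul hE0, ← Real.rpow_natCast (N:ℝ) (t+1), ← Real.rpow_mul hN0.le, hmain]
        rw [show (2:ℝ)/11 * (11/8) = 1/4 by norm_num]
        rw [show (12 * (t:ℝ) + 5)/8 = 7 * (t:ℝ)/11 * (11/8) + ((t+1:ℕ):ℝ) * (5/8) by push_cast; ring, Real.rpow_add hN0]
        ring
      rw [e1]
      have e2 : Q^((11:ℝ)/8) ≤ Q^2 := by
        rw [← Real.rpow_natCast Q 2]
        exact Real.rpow_le_rpow_of_exponent_le hQ1 (by norm_num)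
      calc Q^((11:ℝ)/8) * main ≤ Q^2 * main := by gcongr
        _ ≤ _ := by gcongr; linarith
    · calc X^2 * w = X * (X * w) := by ring
        _ ≤ (N:ℝ)^t * (Q * (N:ℝ)^t) := by gcongr
        _ = Q * (N:ℝ)^(2*t) := by ring
        _ ≤ Q^2 * (N:ℝ)^(2*t) := by gcongr
        _ ≤ _ := by gcongr; linarith
    · have h2 : X ≤ Q * (N:ℝ)^(t-1) := by
        rw [← mul_assoc] at h1
        exact le_of_mul_le_mul_right h1 hw
      calc X^2 * w = X * (X * w) := by ring
        _ ≤ (Q * (N:ℝ)^(t-1)) * (N:ℝ)^(t+1) := by gcongr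
        _ = Q * (N:ℝ)^(2*t) := by
          rw [mul_assoc, ← pow_add]; congr 2; omega
        _ ≤ Q^2 * (N:ℝ)^(2*t) := by gcongr
        _ ≤ _ := by gcongr; linarith
  have fin1 : ((∑ w ∈ W, g w ^ 2 : ℕ) : ℝ) ≤ ∑ k ∈ range J, 4 * (((2:ℝ)^k)^2 * #(Wk k)) := by
    have : ∑ w ∈ W, g w ^ 2 ≤ ∑ k ∈ range J, 4 * ((2^k)^2 * #(Wk k)) := by
      rw [← sum_fiberwise_of_maps_to gJ]
      refine sum_le_sum (fun k _ => ?_)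
      calc ∑ w ∈ Wk k, g w ^ 2 ≤ ∑ w ∈ Wk k, (2 * 2^k)^2 := sum_le_sum (fun w hw => Nat.pow_le_pow_left (hWhi k w hw) 2)
        _ = _ := by rw [sum_const, smul_eq_mul]; ring
    exact_mod_cast this
  calc ((∑ w ∈ W, g w ^ 2 : ℕ) : ℝ) ≤ ∑ k ∈ range J, 4 * (((2:ℝ)^k)^2 * #(Wk k)) := fin1
    _ ≤ ∑ k ∈ range J, 4 * (Q^2 * (main + (N:ℝ)^(2*t))) := by
        refine sum_le_sum (fun k _ => ?_)
        have := lev2 k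
        linarith
    _ = _ := by rw [sum_const, card_range, nsmul_eq_mul, hQ]; ring


/-! ### Logarithmic factors and the incidence bound -/

theorem polylog (κ n : ℕ) (ε : ℝ) (hε : 0 < ε) : ∃ K : ℝ, 1 ≤ K ∧ ∀ m : ℕ, 0 < m →
    (1 + Real.log (8 * (3 * (m:ℝ))^κ))^n ≤ K * (m:ℝ)^ε := by
  set δ : ℝ := ε / (n + 1) with hδ
  have hδ0 : 0 < δ := by positivity
  set c : ℝ := 1 + Real.log 8 + κ * Real.log 3 + κ with hc
  have l8 : 0 ≤ Real.log 8 := Real.log_nonneg (by norm_num)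
  have l3 : 0 ≤ Real.log 3 := Real.log_nonneg (by norm_num)
  have hc1 : 1 ≤ c := by
    have : (0:ℝ) ≤ κ := Nat.cast_nonneg _
    have := mul_nonneg this l3
    rw [hc]; linarith
  set b : ℝ := c * (1 + 1 / δ) with hb
  have hb1 : 1 ≤ b := by
    have : 0 ≤ 1 / δ := by positivity
    rw [hb]; nlinarith
  refine ⟨b^n, one_le_pow₀ hb1, fun m hm => ?_⟩
  have hm1 : (1:ℝ) ≤ m := by exact_mod_cast hm
  have hlm : 0 ≤ Real.log m := Real.log_nonneg hm1
  have h1 : Real.log m ≤ (m:ℝ)^δ / δ := Real.log_le_rpow_div (by linarith) hδ0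
  have h2 : (1:ℝ) ≤ (m:ℝ)^δ := Real.one_le_rpow hm1 hδ0.le
  have h3 : Real.log (8 * (3 * (m:ℝ))^κ) = Real.log 8 + κ * (Real.log 3 + Real.log m) := by
    rw [Real.log_mul (by norm_num) (by positivity), Real.log_pow, Real.log_mul (by norm_num) (by positivity)]
  have h5 : 1 + Real.log (8 * (3 * (m:ℝ))^κ) ≤ b * (m:ℝ)^δ := by
    have hκ : (0:ℝ) ≤ κ := Nat.cast_nonneg _
    calc 1 + Real.log (8 * (3 * (m:ℝ))^κ) ≤ c * (1 + Real.log m) := by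
          rw [h3, hc]
          nlinarith [mul_nonneg hκ l3, mul_nonneg (mul_nonneg hκ l3) hlm, mul_nonneg l8 hlm]
      _ ≤ c * ((m:ℝ)^δ + (m:ℝ)^δ / δ) := by gcongr
      _ = b * (m:ℝ)^δ := by rw [hb]; ring
  have h6 : 0 ≤ 1 + Real.log (8 * (3 * (m:ℝ))^κ) := by rw [h3]; positivity
  calc (1 + Real.log (8 * (3 * (m:ℝ))^κ))^n ≤ (b * (m:ℝ)^δ)^n := by gcongr
    _ = b^n * (m:ℝ)^(δ * n) := by rw [mul_pow, ← Real.rpow_natCast ((m:ℝ)^δ) n, ← Real.rpow_mul (by linarith)]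
    _ ≤ b^n * (m:ℝ)^ε := by
      gcongr
      rw [hδ, div_mul_eq_mul_div, div_le_iff₀ (by positivity)]
      nlinarith

theorem log_le_Z (κ m n : ℕ) (hm : 0 < m) (hn : (n:ℝ) ≤ (3 * (m:ℝ))^κ) :
    ((Nat.log 2 n + 1 : ℕ) : ℝ) ≤ 2 * (1 + Real.log (8 * (3 * (m:ℝ))^κ)) := by
  have hm1 : (1:ℝ) ≤ m := by exact_mod_cast hm
  have hp : (1:ℝ) ≤ (3 * (m:ℝ))^κ := one_le_pow₀ (by linarith)
  have h0 : 0 ≤ Real.log (8 * (3 * (m:ℝ))^κ) := Real.log_nonneg (by linarith)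
  rcases Nat.eq_zero_or_pos n with rfl | hpos
  · simp; linarith
  have h1 : (2:ℝ)^(Nat.log 2 n) ≤ n := by exact_mod_cast Nat.pow_log_le_self 2 hpos.ne'
  have h2 : (Nat.log 2 n : ℝ) * Real.log 2 ≤ Real.log (8 * (3 * (m:ℝ))^κ) := by
    rw [← Real.log_pow]
    exact Real.log_le_log (by positivity) (by linarith)
  have h3 := Real.log_two_gt_d9
  have h4 : (0:ℝ) ≤ (Nat.log 2 n : ℝ) := Nat.cast_nonneg _
  push_cast
  nlinarith

open Classical in
theorem inc_bound (κ : ℕ) (ε : ℝ) (hε : 0 < ε) : ∃ K : ℝ, 1 ≤ K ∧ ∀ m : ℕ, 0 < m →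
    ∀ U W : Finset (Fin 4 → ℤ), W.Nonempty → (#U:ℝ) ≤ (3 * (m:ℝ))^κ → (#W:ℝ) ≤ (3 * (m:ℝ))^κ →
    (II (Inc m) U W : ℝ) ≤ K * (m:ℝ)^ε * ((#U:ℝ)^((9:ℝ)/11) * (#W:ℝ)^((8:ℝ)/11) + #U + #W) := by
  obtain ⟨K1, hK1, h1⟩ := polylog κ 100 (ε/2) (by positivity)
  obtain ⟨K2, hK2, h2⟩ := three_count (ε/2) (by positivity)
  have hKP : 1 ≤ KP := by rw [KP]; norm_num
  refine ⟨32 * K2 * (4 * KP)^11 * K1, ?_, ?_⟩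
  · have : 1 ≤ (4 * KP)^11 := one_le_pow₀ (by linarith)
    have a : 1 ≤ 32 * K2 := by linarith
    exact one_le_mul_of_one_le_of_one_le (one_le_mul_of_one_le_of_one_le a this) hK1
  intro m hm U W hW hUc hWc
  have hm1 : (1:ℝ) ≤ m := by exact_mod_cast hm
  set t : ℝ := K2 * (m:ℝ)^(ε/2) with ht
  have ht1 : 1 ≤ t := one_le_mul_of_one_le_of_one_le hK2 (Real.one_le_rpow hm1 (by positivity))
  set Z : ℝ := 1 + Real.log (8 * (3 * (m:ℝ))^κ) with hZ
  set L : ℝ := KP * (1 + Real.log (8 * #W))^9 with hL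
  have hWp : (1:ℝ) ≤ #W := by exact_mod_cast card_pos.2 hW
  have hlW : 0 ≤ Real.log (8 * #W) := Real.log_nonneg (by linarith)
  have hL1 : 1 ≤ L := one_le_mul_of_one_le_of_one_le hKP (one_le_pow₀ (by linarith))
  have hLZ : L ≤ KP * Z^9 := by
    rw [hL, hZ]; gcongr
  have hZ1 : 1 ≤ Z := by
    have : (1:ℝ) ≤ (3 * (m:ℝ))^κ := one_le_pow₀ (by linarith)
    have := Real.log_nonneg (show (1:ℝ) ≤ 8 * (3 * (m:ℝ))^κ by linarith)
    rw [hZ]; linarith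
  have hi := incidence (Inc m) U W L t ht1 hL1 hW (fun U' _ r hr => part_thm m W U' hW r hr)
    (by
      intro T _ hT
      obtain ⟨a, b, c, hab, hac, hbc, rfl⟩ := card_eq_three.1 hT
      refine h2 m hm a b c hab hac hbc _ (fun w hw => ?_)
      have := (mem_filter.1 hw).2
      refine ⟨(Inc_symm _ _ _).1 (this a (by simp)), (Inc_symm _ _ _).1 (this b (by simp)), (Inc_symm _ _ _).1 (this c (by simp))⟩)
    (by
      intro T _ hT
      obtain ⟨a, b, c, hab, hac, hbc, rfl⟩ := card_eq_three.1 hT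
      refine h2 m hm a b c hab hac hbc _ (fun w hw => ?_)
      have := (mem_filter.1 hw).2
      exact ⟨this a (by simp), this b (by simp), this c (by simp)⟩)
    (Nat.log 2 (#U) + 1) U subset_rfl (Nat.lt_pow_succ_log_self (by norm_num) _)
  have hk := log_le_Z κ m (#U) hm hUc
  rw [← hZ] at hk
  refine hi.trans ?_
  set S : ℝ := (#U:ℝ)^((9:ℝ)/11) * (#W:ℝ)^((8:ℝ)/11) + #U + #W with hS
  have hS0 : 0 ≤ S := by positivity
  calc ((Nat.log 2 (#U) + 1 : ℕ) : ℝ) * (16 * t * (4 * L)^11 * S) ≤ (2 * Z) * (16 * t * (4 * (KP * Z^9))^11 * S) := by gcongr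
    _ = 32 * K2 * (4 * KP)^11 * Z^100 * (m:ℝ)^(ε/2) * S := by rw [ht]; ring
    _ ≤ 32 * K2 * (4 * KP)^11 * (K1 * (m:ℝ)^(ε/2)) * (m:ℝ)^(ε/2) * S := by
        have := h1 m hm
        gcongr
    _ = 32 * K2 * (4 * KP)^11 * K1 * ((m:ℝ)^(ε/2) * (m:ℝ)^(ε/2)) * S := by ring
    _ = _ := by rw [← Real.rpow_add (by linarith), add_halves]


/-! ### Representation counts -/

section counts
variable (A : Finset (Fin 4 → ℤ))

open Classical in
/-- number of representations as an ordered sum -/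
def Rp (s : ℕ) (n : Fin 4 → ℤ) : ℕ := #((Fintype.piFinset (fun _ : Fin s => A)).filter (fun x => ∑ i, x i = n))

open Classical in
/-- the sumset -/
def Sm (s : ℕ) : Finset (Fin 4 → ℤ) := (Fintype.piFinset (fun _ : Fin s => A)).image (fun x => ∑ i, x i)

open Classical in
theorem Rp_sum (s : ℕ) : ∑ n ∈ Sm A s, Rp A s n = #A ^ s := by
  have h := card_eq_sum_card_image (fun x : Fin s → (Fin 4 → ℤ) => ∑ i, x i) (Fintype.piFinset (fun _ : Fin s => A))
  rw [Fintype.card_piFinset_const] at h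
  exact h.symm

theorem Rp_pos (s : ℕ) (n : Fin 4 → ℤ) (hn : n ∈ Sm A s) : 1 ≤ Rp A s n := by
  classical
  obtain ⟨x, hx, rfl⟩ := mem_image.1 hn
  exact card_pos.2 ⟨x, mem_filter.2 ⟨hx, rfl⟩⟩

theorem Rp_zero (s : ℕ) (n : Fin 4 → ℤ) (hn : n ∉ Sm A s) : Rp A s n = 0 := by
  classical
  rw [Rp, card_eq_zero, filter_eq_empty_iff]
  intro x hx h
  exact hn (mem_image.2 ⟨x, hx, h⟩)

theorem Sm_card (s : ℕ) : #(Sm A s) ≤ #A ^ s := by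
  classical
  rw [← Rp_sum A s, card_eq_sum_ones]
  exact sum_le_sum (fun n hn => Rp_pos A s n hn)

theorem Rp_succ (s : ℕ) (n : Fin 4 → ℤ) : Rp A (s+1) n = ∑ a ∈ A, Rp A s (n - a) := by
  classical
  rw [Rp, card_eq_sum_card_fiberwise (f := fun x : Fin (s+1) → (Fin 4 → ℤ) => x 0) (t := A)]
  · refine sum_congr rfl (fun a ha => ?_)
    rw [Rp]
    refine card_bij' (fun x _ => Fin.tail x) (fun y _ => (Fin.cons a y : Fin (s+1) → (Fin 4 → ℤ))) ?_ ?_ ?_ ?_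
    · intro x hx
      simp only [mem_filter, Fintype.mem_piFinset] at hx ⊢
      obtain ⟨⟨h1, h2⟩, h3⟩ := hx
      refine ⟨fun i => h1 _, ?_⟩
      rw [Fin.sum_univ_succ, h3] at h2
      rw [← h2, add_sub_cancel_left]
      rfl
    · intro y hy
      simp only [mem_filter, Fintype.mem_piFinset] at hy ⊢
      refine ⟨⟨fun i => ?_, ?_⟩, rfl⟩
      · refine Fin.cases ?_ (fun j => ?_) i
        · simpa using ha
        · simpa using hy.1 j
      · rw [Fin.sum_univ_succ]
        simp only [Fin.cons_zero, Fin.cons_succ]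
        rw [hy.2]; abel
    · intro x hx
      have := (mem_filter.1 hx).2
      subst this
      exact Fin.cons_self_tail x
    · intro y hy
      exact Fin.tail_cons (α := fun _ => Fin 4 → ℤ) a y
  · intro x hx
    have := (mem_filter.1 (mem_coe.1 hx)).1
    exact Fintype.mem_piFinset.1 this 0

theorem Rp_le (s : ℕ) : ∀ n, Rp A (s+1) n ≤ #A ^ s := by
  classical
  induction s with
  | zero =>
    intro n
    rw [pow_zero, Rp, card_le_one]
    intro x hx y hy
    have h1 := (mem_filter.1 hx).2
    have h2 := (mem_filter.1 hy).2
    simp only [Fin.sum_univ_succ, Fin.sum_univ_zero, add_zero] at h1 h2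
    funext i
    rw [Fin.fin_one_eq_zero i, h1, h2]
  | succ s ih =>
    intro n
    rw [Rp_succ]
    calc ∑ a ∈ A, Rp A (s+1) (n - a) ≤ ∑ a ∈ A, #A ^ s := sum_le_sum (fun a _ => ih _)
      _ = #A ^ (s+1) := by rw [sum_const, smul_eq_mul, pow_succ, mul_comm]

theorem energy_eq (s : ℕ) : addEnergy s (A : Set (Fin 4 → ℤ)) = ∑ n ∈ Sm A s, Rp A s n ^ 2 := by
  classical
  set P := Fintype.piFinset (fun _ : Fin s => A) with hP
  have h1 : addEnergy s (A : Set (Fin 4 → ℤ)) = #((P ×ˢ P).filter (fun p => ∑ i, p.1 i = ∑ i, p.2 i)) := by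
    rw [_root_.addEnergy]
    refine (Nat.subtype_card _ ?_)
    intro p
    simp only [mem_filter, mem_product, hP, Fintype.mem_piFinset, mem_coe]
    tauto
  rw [h1, card_eq_sum_card_fiberwise (f := fun p => ∑ i, p.1 i) (t := Sm A s)]
  · refine sum_congr rfl (fun n _ => ?_)
    rw [Rp, sq, ← card_product]
    congr 1
    ext p
    simp only [mem_filter, mem_product]
    constructor
    · rintro ⟨⟨⟨a, b⟩, c⟩, d⟩
      exact ⟨⟨a, d⟩, b, by rw [← c, d]⟩
    · rintro ⟨⟨a, d⟩, b, c⟩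
      exact ⟨⟨⟨a, b⟩, by rw [c, d]⟩, d⟩
  · intro p hp
    have := (mem_product.1 (mem_filter.1 (mem_coe.1 hp)).1).1
    exact mem_coe.2 (mem_image_of_mem _ this)

open Classical in
theorem Rp_inc (m : ℕ) (hA : (A : Set (Fin 4 → ℤ)) ⊆ latSphere 4 m) (s : ℕ) (w : Fin 4 → ℤ) :
    Rp A (s+1) w ≤ ∑ u ∈ Sm A s with Inc m u w, Rp A s u := by
  rw [Rp_succ]
  have h1 : ∑ a ∈ A, Rp A s (w - a) = ∑ u ∈ A.image (fun a => w - a), Rp A s u := by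
    rw [sum_image]
    intro a _ b _ h
    exact sub_right_injective h
  rw [h1]
  have h2 : ∑ u ∈ A.image (fun a => w - a), Rp A s u = ∑ u ∈ (A.image (fun a => w - a)).filter (fun u => u ∈ Sm A s), Rp A s u := by
    symm
    apply sum_filter_of_ne
    intro u _ hne
    by_contra hcon
    exact hne (Rp_zero A s u hcon)
  rw [h2]
  apply sum_le_sum_of_subset
  intro u hu
  obtain ⟨h3, h4⟩ := mem_filter.1 hu
  obtain ⟨a, ha, rfl⟩ := mem_image.1 h3
  refine mem_filter.2 ⟨h4, ?_⟩
  have := hA ha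
  simp only [latSphere, Set.mem_ofPred_eq] at this
  simpa [Inc] using this

theorem A_card (m : ℕ) (hm : 0 < m) (hA : (A : Set (Fin 4 → ℤ)) ⊆ latSphere 4 m) : (#A : ℝ) ≤ (3 * (m:ℝ))^4 := by
  have hsub : A ⊆ Fintype.piFinset (fun _ : Fin 4 => Icc (-(m:ℤ)) m) := by
    intro x hx
    have h := hA hx
    simp only [latSphere, Set.mem_ofPred_eq] at h
    rw [Fintype.mem_piFinset]
    intro i
    have h1 : x i ^ 2 ≤ m := by
      rw [← h]
      exact single_le_sum (f := fun i => x i ^ 2) (fun i _ => sq_nonneg _) (mem_univ i)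
    have hm' : (1:ℤ) ≤ m := by exact_mod_cast hm
    have h2 : |x i| ≤ m := abs_le_of_sq_le_sq (by nlinarith) (by linarith)
    rw [mem_Icc]
    exact abs_le.1 h2
  have h1 := card_le_card hsub
  rw [Fintype.card_piFinset_const, Int.card_Icc] at h1
  have h2 : ((m:ℤ) + 1 - -(m:ℤ)).toNat ≤ 3 * m := by omega
  have h3 := h1.trans (Nat.pow_le_pow_left h2 4)
  exact_mod_cast h3

end counts

/-! ### The main theorem -/

theorem statement_18 (s : ℕ) (hs : 2 ≤ s) (ε : ℝ) (hε : 0 < ε) :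
    ∃ C : ℝ, 0 < C ∧
      ∀ m : ℕ, 0 < m → ∀ A : Set (Fin 4 → ℤ), A.Finite → A.Nonempty → A ⊆ latSphere 4 m →
        (addEnergy s A : ℝ) ≤ C * (m : ℝ) ^ ε *
          ((A.ncard : ℝ) ^ ((12 * (s : ℝ) - 7) / 8) * (addEnergy (s - 1) A : ℝ) ^ ((1 : ℝ) / 4) +
            (A.ncard : ℝ) ^ (2 * (s : ℝ) - 2)) := by
  obtain ⟨t, rfl⟩ : ∃ t, s = t + 1 := ⟨s - 1, by omega⟩
  have ht : 1 ≤ t := by omega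
  obtain ⟨K, hK1, hK⟩ := inc_bound (4 * (t+1)) (ε/4) (by positivity)
  obtain ⟨K', hK1', hK'⟩ := polylog (4 * (t+1)) 3 (ε/2) (by positivity)
  refine ⟨144 * K^2 * (8 * K'), by positivity, ?_⟩
  intro m hm A0 hfin hne hsub
  obtain ⟨A, rfl⟩ := hfin.exists_finset_coe
  have hm1 : (1:ℝ) ≤ m := by exact_mod_cast hm
  have hN : 1 ≤ #A := card_pos.2 (by simpa using hne)
  have hAc := A_card A m hm hsub
  have hbig : ∀ i, i ≤ t + 1 → ((#A ^ i : ℕ) : ℝ) ≤ (3 * (m:ℝ))^(4 * (t+1)) := by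
    intro i hi
    push_cast
    calc (#A:ℝ)^i ≤ ((3 * (m:ℝ))^4)^i := by gcongr
      _ = (3 * (m:ℝ))^(4 * i) := by rw [← pow_mul]
      _ ≤ _ := pow_le_pow_right₀ (by linarith) (by omega)
  have hJ := log_le_Z (4 * (t+1)) m (#A ^ t) hm (hbig t (by omega))
  have hKm : 1 ≤ K * (m:ℝ)^(ε/4) := one_le_mul_of_one_le_of_one_le hK1 (Real.one_le_rpow hm1 (by positivity))
  have key := dyadic (Inc m) (Sm A t) (Sm A (t+1)) (Rp A t) (Rp A (t+1)) (#A) t (Nat.log 2 (#A ^ t) + 1) ht hN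
    (K * (m:ℝ)^(ε/4)) hKm
    (by
      intro U' hU' W' hW' hWne
      refine hK m hm U' W' hWne ?_ ?_
      · refine le_trans ?_ (hbig t (by omega))
        exact_mod_cast (card_le_card hU').trans (Sm_card A t)
      · refine le_trans ?_ (hbig (t+1) le_rfl)
        exact_mod_cast (card_le_card hW').trans (Sm_card A (t+1)))
    (fun w _ => Rp_inc A m hsub t w) (Rp_pos A t) (Rp_pos A (t+1)) (Rp_sum A t).le (Rp_sum A (t+1)).le
    (fun u _ => by
      obtain ⟨t', rfl⟩ : ∃ t', t = t' + 1 := ⟨t - 1, by omega⟩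
      exact Rp_le A t' u)
    (fun w _ => Rp_le A t w) (Nat.lt_succ_self _)
  rw [← energy_eq, ← energy_eq] at key
  rw [Set.ncard_coe_finset, Nat.add_sub_cancel]
  have e1 : (12 * ((t + 1 : ℕ) : ℝ) - 7) / 8 = (12 * (t:ℝ) + 5) / 8 := by push_cast; ring
  have e2 : ((#A:ℝ))^(2 * ((t + 1 : ℕ) : ℝ) - 2) = (#A:ℝ)^(2 * t) := by
    rw [← Real.rpow_natCast]; congr 1; push_cast; ring
  rw [e1, e2]
  refine key.trans ?_
  have hpl := hK' m hm
  set Z : ℝ := 1 + Real.log (8 * (3 * (m:ℝ))^(4 * (t+1))) with hZ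
  gcongr ?_ * _
  calc 144 * (K * (m:ℝ)^(ε/4))^2 * ((Nat.log 2 (#A ^ t) + 1 : ℕ) : ℝ)^3
      ≤ 144 * (K * (m:ℝ)^(ε/4))^2 * (2 * Z)^3 := by gcongr
    _ = 144 * K^2 * ((m:ℝ)^(ε/4))^2 * (8 * Z^3) := by ring
    _ ≤ 144 * K^2 * ((m:ℝ)^(ε/4))^2 * (8 * (K' * (m:ℝ)^(ε/2))) := by gcongr
    _ = 144 * K^2 * (8 * K') * (((m:ℝ)^(ε/4))^2 * (m:ℝ)^(ε/2)) := by ring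
    _ = _ := by
      rw [← Real.rpow_natCast ((m:ℝ)^(ε/4)) 2, ← Real.rpow_mul (by linarith), ← Real.rpow_add (by linarith)]
      congr 2; push_cast; ring
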